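/- Let p ∈ (0,1) and q ∈ [0,1]. There exists a probability space carrying both an elephant random walk {S_n}_{n≥0} with memory parameter p and initial parameter q, and a standard one-dimensional Brownian motion {B(t)}_{t≥0}, such that: (a) if 0 < p < 3/4, then almost surely S_n − (n^{2p−1}/√(3−4p)) B(n^{3−4p}) = o(√(n log log n)) as n → ∞; (b) if p = 3/4, then almost surely S_n − √n · B(log n) = o(√(n log n log log log n)) as n → ∞. -/

import Mathlib

open MeasureTheory ProbabilityTheory Filter Asymptotics

noncomputable section

/-- The step sequence `X 0, X 1, X 2, …` (with `X i` the `(i+1)`-th step) of an elephant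
random walk on `ℤ` with memory parameter `p` and initial parameter `q`. -/
def IsERW {Ω : Type*} [MeasurableSpace Ω] (P : Measure Ω) (p q : ℝ)
    (X : ℕ → Ω → ℤ) : Prop :=
  (∀ n, Measurable (X n)) ∧
  (∀ n ω, X n ω = 1 ∨ X n ω = -1) ∧
  ∀ (n : ℕ) (ε : ℕ → ℤ), (∀ i, ε i = 1 ∨ ε i = -1) →
    (P {ω | ∀ i ≤ n, X i ω = ε i}).toReal =
      (if ε 0 = 1 then q else 1 - q) *
        ∏ m ∈ Finset.range n,
          ((1 : ℝ) / (m + 1) *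
            ∑ i ∈ Finset.range (m + 1),
              (p * (if ε i = ε (m + 1) then 1 else 0) +
                (1 - p) * (if ε i = -ε (m + 1) then 1 else 0)))

/-- A centered Gaussian process on `[0,∞)`. -/
def IsCenteredGaussianProcess {Ω : Type*} [MeasurableSpace Ω] (P : Measure Ω)
    (B : ℝ → Ω → ℝ) : Prop :=
  (∀ s : ℝ, Measurable (B s)) ∧
    ∀ (k : ℕ) (t : Fin k → ℝ) (c : Fin k → ℝ), (∀ i, 0 ≤ t i) →
      ∃ v : NNReal,
        Measure.map (fun ω => ∑ i, c i * B (t i) ω) P = gaussianReal 0 v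

/-- A standard one-dimensional Brownian motion: a sample-path continuous centered
Gaussian process with covariance `E[B(s)B(t)] = min s t`. -/
def IsStandardBM {Ω : Type*} [MeasurableSpace Ω] (P : Measure Ω)
    (B : ℝ → Ω → ℝ) : Prop :=
  IsCenteredGaussianProcess P B ∧
  (∀ᵐ ω ∂P, ContinuousOn (fun t : ℝ => B t ω) (Set.Ici (0 : ℝ))) ∧
  (∀ s t : ℝ, 0 ≤ s → 0 ≤ t → ∫ ω, B s ω * B t ω ∂P = min s t)

/-- The unit ramp. -/
def ramp (x : ℝ) : ℝ := max 0 (min 1 x)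

/-- The tent function supported on `[0, 1]`. -/
def tent (x : ℝ) : ℝ := max 0 (min x (1 - x))

/-- The covariance kernel of the Brownian bridge on `[0, 1]`, extended by clamping. -/
def bridgeKernel (x y : ℝ) : ℝ := min (ramp x) (ramp y) - ramp x * ramp y

lemma bridgeKernel_comm (x y : ℝ) : bridgeKernel x y = bridgeKernel y x := by
  unfold bridgeKernel; rw [min_comm, mul_comm]

lemma ramp_mono : Monotone ramp := fun x y h => by unfold ramp; gcongr

lemma min_ramp (x y : ℝ) : min (ramp x) (ramp y) = ramp (min x y) := (ramp_mono.map_min).symm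

lemma ramp_of_nonpos {x : ℝ} (h : x ≤ 0) : ramp x = 0 := by
  unfold ramp; rw [min_eq_right (by linarith), max_eq_left h]

lemma ramp_of_one_le {x : ℝ} (h : 1 ≤ x) : ramp x = 1 := by
  unfold ramp; rw [min_eq_left h]; norm_num

lemma ramp_of_mem {x : ℝ} (h : 0 ≤ x) (h' : x ≤ 1) : ramp x = x := by
  unfold ramp; rw [min_eq_right h', max_eq_right h]

lemma ramp_nonneg (x : ℝ) : 0 ≤ ramp x := le_max_left _ _

lemma ramp_le_one (x : ℝ) : ramp x ≤ 1 := by unfold ramp; simp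

lemma tent_nonneg (x : ℝ) : 0 ≤ tent x := le_max_left _ _

lemma tent_of_nonpos {x : ℝ} (h : x ≤ 0) : tent x = 0 := by
  unfold tent; exact max_eq_left ((min_le_left _ _).trans h)

lemma tent_of_one_le {x : ℝ} (h : 1 ≤ x) : tent x = 0 := by
  unfold tent; exact max_eq_left ((min_le_right _ _).trans (by linarith))

lemma tent_left {x : ℝ} (h : 0 ≤ x) (h' : x ≤ 1 / 2) : tent x = x := by
  unfold tent; rw [min_eq_left (by linarith), max_eq_right h]

lemma tent_right {x : ℝ} (h : 1 / 2 ≤ x) (h' : x ≤ 1) : tent x = 1 - x := by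
  unfold tent; rw [min_eq_right (by linarith), max_eq_right (by linarith)]

lemma tent_le (x : ℝ) : tent x ≤ ramp x - ramp (x - 1) := by
  rcases le_total x 0 with h | h
  · rw [tent_of_nonpos h, ramp_of_nonpos h, ramp_of_nonpos (by linarith)]; norm_num
  rcases le_total x 1 with h1 | h1
  · rw [ramp_of_mem h h1, ramp_of_nonpos (by linarith)]
    unfold tent; simp [h]
  · rw [tent_of_one_le h1]
    linarith [ramp_mono (show x - 1 ≤ x by linarith)]

lemma bridgeKernel_nonneg (x y : ℝ) : 0 ≤ bridgeKernel x y := by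
  unfold bridgeKernel
  have := ramp_nonneg x; have := ramp_nonneg y; have := ramp_le_one x; have := ramp_le_one y
  rcases le_total (ramp x) (ramp y) with h | h
  · rw [min_eq_left h]; nlinarith
  · rw [min_eq_right h]; nlinarith

lemma bridgeKernel_le (x y : ℝ) : bridgeKernel x y ≤ ramp x - ramp (x - 1) := by
  have h1 : bridgeKernel x y ≤ ramp x - ramp x * ramp x := by
    unfold bridgeKernel
    have := ramp_nonneg x; have := ramp_nonneg y; have := ramp_le_one x; have := ramp_le_one y
    rcases le_total (ramp x) (ramp y) with h | h
    · rw [min_eq_left h]; nlinarith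
    · rw [min_eq_right h]; nlinarith
  refine h1.trans ?_
  rcases le_total x 1 with h | h
  · rw [ramp_of_nonpos (show x - 1 ≤ 0 by linarith)]; nlinarith [ramp_nonneg x]
  · rw [ramp_of_one_le h]; nlinarith [ramp_le_one (x - 1)]

lemma bridgeKernel_rec_of_le {x y : ℝ} (hxy : x ≤ y) : bridgeKernel x y =
    tent x * tent y +
      (bridgeKernel (2 * x) (2 * y) + bridgeKernel (2 * x - 1) (2 * y - 1)) / 2 := by
  unfold bridgeKernel
  rw [min_ramp, min_ramp, min_ramp, min_eq_left hxy, min_eq_left (by linarith),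
    min_eq_left (by linarith)]
  rcases le_total x 0 with h | h
  · simp [ramp_of_nonpos h, ramp_of_nonpos (show 2 * x ≤ 0 by linarith),
      ramp_of_nonpos (show 2 * x - 1 ≤ 0 by linarith), tent_of_nonpos h]
  rcases le_total 1 y with h1 | h1
  · simp [ramp_of_one_le h1, ramp_of_one_le (show 1 ≤ 2 * y by linarith),
      ramp_of_one_le (show 1 ≤ 2 * y - 1 by linarith), tent_of_one_le h1]
  rw [ramp_of_mem h (hxy.trans h1), ramp_of_mem (h.trans hxy) h1]
  rcases le_total x (1 / 2) with hx | hx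
  · rw [ramp_of_mem (x := 2 * x) (by linarith) (by linarith), tent_left h hx,
      ramp_of_nonpos (x := 2 * x - 1) (by linarith)]
    rcases le_total y (1 / 2) with hy | hy
    · rw [ramp_of_mem (x := 2 * y) (by linarith) (by linarith), tent_left (h.trans hxy) hy]
      ring
    · rw [ramp_of_one_le (x := 2 * y) (by linarith), tent_right hy h1]
      ring
  · rw [ramp_of_one_le (x := 2 * x) (by linarith), ramp_of_one_le (x := 2 * y) (by linarith),
      ramp_of_mem (x := 2 * x - 1) (by linarith) (by linarith),
      ramp_of_mem (x := 2 * y - 1) (by linarith) (by linarith),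
      tent_right hx (by linarith), tent_right (by linarith) h1]
    ring

lemma bridgeKernel_rec (x y : ℝ) : bridgeKernel x y =
    tent x * tent y +
      (bridgeKernel (2 * x) (2 * y) + bridgeKernel (2 * x - 1) (2 * y - 1)) / 2 := by
  rcases le_total x y with h | h
  · exact bridgeKernel_rec_of_le h
  · rw [bridgeKernel_comm x, bridgeKernel_rec_of_le h, bridgeKernel_comm (2 * x),
      bridgeKernel_comm (2 * x - 1), mul_comm (tent x)]

lemma sum_ramp_sub (x : ℝ) (M : ℕ) :
    ∑ k ∈ Finset.range M, (ramp (x - k) - ramp (x - k - 1)) = ramp x - ramp (x - M) := by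
  have := Finset.sum_range_sub' (fun k : ℕ => ramp (x - k)) M
  simp only [Nat.cast_zero, sub_zero] at this
  rw [← this]
  refine Finset.sum_congr rfl fun k _ => ?_
  push_cast
  rw [sub_sub]

lemma sum_ramp (x : ℝ) (hx : 0 ≤ x) (M : ℕ) (hM : x ≤ M) :
    ∑ k ∈ Finset.range M, ramp (x - k) = x := by
  have key : ∀ k : ℕ, ramp (x - k) = min x ((k + 1 : ℕ) : ℝ) - min x (k : ℝ) := by
    intro k
    push_cast
    rcases le_total x k with h | h
    · rw [ramp_of_nonpos (by linarith), min_eq_left h, min_eq_left (by linarith), sub_self]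
    rcases le_total x (k + 1) with h1 | h1
    · rw [ramp_of_mem (by linarith) (by linarith), min_eq_left h1, min_eq_right h]
    · rw [ramp_of_one_le (by linarith), min_eq_right h1, min_eq_right h]; ring
  simp_rw [key]
  rw [Finset.sum_range_sub (fun k : ℕ => min x (k : ℝ))]
  simp [hM, hx]

lemma sum_tent_le (x : ℝ) (M : ℕ) : ∑ k ∈ Finset.range M, tent (x - k) ≤ 1 := by
  refine (Finset.sum_le_sum fun (k : ℕ) _ => tent_le (x - (k : ℝ))).trans ?_
  rw [sum_ramp_sub]
  linarith [ramp_le_one x, ramp_nonneg (x - M)]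

lemma sum_bridgeKernel_le (x y : ℝ) (M : ℕ) :
    ∑ k ∈ Finset.range M, bridgeKernel (x - k) (y - k) ≤ 1 := by
  refine (Finset.sum_le_sum fun (k : ℕ) _ => bridgeKernel_le (x - (k : ℝ)) (y - (k : ℝ))).trans ?_
  rw [sum_ramp_sub]
  linarith [ramp_le_one x, ramp_nonneg (x - M)]

lemma sum_range_two_mul (f : ℕ → ℝ) (M : ℕ) :
    ∑ k ∈ Finset.range (2 * M), f k = ∑ k ∈ Finset.range M, (f (2 * k) + f (2 * k + 1)) := by
  induction M with
  | zero => simp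
  | succ n ih =>
    rw [show 2 * (n + 1) = 2 * n + 1 + 1 by ring, Finset.sum_range_succ, Finset.sum_range_succ, ih,
      Finset.sum_range_succ]
    ring

lemma sum_bridgeKernel_rec (x y : ℝ) (M : ℕ) :
    ∑ k ∈ Finset.range M, bridgeKernel (x - k) (y - k) =
      ∑ k ∈ Finset.range M, tent (x - k) * tent (y - k) +
        (1 / 2) * ∑ k ∈ Finset.range (2 * M), bridgeKernel (2 * x - k) (2 * y - k) := by
  rw [sum_range_two_mul, Finset.mul_sum, ← Finset.sum_add_distrib]
  refine Finset.sum_congr rfl fun k _ => ?_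
  rw [bridgeKernel_rec]
  push_cast
  rw [show 2 * (x - k) - 1 = 2 * x - (2 * k + 1) by ring,
    show 2 * (y - k) - 1 = 2 * y - (2 * k + 1) by ring, mul_sub, mul_sub]
  ring

/-- The Faber–Schauder functions on the half line: unit ramps followed by rescaled tents. -/
def schauder : ℕ → ℕ → ℝ → ℝ
  | 0, k, t => ramp (t - k)
  | n + 1, k, t => √(1 / 2) ^ n * tent (2 ^ n * t - k)

lemma schauder_zero (k : ℕ) (t : ℝ) : schauder 0 k t = ramp (t - k) := rfl

lemma schauder_succ (n k : ℕ) (t : ℝ) :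
    schauder (n + 1) k t = √(1 / 2) ^ n * tent (2 ^ n * t - k) := rfl

lemma continuous_schauder (n k : ℕ) : Continuous (schauder n k) := by
  cases n with
  | zero => unfold schauder ramp; fun_prop
  | succ n => unfold schauder tent; fun_prop

lemma schauder_eq_zero {n k : ℕ} {t : ℝ} (h : 2 ^ n * t ≤ k) : schauder n k t = 0 := by
  have hk : (0 : ℝ) ≤ k := k.cast_nonneg
  cases n with
  | zero => exact ramp_of_nonpos (by linarith [show t ≤ k by simpa using h])
  | succ n =>
    rw [schauder_succ, tent_of_nonpos, mul_zero]
    rw [pow_succ] at h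
    by_contra! h1
    nlinarith

lemma sum_schauder_mul (s t : ℝ) (hs : 0 ≤ s) (ht : 0 ≤ t) (M N : ℕ) (hsM : s ≤ M) :
    ∑ n ∈ Finset.range (N + 1), ∑ k ∈ Finset.range (2 ^ n * M), schauder n k s * schauder n k t =
      min s t - (1 / 2) ^ N * ∑ k ∈ Finset.range (2 ^ N * M),
        bridgeKernel (2 ^ N * s - k) (2 ^ N * t - k) := by
  induction N with
  | zero =>
    simp only [zero_add, Finset.range_one, Finset.sum_singleton, pow_zero, one_mul]
    rw [eq_sub_iff_add_eq, ← Finset.sum_add_distrib]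
    rw [← sum_ramp (min s t) (le_min hs ht) M (min_le_iff.2 (.inl hsM))]
    refine Finset.sum_congr rfl fun k _ => ?_
    unfold bridgeKernel
    rw [schauder_zero, schauder_zero, min_ramp, min_sub_sub_right]; ring
  | succ N ih =>
    rw [Finset.sum_range_succ, ih, sum_bridgeKernel_rec]
    have h2 : (√(1 / 2) : ℝ) ^ N * √(1 / 2) ^ N = (1 / 2) ^ N := by
      rw [← mul_pow, Real.mul_self_sqrt (by norm_num)]
    have h3 : ∑ k ∈ Finset.range (2 ^ (N + 1) * M), schauder (N + 1) k s * schauder (N + 1) k t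
        = (1 / 2) ^ N * ∑ k ∈ Finset.range (2 ^ N * M),
          tent (2 ^ N * s - k) * tent (2 ^ N * t - k) := by
      rw [← Finset.sum_subset (s₁ := Finset.range (2 ^ N * M)), Finset.mul_sum]
      · refine Finset.sum_congr rfl fun k _ => ?_
        rw [schauder_succ, schauder_succ, ← h2]; ring
      · exact Finset.range_subset_range.2 (Nat.mul_le_mul_right _ (Nat.pow_le_pow_right (by simp)
          (by simp)))
      · intro k _ hk
        have : 2 ^ N * M ≤ k := by simpa using hk
        have h4 : (2 : ℝ) ^ N * M ≤ k := by exact_mod_cast this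
        rw [schauder_succ, tent_of_nonpos (x := 2 ^ N * s - k)]
        · simp
        · nlinarith [mul_le_mul_of_nonneg_left hsM (show (0 : ℝ) ≤ 2 ^ N by positivity)]
    rw [h3, pow_succ' 2, pow_succ' 2, pow_succ (1 / 2 : ℝ), mul_assoc 2 _ M, mul_assoc 2 _ s,
      mul_assoc 2 _ t]
    ring

lemma tendsto_sum_schauder_mul (s t : ℝ) (hs : 0 ≤ s) (ht : 0 ≤ t) (M : ℕ) (hsM : s ≤ M) :
    Tendsto (fun N => ∑ n ∈ Finset.range N, ∑ k ∈ Finset.range (2 ^ n * M),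
      schauder n k s * schauder n k t) atTop (nhds (min s t)) := by
  rw [← tendsto_add_atTop_iff_nat 1]
  simp_rw [sum_schauder_mul s t hs ht M _ hsM]
  have h0 : Tendsto (fun N : ℕ => (1 / 2 : ℝ) ^ N) atTop (nhds 0) :=
    tendsto_pow_atTop_nhds_zero_of_lt_one (by norm_num) (by norm_num)
  have : Tendsto (fun N : ℕ => (1 / 2 : ℝ) ^ N * ∑ k ∈ Finset.range (2 ^ N * M),
        bridgeKernel (2 ^ N * s - k) (2 ^ N * t - k)) atTop (nhds 0) := by
    refine squeeze_zero (fun N => ?_) (fun N => ?_) h0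
    · exact mul_nonneg (by positivity) (Finset.sum_nonneg fun k _ => bridgeKernel_nonneg _ _)
    · exact mul_le_of_le_one_right (by positivity) (sum_bridgeKernel_le _ _ _)
  simpa using this.const_sub (min s t)

lemma abs_sum_schauder_le (n M : ℕ) (t a : ℝ) (z : ℕ → ℝ) (ha : ∀ k < M, |z k| ≤ a) (ha0 : 0 ≤ a) :
    |∑ k ∈ Finset.range M, schauder (n + 1) k t * z k| ≤ √(1 / 2) ^ n * a := by
  refine (Finset.abs_sum_le_sum_abs _ _).trans ?_
  have : ∀ k ∈ Finset.range M, |schauder (n + 1) k t * z k| ≤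
      √(1 / 2) ^ n * a * tent (2 ^ n * t - k) := by
    intro k hk
    rw [schauder_succ, abs_mul, abs_mul, abs_of_nonneg (tent_nonneg _),
      abs_of_nonneg (by positivity)]
    have h1 := ha k (by simpa using hk)
    have h2 := tent_nonneg (2 ^ n * t - k)
    have h3 : (0 : ℝ) ≤ √(1 / 2) ^ n := by positivity
    calc _ ≤ √(1 / 2) ^ n * tent (2 ^ n * t - k) * a := by gcongr
      _ = _ := by ring
  refine (Finset.sum_le_sum this).trans ?_
  rw [← Finset.mul_sum]
  exact mul_le_of_le_one_right (by positivity) (sum_tent_le _ _)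

lemma ae_summable_of_summable_integral {Ω ι : Type*} [Countable ι] [MeasurableSpace Ω]
    {P : Measure Ω} (f : ι → Ω → ℝ) (hf : ∀ i ω, 0 ≤ f i ω) (hfi : ∀ i, Integrable (f i) P)
    (hs : Summable fun i => ∫ ω, f i ω ∂P) : ∀ᵐ ω ∂P, Summable fun i => f i ω := by
  have h1 : ∫⁻ ω, ∑' i, ENNReal.ofReal (f i ω) ∂P ≠ ⊤ := by
    rw [lintegral_tsum fun i => (hfi i).aemeasurable.ennreal_ofReal]
    simp_rw [← ofReal_integral_eq_lintegral_ofReal (hfi _) (ae_of_all _ (hf _))]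
    exact hs.tsum_ofReal_ne_top
  filter_upwards [ae_lt_top' (AEMeasurable.tsum
    fun i => (hfi i).aemeasurable.ennreal_ofReal) h1] with ω hω
  have := ENNReal.summable_toReal hω.ne
  simpa [ENNReal.toReal_ofReal, hf] using this

/-- The `n`-th term of the Lévy–Ciesielski series. -/
def schauderLevel (n : ℕ) (t : ℝ) (ω : ℕ × ℕ → ℝ) : ℝ :=
  ∑ k ∈ Finset.range (2 ^ n * (⌊t⌋₊ + 1)), schauder n k t * ω (n, k)

lemma sum_schauder_eq_of_le {n M M' : ℕ} {t : ℝ} (ht : t ≤ M) (h : M ≤ M') (ω : ℕ × ℕ → ℝ) :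
    ∑ k ∈ Finset.range (2 ^ n * M), schauder n k t * ω (n, k) =
      ∑ k ∈ Finset.range (2 ^ n * M'), schauder n k t * ω (n, k) := by
  refine Finset.sum_subset (Finset.range_subset_range.2 (Nat.mul_le_mul_left _ h)) ?_
  intro k _ hk
  have hk : 2 ^ n * M ≤ k := by simpa using hk
  rw [schauder_eq_zero, zero_mul]
  calc 2 ^ n * t ≤ 2 ^ n * (M : ℝ) := by gcongr
    _ ≤ k := by exact_mod_cast hk

lemma schauderLevel_eq {M : ℕ} {t : ℝ} (ht : t ≤ M) (n : ℕ) (ω : ℕ × ℕ → ℝ) :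
    schauderLevel n t ω = ∑ k ∈ Finset.range (2 ^ n * M), schauder n k t * ω (n, k) := by
  have h1 : t ≤ ((⌊t⌋₊ + 1 : ℕ) : ℝ) := by push_cast; exact (Nat.lt_floor_add_one t).le
  unfold schauderLevel
  rcases le_total M (⌊t⌋₊ + 1) with h | h
  · exact (sum_schauder_eq_of_le ht h ω).symm
  · exact sum_schauder_eq_of_le h1 h ω

/-- A growth condition on the coefficients ensuring locally uniform convergence of the
Lévy–Ciesielski series. -/
def ModerateGrowth (ω : ℕ × ℕ → ℝ) : Prop :=
  Summable fun x : ℕ × ℕ => (1 / 2 : ℝ) ^ x.1 * (((x.2 : ℝ) + 1) ^ 2)⁻¹ * ω x ^ 8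

lemma measurableSet_moderateGrowth : MeasurableSet {ω | ModerateGrowth ω} := by
  have : {ω | ModerateGrowth ω} = {ω : ℕ × ℕ → ℝ | ∑' x : ℕ × ℕ, ENNReal.ofReal
      ((1 / 2 : ℝ) ^ x.1 * (((x.2 : ℝ) + 1) ^ 2)⁻¹ * ω x ^ 8) < ⊤} := by
    ext ω
    have h0 : ∀ x : ℕ × ℕ, 0 ≤ (1 / 2 : ℝ) ^ x.1 * (((x.2 : ℝ) + 1) ^ 2)⁻¹ * ω x ^ 8 := by
      intro x
      have : 0 ≤ ω x ^ 8 := by positivity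
      positivity
    constructor
    · intro h
      exact (Summable.tsum_ofReal_ne_top h).lt_top
    · intro h
      have := ENNReal.summable_toReal (Set.mem_ofPred.1 h).ne
      simp only [ENNReal.toReal_ofReal (h0 _)] at this
      exact this
  rw [this]
  refine measurableSet_lt (Measurable.tsum fun x => ?_) measurable_const
  fun_prop

lemma ModerateGrowth.exists_bound {ω : ℕ × ℕ → ℝ} (h : ModerateGrowth ω) (M : ℕ) :
    ∃ u : ℕ → ℝ, Summable u ∧ ∀ n, ∀ t : ℝ, t ≤ M → |schauderLevel n t ω| ≤ u n := by
  obtain ⟨C, hC⟩ : ∃ C : ℝ, ∀ x : ℕ × ℕ,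
      (1 / 2 : ℝ) ^ x.1 * (((x.2 : ℝ) + 1) ^ 2)⁻¹ * ω x ^ 8 ≤ C := by
    refine ⟨_, fun x => h.le_tsum x fun y _ => ?_⟩
    have : 0 ≤ ω y ^ 8 := by positivity
    positivity
  have hC0 : 0 ≤ C := le_trans (by
    have : 0 ≤ ω (0, 0) ^ 8 := by positivity
    positivity) (hC (0, 0))
  have root : ∀ x : ℝ, 0 ≤ x → ∃ y, 0 ≤ y ∧ y ^ 8 = x := fun x hx =>
    ⟨x ^ ((8 : ℕ) : ℝ)⁻¹, by positivity, Real.rpow_inv_natCast_pow hx (by norm_num)⟩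
  obtain ⟨ρ, hρ0, hρ⟩ := root 8 (by norm_num)
  obtain ⟨K, hK0, hK⟩ := root (8 * C * M ^ 2) (by positivity)
  have hr : √(1 / 2) * ρ < 1 := by
    have : (√(1 / 2) * ρ) ^ 8 < 1 := by
      rw [mul_pow, hρ, show (√(1 / 2 : ℝ)) ^ 8 = (√(1 / 2) ^ 2) ^ 4 by ring,
        Real.sq_sqrt (by norm_num)]
      norm_num
    exact (pow_lt_one_iff_of_nonneg (by positivity) (by norm_num)).1 this
  have hr0 : 0 ≤ √(1 / 2) * ρ := by positivity
  refine ⟨fun n => Nat.casesOn n (∑ k ∈ Finset.range M, |ω (0, k)|)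
    fun n => K * (√(1 / 2) * ρ) ^ n, ?_, ?_⟩
  · rw [← summable_nat_add_iff 1]
    exact (summable_geometric_of_lt_one hr0 hr).mul_left K
  · intro n t ht
    rw [schauderLevel_eq ht]
    cases n with
    | zero =>
      simp only [pow_zero, one_mul]
      refine (Finset.abs_sum_le_sum_abs _ _).trans (Finset.sum_le_sum fun k _ => ?_)
      rw [abs_mul, schauder_zero, abs_of_nonneg (ramp_nonneg _)]
      exact mul_le_of_le_one_left (abs_nonneg _) (ramp_le_one _)
    | succ n =>
      refine (abs_sum_schauder_le n _ t (K * ρ ^ n) _ (fun k hk => ?_) (by positivity)).trans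
        (le_of_eq (by dsimp only; rw [mul_pow]; ring))
      rw [← pow_le_pow_iff_left₀ (abs_nonneg _) (by positivity) (show 8 ≠ 0 by norm_num),
        (show Even 8 by decide).pow_abs, mul_pow, hK, ← pow_mul, mul_comm n, pow_mul, hρ]
      have h1 := hC (n + 1, k)
      simp only at h1
      have h2 : (0 : ℝ) < (k + 1) ^ 2 := by positivity
      have hk' : (k : ℝ) + 1 ≤ 2 ^ (n + 1) * M := by exact_mod_cast hk
      have h3 : ((k : ℝ) + 1) ^ 2 ≤ (2 ^ (n + 1) * M) ^ 2 := by gcongr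
      have h4 : ω (n + 1, k) ^ 8 ≤ C * (2 ^ (n + 1) * ((k : ℝ) + 1) ^ 2) := by
        rw [show (1 / 2 : ℝ) ^ (n + 1) * (((k : ℝ) + 1) ^ 2)⁻¹ * ω (n + 1, k) ^ 8 =
          ω (n + 1, k) ^ 8 / (2 ^ (n + 1) * ((k : ℝ) + 1) ^ 2) by
            rw [one_div, inv_pow]; field_simp] at h1
        rwa [div_le_iff₀ (by positivity)] at h1
      refine h4.trans ?_
      calc C * (2 ^ (n + 1) * ((k : ℝ) + 1) ^ 2) ≤ C * (2 ^ (n + 1) * (2 ^ (n + 1) * M) ^ 2) := by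
            gcongr
        _ = 8 * C * M ^ 2 * (2 ^ 3) ^ n := by rw [← pow_mul]; ring
        _ = _ := by norm_num

lemma ModerateGrowth.summable {ω : ℕ × ℕ → ℝ} (h : ModerateGrowth ω) (t : ℝ) :
    Summable fun n => schauderLevel n t ω := by
  obtain ⟨u, hu, hb⟩ := h.exists_bound (⌊t⌋₊ + 1)
  exact Summable.of_norm_bounded hu fun n =>
    hb n t (by push_cast; exact (Nat.lt_floor_add_one t).le)

open Classical in
/-- The Lévy–Ciesielski construction of Brownian motion. -/
def brownian (t : ℝ) (ω : ℕ × ℕ → ℝ) : ℝ :=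
  if ModerateGrowth ω then ∑' n, schauderLevel n t ω else 0

lemma continuous_brownian (ω : ℕ × ℕ → ℝ) : Continuous fun t => brownian t ω := by
  unfold brownian
  split_ifs with h
  swap
  · exact continuous_const
  rw [continuous_iff_continuousAt]
  intro t
  obtain ⟨M, hM⟩ := exists_nat_gt t
  obtain ⟨u, hu, hb⟩ := h.exists_bound M
  have : ContinuousOn (fun t => ∑' n, schauderLevel n t ω) (Set.Iic (M : ℝ)) := by
    refine continuousOn_tsum (fun n => ?_) hu fun n t ht => hb n t ht
    have : Continuous fun t => ∑ k ∈ Finset.range (2 ^ n * M), schauder n k t * ω (n, k) :=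
      continuous_finsetSum _ fun k _ => (continuous_schauder n k).mul continuous_const
    exact this.continuousOn.congr fun t ht => schauderLevel_eq ht n ω
  exact this.continuousAt (Iic_mem_nhds hM)

lemma measurable_schauderLevel (n : ℕ) (t : ℝ) : Measurable (schauderLevel n t) := by
  unfold schauderLevel
  fun_prop

lemma measurable_brownian (t : ℝ) : Measurable (brownian t) := by
  classical
  refine measurable_of_tendsto_metrizable (f := fun N ω =>
    if ModerateGrowth ω then ∑ n ∈ Finset.range N, schauderLevel n t ω else 0) (fun N => ?_) ?_
  · refine Measurable.ite measurableSet_moderateGrowth ?_ measurable_const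
    exact Finset.measurable_fun_sum _ fun n _ => measurable_schauderLevel n t
  · rw [tendsto_pi_nhds]
    intro ω
    unfold brownian
    split_ifs with h
    · exact (h.summable t).hasSum.tendsto_sum_nat
    · exact tendsto_const_nhds

/-- The law of a sequence of independent standard Gaussian variables. -/
def gaussianNoise : Measure (ℕ × ℕ → ℝ) := Measure.infinitePi fun _ => gaussianReal 0 1

instance : IsProbabilityMeasure gaussianNoise := by unfold gaussianNoise; infer_instance

lemma map_eval_gaussianNoise (x : ℕ × ℕ) : gaussianNoise.map (fun ω => ω x) = gaussianReal 0 1 :=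
  (measurePreserving_eval_infinitePi (fun _ => gaussianReal 0 1) x).map_eq

lemma ae_moderateGrowth : ∀ᵐ ω ∂gaussianNoise, ModerateGrowth ω := by
  have hfi : Integrable (fun x : ℝ => x ^ 8) (gaussianReal 0 1) := by
    have := (memLp_id_gaussianReal (μ := 0) (v := 1) 8).integrable_norm_pow (by norm_num)
    simpa [(show Even 8 by decide).pow_abs] using this
  have hfi' : ∀ x : ℕ × ℕ, Integrable (fun ω : ℕ × ℕ → ℝ => ω x ^ 8) gaussianNoise := by
    intro x
    rw [← map_eval_gaussianNoise x] at hfi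
    exact hfi.comp_measurable (measurable_pi_apply x)
  refine ae_summable_of_summable_integral _ (fun x ω => ?_) (fun x => (hfi' x).const_mul _) ?_
  · have : 0 ≤ ω x ^ 8 := by positivity
    positivity
  · have : ∀ x : ℕ × ℕ, ∫ ω, ω x ^ 8 ∂gaussianNoise = ∫ y, y ^ 8 ∂(gaussianReal 0 1) := by
      intro x
      rw [← map_eval_gaussianNoise x, integral_map (measurable_pi_apply x).aemeasurable]
      exact (by fun_prop : Measurable fun y : ℝ => y ^ 8).aestronglyMeasurable
    simp_rw [integral_const_mul, this]
    refine Summable.mul_right _ ?_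
    refine Summable.mul_of_nonneg (f := fun n => (1 / 2 : ℝ) ^ n)
      (g := fun k : ℕ => (((k : ℝ) + 1) ^ 2)⁻¹)
      (summable_geometric_of_lt_one (by norm_num) (by norm_num)) ?_ (fun n => by positivity)
      (fun n => by positivity)
    have := (summable_nat_add_iff 1).2 (Real.summable_nat_pow_inv.2 (show 1 < 2 by norm_num))
    simpa using this

lemma charFun_sum_gaussianNoise (F : Finset (ℕ × ℕ)) (a : ℕ × ℕ → ℝ) (θ : ℝ) :
    charFun (gaussianNoise.map fun ω => ∑ x ∈ F, a x * ω x) θ =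
      Complex.exp (-((∑ x ∈ F, a x ^ 2 : ℝ) : ℂ) * θ ^ 2 / 2) := by
  have hind : iIndepFun (fun x (ω : ℕ × ℕ → ℝ) => a x * ω x) gaussianNoise :=
    iIndepFun_infinitePi (X := fun x y => a x * y) (fun x => by fun_prop)
  have h := iIndepFun.charFun_map_finsetSum_eq_prod (s := F) (P := gaussianNoise)
    (X := fun x (ω : ℕ × ℕ → ℝ) => a x * ω x)
    (fun x _ => (by fun_prop : Measurable fun ω : ℕ × ℕ → ℝ => a x * ω x).aemeasurable)
    (hind.precomp (g := fun i : F => (i : ℕ × ℕ)) Subtype.val_injective)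
  have h' := congrFun h θ
  rw [Finset.prod_apply] at h'
  rw [show (fun ω : ℕ × ℕ → ℝ => ∑ x ∈ F, a x * ω x) = ∑ x ∈ F, fun ω => a x * ω x by
    ext ω; simp, h']
  have : ∀ x ∈ F, charFun (gaussianNoise.map fun ω => a x * ω x) θ =
      Complex.exp (-((a x ^ 2 : ℝ) : ℂ) * θ ^ 2 / 2) := by
    intro x _
    rw [show (fun ω : ℕ × ℕ → ℝ => a x * ω x) = (fun y => a x * y) ∘ fun ω => ω x from rfl,
      ← Measure.map_map (g := fun y => a x * y) (f := fun ω : ℕ × ℕ → ℝ => ω x)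
      (by fun_prop) (by fun_prop), map_eval_gaussianNoise, gaussianReal_map_const_mul,
      charFun_gaussianReal]
    congr 1
    push_cast
    simp
    ring
  rw [Finset.prod_congr rfl this, ← Complex.exp_sum]
  congr 1
  push_cast
  rw [← Finset.sum_div, ← Finset.sum_mul, Finset.sum_neg_distrib]

lemma map_sum_brownian {ι : Type*} [Fintype ι] (c t : ι → ℝ) (ht : ∀ i, 0 ≤ t i) :
    gaussianNoise.map (fun ω => ∑ i, c i * brownian (t i) ω) =
      gaussianReal 0 (Real.toNNReal (∑ i, ∑ j, c i * c j * min (t i) (t j))) := by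
  obtain ⟨M, hM⟩ : ∃ M : ℕ, ∀ i, t i ≤ M :=
    ⟨⌈∑ i, t i⌉₊, fun i => (Finset.single_le_sum (fun j _ => ht j) (Finset.mem_univ i)).trans
      (Nat.le_ceil _)⟩
  set F : ℕ → Finset (ℕ × ℕ) := fun N =>
    (Finset.range N).biUnion fun n => (Finset.range (2 ^ n * M)).image fun k => (n, k) with hF
  have sumF : ∀ (N : ℕ) (g : ℕ × ℕ → ℝ), ∑ x ∈ F N, g x =
      ∑ n ∈ Finset.range N, ∑ k ∈ Finset.range (2 ^ n * M), g (n, k) := by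
    intro N g
    rw [hF, Finset.sum_biUnion]
    · refine Finset.sum_congr rfl fun n _ => ?_
      rw [Finset.sum_image]
      intro a _ b _ hab
      simpa using hab
    · intro n _ m _ hnm
      simp only [Function.onFun]
      rw [Finset.disjoint_left]
      rintro ⟨x, y⟩ h1 h2
      simp only [Finset.mem_image, Prod.mk.injEq] at h1 h2
      obtain ⟨_, _, h1, _⟩ := h1
      obtain ⟨_, _, h2, _⟩ := h2
      exact hnm (h1.trans h2.symm)
  set a : ℕ × ℕ → ℝ := fun x => ∑ i, c i * schauder x.1 x.2 (t i) with ha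
  set v := ∑ i, ∑ j, c i * c j * min (t i) (t j) with hv
  have hlim : Tendsto (fun N => ∑ x ∈ F N, a x ^ 2) atTop (nhds v) := by
    have : ∀ N, ∑ x ∈ F N, a x ^ 2 = ∑ i, ∑ j, c i * c j * ∑ n ∈ Finset.range N,
        ∑ k ∈ Finset.range (2 ^ n * M), schauder n k (t i) * schauder n k (t j) := by
      intro N
      simp_rw [fun i j => (sumF N fun x => schauder x.1 x.2 (t i) * schauder x.1 x.2 (t j)).symm,
        Finset.mul_sum]
      simp_rw [ha, sq, Finset.sum_mul_sum]
      rw [Finset.sum_comm]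
      refine Finset.sum_congr rfl fun i _ => ?_
      rw [Finset.sum_comm]
      refine Finset.sum_congr rfl fun j _ => Finset.sum_congr rfl fun x _ => by ring
    simp_rw [this]
    exact tendsto_finsetSum _ fun i _ => tendsto_finsetSum _ fun j _ =>
      (tendsto_sum_schauder_mul _ _ (ht i) (ht j) M (hM i)).const_mul _
  have hv0 : 0 ≤ v := ge_of_tendsto' hlim fun N => Finset.sum_nonneg fun x _ => sq_nonneg _
  have hmeas : Measurable fun ω => ∑ i, c i * brownian (t i) ω :=
    Finset.measurable_fun_sum _ fun i _ => (measurable_brownian _).const_mul _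
  have hpt : ∀ᵐ ω ∂gaussianNoise, Tendsto (fun N => ∑ x ∈ F N, a x * ω x) atTop
      (nhds (∑ i, c i * brownian (t i) ω)) := by
    filter_upwards [ae_moderateGrowth] with ω hω
    have : ∀ N, ∑ x ∈ F N, a x * ω x =
        ∑ i, c i * ∑ n ∈ Finset.range N, schauderLevel n (t i) ω := by
      intro N
      simp_rw [fun i n => schauderLevel_eq (hM i) n ω,
        fun i => (sumF N fun x => schauder x.1 x.2 (t i) * ω x).symm, Finset.mul_sum, ha,
        Finset.sum_mul]
      rw [Finset.sum_comm]
      refine Finset.sum_congr rfl fun i _ => Finset.sum_congr rfl fun x _ => by ring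
    simp_rw [this]
    refine tendsto_finsetSum _ fun i _ => Tendsto.const_mul _ ?_
    rw [brownian, if_pos hω]
    exact (hω.summable (t i)).hasSum.tendsto_sum_nat
  have : IsProbabilityMeasure (gaussianNoise.map fun ω => ∑ i, c i * brownian (t i) ω) :=
    Measure.isProbabilityMeasure_map hmeas.aemeasurable
  refine Measure.ext_of_charFun (funext fun θ => ?_)
  rw [charFun_gaussianReal]
  have h1 : Tendsto (fun N => charFun (gaussianNoise.map fun ω => ∑ x ∈ F N, a x * ω x) θ) atTop
      (nhds (charFun (gaussianNoise.map fun ω => ∑ i, c i * brownian (t i) ω) θ)) := by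
    have cf : ∀ g : (ℕ × ℕ → ℝ) → ℝ, Measurable g → charFun (gaussianNoise.map g) θ =
        ∫ ω, Complex.exp (θ * g ω * Complex.I) ∂gaussianNoise := by
      intro g hg
      rw [charFun_apply_real, integral_map hg.aemeasurable]
      exact (by fun_prop :
        Measurable fun x : ℝ => Complex.exp (θ * x * Complex.I)).aestronglyMeasurable
    rw [cf _ hmeas]
    simp_rw [fun N => cf (fun ω => ∑ x ∈ F N, a x * ω x) (by fun_prop)]
    refine tendsto_integral_of_dominated_convergence (fun _ => 1) (fun N => ?_)
      (integrable_const _) (fun N => ae_of_all _ fun ω => ?_) ?_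
    · exact (by fun_prop : Measurable fun ω : ℕ × ℕ → ℝ => Complex.exp
        (θ * ((∑ x ∈ F N, a x * ω x : ℝ) : ℂ) * Complex.I)).aestronglyMeasurable
    · rw [← Complex.ofReal_mul, Complex.norm_exp_ofReal_mul_I]
    · filter_upwards [hpt] with ω hω
      have hc : Continuous fun x : ℝ => Complex.exp (θ * x * Complex.I) := by fun_prop
      exact (hc.tendsto _).comp hω
  simp_rw [charFun_sum_gaussianNoise] at h1
  have h2 : Tendsto (fun N => Complex.exp (-((∑ x ∈ F N, a x ^ 2 : ℝ) : ℂ) * θ ^ 2 / 2)) atTop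
      (nhds (Complex.exp (-(v : ℂ) * θ ^ 2 / 2))) := by
    have hc : Continuous fun x : ℝ => Complex.exp (-(x : ℂ) * θ ^ 2 / 2) := by fun_prop
    exact (hc.tendsto _).comp hlim
  rw [tendsto_nhds_unique h1 h2]
  congr 1
  simp [Real.coe_toNNReal v hv0]
  ring

lemma map_brownian {t : ℝ} (ht : 0 ≤ t) (c : ℝ) :
    gaussianNoise.map (fun ω => c * brownian t ω) = gaussianReal 0 (Real.toNNReal (c ^ 2 * t)) := by
  have := map_sum_brownian (ι := Fin 1) (fun _ => c) (fun _ => t) (fun _ => ht)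
  simpa [← sq] using this

lemma map_brownian_add {s t : ℝ} (hs : 0 ≤ s) (ht : 0 ≤ t) (c d : ℝ) :
    gaussianNoise.map (fun ω => c * brownian s ω + d * brownian t ω) =
      gaussianReal 0 (Real.toNNReal (c ^ 2 * s + 2 * c * d * min s t + d ^ 2 * t)) := by
  have := map_sum_brownian (ι := Fin 2) ![c, d] ![s, t] (by
    intro i; fin_cases i <;> simpa)
  simp only [Fin.sum_univ_two, Matrix.cons_val_zero, Matrix.cons_val_one, min_self] at this
  rw [this, min_comm t s]
  congr 2
  ring

lemma integrable_sq_and_integral_sq {Ω : Type*} [MeasurableSpace Ω] {P : Measure Ω} {Y : Ω → ℝ}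
    (hY : Measurable Y) {v : NNReal} (h : P.map Y = gaussianReal 0 v) :
    Integrable Y P ∧ ∫ ω, Y ω ∂P = 0 ∧ Integrable (fun ω => Y ω ^ 2) P ∧
      ∫ ω, Y ω ^ 2 ∂P = v := by
  have h2 : Integrable (fun x : ℝ => x ^ 2) (gaussianReal 0 v) := by
    simpa using (memLp_id_gaussianReal (μ := 0) (v := v) 2).integrable_norm_pow (by norm_num)
  have h1 : Integrable (fun x : ℝ => x) (gaussianReal 0 v) := by
    exact memLp_one_iff_integrable.1 (memLp_id_gaussianReal (μ := 0) (v := v) 1)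
  have hv := variance_fun_id_gaussianReal (μ := 0) (v := v)
  rw [variance_of_integral_eq_zero (by fun_prop) (integral_id_gaussianReal)] at hv
  have h0 : ∫ x : ℝ, x ∂(gaussianReal 0 v) = 0 := integral_id_gaussianReal
  rw [← h] at h2 h1 hv h0
  rw [integral_map hY.aemeasurable (by fun_prop)] at hv h0
  exact ⟨h1.comp_measurable hY, h0, h2.comp_measurable hY, hv⟩

lemma integral_brownian_mul {s t : ℝ} (hs : 0 ≤ s) (ht : 0 ≤ t) :
    ∫ ω, brownian s ω * brownian t ω ∂gaussianNoise = min s t := by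
  have ms := measurable_brownian s
  have mt := measurable_brownian t
  obtain ⟨-, -, i1, e1⟩ := integrable_sq_and_integral_sq (ms.const_mul 1) (map_brownian hs 1)
  obtain ⟨-, -, i2, e2⟩ := integrable_sq_and_integral_sq (mt.const_mul 1) (map_brownian ht 1)
  obtain ⟨-, -, i3, e3⟩ := integrable_sq_and_integral_sq ((ms.const_mul 1).add (mt.const_mul 1))
    (map_brownian_add hs ht 1 1)
  have hm : 0 ≤ min s t := le_min hs ht
  rw [Real.coe_toNNReal _ (by nlinarith)] at e1 e2 e3
  have : ∀ ω, brownian s ω * brownian t ω = 1 / 2 * ((1 * brownian s ω + 1 * brownian t ω) ^ 2 -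
      ((1 * brownian s ω) ^ 2 + (1 * brownian t ω) ^ 2)) := fun ω => by ring
  simp_rw [this]
  simp only [Pi.add_apply] at i3 e3
  rw [integral_const_mul, integral_sub i3 (i1.fun_add i2), integral_add i1 i2, e1, e2, e3]
  ring

theorem isStandardBM_brownian : IsStandardBM gaussianNoise brownian :=
  ⟨⟨measurable_brownian, fun _ t c ht => ⟨_, map_sum_brownian c t ht⟩⟩,
    ae_of_all _ fun ω => (continuous_brownian ω).continuousOn,
    fun _ _ hs ht => integral_brownian_mul hs ht⟩

lemma isGaussianProcess_brownian :
    IsGaussianProcess (fun (t : NNReal) ω => brownian t ω) gaussianNoise := by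
  refine ⟨fun I => ⟨isGaussian_of_map_eq_gaussianReal fun L => ?_⟩⟩
  have hm : Measurable fun ω => I.restrict (fun t : NNReal => brownian t ω) :=
    measurable_pi_lambda _ fun i => measurable_brownian _
  rw [Measure.map_map (by fun_prop) hm]
  refine ⟨_, _, Eq.trans ?_ (map_sum_brownian (ι := I) (fun i => L (Pi.single i 1))
    (fun i => ((i : NNReal) : ℝ)) fun i => NNReal.coe_nonneg _)⟩
  congr 1
  ext ω
  simp only [Function.comp]
  conv_lhs => rw [← Finset.univ_sum_single (I.restrict fun t : NNReal => brownian t ω)]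
  rw [map_sum]
  refine Finset.sum_congr rfl fun i _ => ?_
  rw [mul_comm, ← smul_eq_mul, ← map_smul, ← Pi.single_smul]
  simp

lemma iIndepFun_brownian_sub (t : ℕ → ℝ) (ht : Monotone t) (ht0 : ∀ i, 0 ≤ t i) :
    iIndepFun (fun i ω => brownian (t (i + 1)) ω - brownian (t i) ω) gaussianNoise := by
  have h := IsGaussianProcess.isPreBrownianReal_of_covariance isGaussianProcess_brownian
    (fun t => by
      simpa using (integrable_sq_and_integral_sq ((measurable_brownian t).const_mul 1)
        (map_brownian t.2 1)).2.1) (fun s t hst => by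
      have h0 : ∀ t : NNReal, ∫ ω, brownian t ω ∂gaussianNoise = 0 := fun t => by
        simpa using (integrable_sq_and_integral_sq ((measurable_brownian t).const_mul 1)
          (map_brownian t.2 1)).2.1
      have hL : ∀ t : NNReal, MemLp (fun ω => brownian t ω) 2 gaussianNoise := fun t => by
        rw [memLp_two_iff_integrable_sq (measurable_brownian _).aestronglyMeasurable]
        simpa using (integrable_sq_and_integral_sq ((measurable_brownian t).const_mul 1)
          (map_brownian t.2 1)).2.2.1
      rw [covariance_eq_sub (hL s) (hL t), h0 s, zero_mul, sub_zero]
      have := integral_brownian_mul s.2 t.2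
      rw [min_eq_left (by exact_mod_cast hst)] at this
      exact this)
  exact h.hasIndepIncrements.nat (t := fun i => (⟨t i, ht0 i⟩ : NNReal)) (fun i j hij => ht hij)

lemma map_brownian_sub {s t : ℝ} (hs : 0 ≤ s) (hst : s ≤ t) (c : ℝ) :
    gaussianNoise.map (fun ω => c * (brownian t ω - brownian s ω)) =
      gaussianReal 0 (Real.toNNReal (c ^ 2 * (t - s))) := by
  have := map_brownian_add hs (hs.trans hst) (-c) c
  rw [min_eq_left hst] at this
  rw [show (fun ω => c * (brownian t ω - brownian s ω)) =
    fun ω => -c * brownian s ω + c * brownian t ω by ext ω; ring, this]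
  congr 2
  ring

lemma strictMono_cdf_gaussianReal {v : NNReal} (hv : v ≠ 0) :
    StrictMono (cdf (gaussianReal 0 v)) := by
  intro a b hab
  have h : gaussianReal 0 v (Set.Ioc a b) ≠ 0 := by
    intro h0
    have := gaussianReal_absolutelyContinuous' 0 hv h0
    simp at this
    linarith
  rw [← measure_cdf (gaussianReal 0 v), StieltjesFunction.measure_Ioc] at h
  simpa using h

lemma continuous_cdf_gaussianReal {v : NNReal} (hv : v ≠ 0) :
    Continuous (cdf (gaussianReal 0 v)) := by
  rw [continuous_iff_continuousAt]
  intro a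
  have := nullSingletonClass_gaussianReal (μ := 0) hv
  have h0 : gaussianReal 0 v {a} = 0 := measure_singleton a
  rw [← measure_cdf (gaussianReal 0 v), StieltjesFunction.measure_singleton] at h0
  have hm := monotone_cdf (gaussianReal 0 v)
  rw [hm.continuousAt_iff_leftLim_eq_rightLim, StieltjesFunction.rightLim_eq]
  refine le_antisymm (hm.leftLim_le le_rfl) ?_
  simpa using h0

lemma gaussianReal_cdf_le {v : NNReal} (hv : v ≠ 0) {u : ℝ} (hu0 : 0 ≤ u) (hu1 : u ≤ 1) :
    (gaussianReal 0 v).real {g | cdf (gaussianReal 0 v) g ≤ u} = u := by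
  have hs := strictMono_cdf_gaussianReal hv
  rcases hu0.eq_or_lt with rfl | hu0
  · have : {g | cdf (gaussianReal 0 v) g ≤ 0} = ∅ := by
      ext g
      simp only [Set.mem_ofPred_eq, Set.mem_empty_iff_false, iff_false, not_le]
      exact (cdf_nonneg _ (g - 1)).trans_lt (hs (by linarith))
    simp [this]
  rcases hu1.eq_or_lt with rfl | hu1
  · simp [cdf_le_one]
  obtain ⟨x, hx⟩ : ∃ x, cdf (gaussianReal 0 v) x = u := by
    refine mem_range_of_exists_le_of_exists_ge (continuous_cdf_gaussianReal hv) ?_ ?_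
    · exact ((tendsto_cdf_atBot _).eventually_lt_const hu0).exists.imp fun _ h => h.le
    · exact ((tendsto_cdf_atTop _).eventually_const_lt hu1).exists.imp fun _ h => h.le
  have : {g | cdf (gaussianReal 0 v) g ≤ u} = Set.Iic x := by
    ext g
    simp [← hx, hs.le_iff_le]
  rw [this, ← cdf_eq_real, hx]

lemma exists_quantile_nat {v : NNReal} (hv : v ≠ 0) (n : ℕ) (W D : ℕ → ℝ) (hW : ∀ j, 0 ≤ W j)
    (hsum : ∑ j ∈ Finset.range n, W j = 1) (hD : ∀ i j, i ≤ j → j < n → D i ≤ D j) :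
    ∃ f : ℝ → ℕ, (∀ g, f g < n) ∧
      (∀ i < n, MeasurableSet {g | f g = i} ∧ (gaussianReal 0 v).real {g | f g = i} = W i) ∧
      ∃ φ : ℝ → ℝ, LipschitzWith 1 φ ∧ ∀ g, |D (f g) - g| = φ (D (f g)) - φ g := by
  set F := cdf (gaussianReal 0 v) with hF
  have hs : StrictMono F := strictMono_cdf_gaussianReal hv
  have hFm : Measurable F := (continuous_cdf_gaussianReal hv).measurable
  set c : ℕ → ℝ := fun m => ∑ j ∈ Finset.range m, W j with hc
  have hcm : Monotone c := monotone_nat_of_le_succ fun m => by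
    simp only [hc, Finset.sum_range_succ]; linarith [hW m]
  have hc0 : c 0 = 0 := by simp [hc]
  have hex : ∀ g, ∃ i, i < n ∧ c i < F g ∧ F g ≤ c (i + 1) := by
    intro g
    have hpos : 0 < F g := (cdf_nonneg _ (g - 1)).trans_lt (hs (by linarith))
    have hn : ∃ m, F g ≤ c m := ⟨n, by rw [show c n = 1 from hsum]; exact cdf_le_one _ _⟩
    classical
    obtain ⟨i, hi⟩ : ∃ i, Nat.find hn = i + 1 := by
      refine Nat.exists_eq_succ_of_ne_zero fun h0 => ?_
      have := Nat.find_spec hn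
      rw [h0, hc0] at this
      linarith
    refine ⟨i, ?_, ?_, hi ▸ Nat.find_spec hn⟩
    · have : Nat.find hn ≤ n := Nat.find_min' hn
        (by rw [show c n = 1 from hsum]; exact cdf_le_one _ _)
      omega
    · exact not_le.1 (Nat.find_min hn (by omega))
  choose f hf1 hf2 hf3 using hex
  have huniq : ∀ g i, c i < F g → F g ≤ c (i + 1) → f g = i := by
    intro g i h1 h2
    rcases lt_trichotomy (f g) i with h | h | h
    · have := hcm (show f g + 1 ≤ i by omega); linarith [hf3 g]
    · exact h
    · have := hcm (show i + 1 ≤ f g by omega); linarith [hf2 g]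
  refine ⟨f, hf1, fun i hi => ?_, ?_⟩
  · have hset : {g | f g = i} = {g | F g ≤ c (i + 1)} \ {g | F g ≤ c i} := by
      ext g
      simp only [Set.mem_ofPred_eq, Set.mem_sdiff, not_le]
      exact ⟨fun h => ⟨h ▸ hf3 g, h ▸ hf2 g⟩, fun h => huniq g i h.2 h.1⟩
    have hms : ∀ u, MeasurableSet {g | F g ≤ u} := fun u => measurableSet_le hFm measurable_const
    have hcn : ∀ m, m ≤ n → c m ≤ 1 := fun m hm => (hcm hm).trans hsum.le
    have hcp : ∀ m, 0 ≤ c m := fun m => Finset.sum_nonneg fun j _ => hW j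
    refine ⟨hset ▸ (hms _).diff (hms _), ?_⟩
    have hsub : {g | F g ≤ c i} ⊆ {g | F g ≤ c (i + 1)} :=
      fun g (hg : F g ≤ c i) => hg.trans (hcm (Nat.le_succ i))
    rw [hset, measureReal_sdiff hsub (hms _),
      gaussianReal_cdf_le hv (hcp _) (hcn _ hi), gaussianReal_cdf_le hv (hcp _) (hcn _ hi.le)]
    simp [hc, Finset.sum_range_succ]
  · set FD : ℝ → ℝ := fun y => ∑ j ∈ Finset.range n with D j ≤ y, W j with hFD
    have hFDm : Monotone FD := by
      intro x y hxy
      refine Finset.sum_le_sum_of_subset_of_nonneg (fun j hj => ?_) fun j _ _ => hW j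
      simp only [Finset.mem_filter] at hj ⊢
      exact ⟨hj.1, hj.2.trans hxy⟩
    set sg : ℝ → ℝ := fun y => if FD y < F y then 1 else -1 with hsg
    have hsgm : Measurable sg :=
      Measurable.ite (measurableSet_lt hFDm.measurable hFm) measurable_const measurable_const
    have hsgb : ∀ y, ‖sg y‖ ≤ 1 := by
      intro y; simp only [hsg]; split_ifs <;> simp
    have hfi : ∀ a b, IntervalIntegrable sg volume a b := by
      intro a b
      refine (intervalIntegrable_const (c := (1 : ℝ))).mono_fun hsgm.aestronglyMeasurable ?_
      exact ae_of_all _ fun y => by simpa using hsgb y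
    refine ⟨fun x => ∫ y in (0 : ℝ)..x, sg y, ?_, fun g => ?_⟩
    · refine LipschitzWith.of_dist_le_mul fun x y => ?_
      rw [Real.dist_eq, intervalIntegral.integral_interval_sub_left (hfi _ _) (hfi _ _)]
      have := intervalIntegral.norm_integral_le_of_norm_le_const (a := y) (b := x) (f := sg) (C := 1)
        (fun z _ => hsgb z)
      simpa [Real.dist_eq] using this
    · rw [intervalIntegral.integral_interval_sub_left (hfi _ _) (hfi _ _)]
      rcases lt_or_ge g (D (f g)) with h | h
      · have : ∫ y in g..(D (f g)), sg y = ∫ y in g..(D (f g)), (1 : ℝ) := by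
          refine intervalIntegral.integral_congr_ae ?_
          rw [Set.uIoc_of_le h.le]
          have h0 : ∀ᵐ y : ℝ, y ≠ D (f g) := by simp [ae_iff, measure_singleton]
          filter_upwards [h0] with y hy hy2
          have hlt : FD y < F y := by
            refine lt_of_le_of_lt ?_ ((hf2 g).trans (hs hy2.1))
            refine Finset.sum_le_sum_of_subset_of_nonneg (fun j hj => ?_) fun j _ _ => hW j
            simp only [Finset.mem_filter, Finset.mem_range] at hj ⊢
            by_contra! hji
            have := hD _ _ hji hj.1
            exact hy (le_antisymm hy2.2 (this.trans hj.2))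
          simp [hsg, hlt]
        rw [this, abs_of_pos (by linarith)]
        simp
      · have : ∫ y in g..(D (f g)), sg y = ∫ y in g..(D (f g)), (-1 : ℝ) := by
          rw [intervalIntegral.integral_symm, intervalIntegral.integral_symm _ g]
          congr 1
          refine intervalIntegral.integral_congr_ae (ae_of_all _ fun y hy => ?_)
          rw [Set.uIoc_of_le h] at hy
          have hle : ¬ FD y < F y := by
            refine not_lt.2 ((hs.monotone hy.2).trans ((hf3 g).trans ?_))
            refine Finset.sum_le_sum_of_subset_of_nonneg (fun j hj => ?_) fun j _ _ => hW j
            simp only [Finset.mem_filter, Finset.mem_range] at hj ⊢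
            have := hf1 g
            exact ⟨by omega, (hD j (f g) (by omega) this).trans hy.1.le⟩
          simp [hsg, hle]
        rw [this, abs_of_nonpos (by linarith)]
        simp

/-- Quantile coupling of a finitely supported law with a centered Gaussian law: the `L¹` cost is
attained by a dual pair of `1`-Lipschitz functions. -/
theorem exists_quantile_coupling {E : Type*} {v : NNReal} (hv : v ≠ 0) (s : Finset E)
    (w D : E → ℝ) (hw : ∀ e ∈ s, 0 ≤ w e) (hsum : ∑ e ∈ s, w e = 1) :
    ∃ f : ℝ → E, (∀ g, f g ∈ s) ∧
      (∀ e ∈ s, MeasurableSet {g | f g = e} ∧ (gaussianReal 0 v).real {g | f g = e} = w e) ∧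
      ∃ φ : ℝ → ℝ, LipschitzWith 1 φ ∧ ∀ g, |D (f g) - g| = φ (D (f g)) - φ g := by
  classical
  set n := s.card with hn
  obtain ⟨e, hinj, hmem, hsurj, hmono⟩ : ∃ e : Fin n → E, Function.Injective e ∧ (∀ i, e i ∈ s) ∧
      (∀ x ∈ s, ∃ i, e i = x) ∧ Monotone (D ∘ e) := by
    let e0 : Fin n ≃ s := s.equivFin.symm
    let σ := Tuple.sort fun i => D (e0 i)
    refine ⟨fun i => e0 (σ i), fun i j h => ?_, fun i => (e0 (σ i)).2, fun x hx => ?_,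
      Tuple.monotone_sort fun i => D (e0 i)⟩
    · simpa [Subtype.val_inj] using h
    · exact ⟨σ.symm (e0.symm ⟨x, hx⟩), by simp⟩
  have hn0 : 0 < n := by
    rw [hn, Finset.card_pos]
    by_contra! h
    simp [h] at hsum
  set e' : ℕ → E := fun j => if h : j < n then e ⟨j, h⟩ else e ⟨0, hn0⟩ with he'
  have he : ∀ j (h : j < n), e' j = e ⟨j, h⟩ := fun j h => by simp [he', h]
  have himg : (Finset.range n).image e' = s := by
    ext x
    simp only [Finset.mem_image, Finset.mem_range]
    constructor
    · rintro ⟨j, hj, rfl⟩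
      rw [he j hj]
      exact hmem _
    · intro hx
      obtain ⟨i, rfl⟩ := hsurj x hx
      exact ⟨i, i.2, he _ i.2⟩
  have hinj' : ∀ i < n, ∀ j < n, e' i = e' j → i = j := by
    intro i hi j hj h
    rw [he i hi, he j hj] at h
    simpa using hinj h
  obtain ⟨f, h1, h2, φ, h3, h4⟩ := exists_quantile_nat hv n (fun j => w (e' j)) (fun j => D (e' j))
    (fun j => hw _ (by
      simp only [he']
      split_ifs <;> exact hmem _))
    (by
      rw [← hsum, ← himg, Finset.sum_image]
      intro i hi j hj
      exact hinj' i (by simpa using hi) j (by simpa using hj))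
    (fun i j hij hj => by
      rw [he j hj, he i (hij.trans_lt hj)]
      exact hmono (by simpa using hij))
  refine ⟨fun g => e' (f g), fun g => ?_, fun x hx => ?_, φ, h3, h4⟩
  · rw [← himg]
    exact Finset.mem_image_of_mem _ (by simpa using h1 g)
  · rw [← himg] at hx
    obtain ⟨i, hi, rfl⟩ := Finset.mem_image.1 hx
    have hi : i < n := by simpa using hi
    have : {g | e' (f g) = e' i} = {g | f g = i} := by
      ext g
      exact ⟨fun h => hinj' _ (h1 g) _ hi h, fun h => congrArg e' h⟩
    rw [this]
    exact h2 i hi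

lemma abs_sub_le_of_deriv_bound {g g' : ℝ → ℝ} (hg : ∀ y, HasDerivAt g (g' y) y) {C : ℝ} {y : ℝ}
    (hb : ∀ z, |z| ≤ |y| → |g' z| ≤ C) : |g y - g 0| ≤ C * |y| := by
  have h := Convex.norm_image_sub_le_of_norm_hasDerivWithin_le (f := g) (f' := g')
    (s := Metric.closedBall (0 : ℝ) |y|) (C := C) (x := 0) (y := y)
    (fun z _ => (hg z).hasDerivWithinAt) (fun z hz => hb z (by simpa using hz))
    (convex_closedBall _ _) (by simp) (by simp)
  simpa using h

/-- Taylor estimates for the iterated primitives of a Lipschitz function. -/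
lemma taylor_of_lipschitz {φ F H : ℝ → ℝ} (hφ : LipschitzWith 1 φ)
    (hF : ∀ x, HasDerivAt F (φ x) x) (hH : ∀ x, HasDerivAt H (F x) x) (x y : ℝ) :
    |F (x + y) - F x - φ x * y| ≤ |y| ^ 2 ∧
      |H (x + y) - H x - F x * y - φ x * y ^ 2 / 2| ≤ |y| ^ 3 := by
  have h1 : ∀ y, |F (x + y) - F x - φ x * y| ≤ |y| ^ 2 := by
    intro y
    have hd : ∀ z, HasDerivAt (fun z => F (x + z) - F x - φ x * z) (φ (x + z) - φ x) z := by
      intro z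
      have := (((hF (x + z)).comp_const_add x z).sub_const (F x)).sub
        ((hasDerivAt_id z).const_mul (φ x))
      exact this.congr_deriv (by simp)
    have := abs_sub_le_of_deriv_bound hd (C := |y|) (y := y) (fun z hz => by
      have := hφ.dist_le_mul (x + z) x
      simp only [Real.dist_eq, NNReal.coe_one, one_mul, add_sub_cancel_left] at this
      exact this.trans hz)
    simpa [sq] using this
  refine ⟨h1 y, ?_⟩
  have hd : ∀ z, HasDerivAt (fun z => H (x + z) - H x - F x * z - φ x * z ^ 2 / 2)
      (F (x + z) - F x - φ x * z) z := by
    intro z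
    have := ((((hH (x + z)).comp_const_add x z).sub_const (H x)).sub
        ((hasDerivAt_id z).const_mul (F x))).sub
        ((((hasDerivAt_id z).pow 2).const_mul (φ x)).div_const 2)
    refine (this.congr_deriv ?_)
    simp
    ring
  have := abs_sub_le_of_deriv_bound hd (C := |y| ^ 2) (y := y)
    (fun z hz => (h1 z).trans (by gcongr))
  simp only [add_zero, sub_self, mul_zero, ne_eq, OfNat.ofNat_ne_zero, not_false_eq_true, zero_pow,
    zero_div, sub_zero] at this
  calc _ ≤ _ := this
    _ = |y| ^ 3 := by ring

/-- A function with formal first and second derivatives satisfying a third order Taylor bound. -/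
structure TaylorBound (h h1 h2 : ℝ → ℝ) (A B K : ℝ) : Prop where
  meas : Measurable h
  meas1 : Measurable h1
  meas2 : Measurable h2
  growth : ∀ x, |h x| ≤ K + |x|
  bound1 : ∀ x, |h1 x| ≤ 2
  bound2 : ∀ x, |h2 x| ≤ A
  taylor : ∀ x y, |h (x + y) - h x - h1 x * y - h2 x * y ^ 2 / 2| ≤ B * |y| ^ 3

lemma exists_taylorBound {φ : ℝ → ℝ} (hφ : LipschitzWith 1 φ) {δ : ℝ} (hδ : 0 < δ) :
    ∃ h h1 h2 K, TaylorBound h h1 h2 (2 / δ) (4 / δ ^ 2) K ∧ ∀ x, |h x - φ x| ≤ 2 * δ := by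
  set F : ℝ → ℝ := fun x => ∫ y in (0 : ℝ)..x, φ y
  set H : ℝ → ℝ := fun x => ∫ y in (0 : ℝ)..x, F y
  have hφc := hφ.continuous
  have hF : ∀ x, HasDerivAt F (φ x) x := fun x =>
    intervalIntegral.integral_hasDerivAt_right (hφc.intervalIntegrable _ _)
      hφc.stronglyMeasurable.stronglyMeasurableAtFilter hφc.continuousAt
  have hFc : Continuous F := continuous_iff_continuousAt.2 fun x => (hF x).continuousAt
  have hH : ∀ x, HasDerivAt H (F x) x := fun x =>
    intervalIntegral.integral_hasDerivAt_right (hFc.intervalIntegrable _ _)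
      hFc.stronglyMeasurable.stronglyMeasurableAtFilter hFc.continuousAt
  have hHc : Continuous H := continuous_iff_continuousAt.2 fun x => (hH x).continuousAt
  have ht := fun x y => taylor_of_lipschitz hφ hF hH x y
  have hL : ∀ x y, |φ (x + y) - φ x| ≤ |y| := by
    intro x y
    have := hφ.dist_le_mul (x + y) x
    simpa [Real.dist_eq] using this
  have hclose : ∀ x, |(H (x + δ) - 2 * H x + H (x - δ)) / δ ^ 2 - φ x| ≤ 2 * δ := by
    intro x
    have a1 := (ht x δ).2
    have a2 := (ht x (-δ)).2
    rw [abs_neg, abs_of_pos hδ] at a2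
    rw [abs_of_pos hδ] at a1
    rw [← sub_eq_add_neg] at a2
    have : (H (x + δ) - 2 * H x + H (x - δ)) / δ ^ 2 - φ x =
        ((H (x + δ) - H x - F x * δ - φ x * δ ^ 2 / 2) +
          (H (x - δ) - H x - F x * -δ - φ x * (-δ) ^ 2 / 2)) / δ ^ 2 := by
      field_simp; ring
    rw [this, abs_div, abs_of_pos (show 0 < δ ^ 2 by positivity), div_le_iff₀ (by positivity)]
    refine (abs_add_le _ _).trans ?_
    nlinarith
  refine ⟨fun x => (H (x + δ) - 2 * H x + H (x - δ)) / δ ^ 2,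
    fun x => (F (x + δ) - 2 * F x + F (x - δ)) / δ ^ 2,
    fun x => (φ (x + δ) - 2 * φ x + φ (x - δ)) / δ ^ 2, |φ 0| + 2 * δ, ?_, hclose⟩
  refine ⟨by fun_prop, by fun_prop, by fun_prop, fun x => ?_, fun x => ?_, fun x => ?_,
    fun x y => ?_⟩
  · have a1 := abs_add_le ((H (x + δ) - 2 * H x + H (x - δ)) / δ ^ 2 - φ x) (φ x)
    have a2 := hL 0 x
    have a3 := abs_add_le (φ x - φ 0) (φ 0)
    rw [zero_add] at a2
    rw [sub_add_cancel] at a1 a3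
    linarith [hclose x]
  · have a1 := (ht x δ).1
    have a2 := (ht x (-δ)).1
    rw [abs_neg, abs_of_pos hδ] at a2
    rw [abs_of_pos hδ] at a1
    rw [← sub_eq_add_neg] at a2
    rw [abs_div, abs_of_pos (show 0 < δ ^ 2 by positivity), div_le_iff₀ (by positivity)]
    rw [abs_le] at *
    constructor <;> linarith
  · have a1 := hL x δ
    have a2 := hL x (-δ)
    rw [abs_neg, abs_of_pos hδ] at a2
    rw [abs_of_pos hδ] at a1
    rw [← sub_eq_add_neg] at a2
    rw [abs_div, abs_of_pos (show 0 < δ ^ 2 by positivity), div_le_iff₀ (by positivity),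
      show 2 / δ * δ ^ 2 = 2 * δ by field_simp]
    rw [abs_le] at *
    constructor <;> linarith
  · have a1 := (ht (x + δ) y).2
    have a2 := (ht x y).2
    have a3 := (ht (x - δ) y).2
    rw [show x + y + δ = x + δ + y by ring, show x + y - δ = x - δ + y by ring]
    rw [show (H (x + δ + y) - 2 * H (x + y) + H (x - δ + y)) / δ ^ 2 -
      (H (x + δ) - 2 * H x + H (x - δ)) / δ ^ 2 - (F (x + δ) - 2 * F x + F (x - δ)) / δ ^ 2 * y -
      (φ (x + δ) - 2 * φ x + φ (x - δ)) / δ ^ 2 * y ^ 2 / 2 =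
      ((H (x + δ + y) - H (x + δ) - F (x + δ) * y - φ (x + δ) * y ^ 2 / 2) -
      2 * (H (x + y) - H x - F x * y - φ x * y ^ 2 / 2) +
      (H (x - δ + y) - H (x - δ) - F (x - δ) * y - φ (x - δ) * y ^ 2 / 2)) / δ ^ 2 by ring]
    rw [abs_div, abs_of_pos (show 0 < δ ^ 2 by positivity), div_le_iff₀ (by positivity),
      show 4 / δ ^ 2 * |y| ^ 3 * δ ^ 2 = 4 * |y| ^ 3 by field_simp]
    rw [abs_le] at *
    constructor <;> linarith

section

/-- The third absolute moment of the standard Gaussian law. -/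
def gaussianThird : ℝ := ∫ y, |y| ^ 3 ∂(gaussianReal 0 1)

lemma gaussianThird_nonneg : 0 ≤ gaussianThird := integral_nonneg fun y => by positivity

lemma integrable_abs_pow_gaussianReal (v : NNReal) (n : ℕ) :
    Integrable (fun y : ℝ => |y| ^ n) (gaussianReal 0 v) := by
  simpa using (memLp_id_gaussianReal (μ := 0) (v := v) n).integrable_norm_pow'

lemma integral_abs_pow_gaussianReal (v : NNReal) (n : ℕ) :
    ∫ y, |y| ^ n ∂(gaussianReal 0 v) = √v ^ n * ∫ y, |y| ^ n ∂(gaussianReal 0 1) := by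
  have h : gaussianReal 0 v = (gaussianReal 0 1).map (fun y => √v * y) := by
    rw [gaussianReal_map_const_mul]
    congr 1
    · simp
    · ext; simp
  rw [h, integral_map (by fun_prop) (by fun_prop), ← integral_const_mul]
  simp [abs_mul, mul_pow, abs_of_nonneg (Real.sqrt_nonneg _)]

lemma integrable_of_growth {g : ℝ → ℝ} (hg : Measurable g) {K : ℝ} (h : ∀ x, |g x| ≤ K + |x|)
    (v : NNReal) (a : ℝ) : Integrable (fun z => g (a + z)) (gaussianReal 0 v) := by
  have h1 := integrable_abs_pow_gaussianReal v 1
  simp only [pow_one] at h1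
  refine (((integrable_const (K + |a|)).add h1).mono'
    (hg.comp (measurable_const_add a)).aestronglyMeasurable (ae_of_all _ fun z => ?_))
  have := h (a + z)
  have := abs_add_le a z
  simp only [Real.norm_eq_abs, Pi.add_apply]
  linarith

lemma integrable_of_bounded {g : ℝ → ℝ} (hg : Measurable g) {K : ℝ} (h : ∀ x, |g x| ≤ K)
    (v : NNReal) (a : ℝ) : Integrable (fun z => g (a + z)) (gaussianReal 0 v) :=
  integrable_of_growth hg (K := K) (fun x => (h x).trans (by linarith [abs_nonneg x])) v a

/-- Averaging over a centered Gaussian law. -/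
def gaussAvg (v : NNReal) (g : ℝ → ℝ) (a : ℝ) : ℝ := ∫ z, g (a + z) ∂(gaussianReal 0 v)

lemma gaussAvg_zero (g : ℝ → ℝ) (a : ℝ) : gaussAvg 0 g a = g a := by
  simp [gaussAvg, gaussianReal_zero_var]

variable {h h1 h2 : ℝ → ℝ} {A B K : ℝ}

lemma TaylorBound.gaussAvg_taylor (H : TaylorBound h h1 h2 A B K) (v : NNReal) (a y : ℝ) :
    |gaussAvg v h (a + y) - gaussAvg v h a - gaussAvg v h1 a * y - gaussAvg v h2 a * y ^ 2 / 2| ≤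
      B * |y| ^ 3 := by
  have i0 := fun a => integrable_of_growth H.meas H.growth v a
  have i1 := fun a => integrable_of_bounded H.meas1 H.bound1 v a
  have i2 := fun a => integrable_of_bounded H.meas2 H.bound2 v a
  have : gaussAvg v h (a + y) - gaussAvg v h a - gaussAvg v h1 a * y - gaussAvg v h2 a * y ^ 2 / 2 =
      ∫ z, (h (a + y + z) - h (a + z) - h1 (a + z) * y - h2 (a + z) * y ^ 2 / 2)
        ∂(gaussianReal 0 v) := by
    rw [integral_sub, integral_sub, integral_sub (i0 _) (i0 _), integral_mul_const, integral_div,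
      integral_mul_const]
    · rfl
    · exact (i0 _).sub (i0 _)
    · exact (i1 _).mul_const _
    · exact ((i0 _).sub (i0 _)).sub ((i1 _).mul_const _)
    · exact ((i2 _).mul_const _).div_const _
  rw [this]
  have := norm_integral_le_of_norm_le_const (μ := gaussianReal 0 v) (C := B * |y| ^ 3)
    (f := fun z => h (a + y + z) - h (a + z) - h1 (a + z) * y - h2 (a + z) * y ^ 2 / 2)
    (ae_of_all _ fun z => by
      have := H.taylor (a + z) y
      rwa [show a + z + y = a + y + z by ring] at this)
  simpa using this

lemma TaylorBound.abs_gaussAvg_le (H : TaylorBound h h1 h2 A B K) (v : NNReal) (a : ℝ) :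
    |gaussAvg v h2 a| ≤ A := by
  have := norm_integral_le_of_norm_le_const (μ := gaussianReal 0 v) (C := A)
    (f := fun z => h2 (a + z)) (ae_of_all _ fun z => H.bound2 _)
  simpa [gaussAvg] using this

lemma TaylorBound.gaussAvg_add (H : TaylorBound h h1 h2 A B K) (s v : NNReal) (a : ℝ) :
    gaussAvg (s + v) h a = ∫ y, gaussAvg v h (a + y) ∂(gaussianReal 0 s) ∧
      Integrable (fun y => gaussAvg v h (a + y)) (gaussianReal 0 s) := by
  have hc : gaussianReal 0 (s + v) = Measure.conv (gaussianReal 0 s) (gaussianReal 0 v) := by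
    rw [gaussianReal_conv_gaussianReal, add_zero]
  have hi := integrable_of_growth H.meas H.growth (s + v) a
  have hm : Measurable fun z => h (a + z) := H.meas.comp (measurable_const_add a)
  rw [hc, Measure.conv] at hi
  rw [integrable_map_measure hm.aestronglyMeasurable (by fun_prop)] at hi
  constructor
  · rw [gaussAvg, hc, Measure.conv, integral_map (by fun_prop) hm.aestronglyMeasurable]
    refine (integral_prod _ hi).trans ?_
    simp [gaussAvg, add_assoc]
  · have := hi.integral_prod_left
    simpa [gaussAvg, add_assoc] using this

lemma TaylorBound.gaussAvg_step (H : TaylorBound h h1 h2 A B K) (s v : NNReal) (a : ℝ) :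
    |gaussAvg (s + v) h a - gaussAvg v h a - gaussAvg v h2 a * s / 2| ≤
      B * (gaussianThird * √s ^ 3) := by
  obtain ⟨e, hi⟩ := H.gaussAvg_add s v a
  have j1 : Integrable (fun y : ℝ => y) (gaussianReal 0 s) :=
    memLp_one_iff_integrable.1 (memLp_id_gaussianReal (μ := 0) (v := s) 1)
  have j2 : Integrable (fun y : ℝ => y ^ 2) (gaussianReal 0 s) := by
    simpa using integrable_abs_pow_gaussianReal s 2
  have e1 : ∫ y : ℝ, y ∂(gaussianReal 0 s) = 0 := integral_id_gaussianReal
  have e2 : ∫ y : ℝ, y ^ 2 ∂(gaussianReal 0 s) = s := by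
    have hv := variance_fun_id_gaussianReal (μ := 0) (v := s)
    rwa [variance_of_integral_eq_zero (by fun_prop) integral_id_gaussianReal] at hv
  have : gaussAvg (s + v) h a - gaussAvg v h a - gaussAvg v h2 a * s / 2 =
      ∫ y, (gaussAvg v h (a + y) - gaussAvg v h a - gaussAvg v h1 a * y -
        gaussAvg v h2 a * y ^ 2 / 2) ∂(gaussianReal 0 s) := by
    rw [integral_sub, integral_sub, integral_sub hi (integrable_const _), integral_const_mul,
      integral_div, integral_const_mul, e1, e2, e]
    · simp
    · exact hi.sub (integrable_const _)
    · exact j1.const_mul _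
    · exact (hi.sub (integrable_const _)).sub (j1.const_mul _)
    · exact (j2.const_mul _).div_const _
  rw [this]
  refine (abs_integral_le_integral_abs).trans ?_
  have h3 : ∫ y, B * |y| ^ 3 ∂(gaussianReal 0 s) = B * (gaussianThird * √s ^ 3) := by
    rw [integral_const_mul, integral_abs_pow_gaussianReal, gaussianThird, mul_comm (√_ ^ 3)]
  rw [← h3]
  refine integral_mono_of_nonneg (ae_of_all _ fun y => abs_nonneg _)
    ((integrable_abs_pow_gaussianReal s 3).const_mul _) (ae_of_all _ fun y => ?_)
  exact H.gaussAvg_taylor v a y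

/-- One step of the Lindeberg replacement for a centered two-point law. -/
lemma TaylorBound.lindeberg_step (H : TaylorBound h h1 h2 A B K) (hB : 0 ≤ B) (s v : NNReal)
    (a c u : ℝ) (hu0 : 0 ≤ u) (hu1 : u ≤ 1) :
    |u * gaussAvg v h (a + c * (1 - (2 * u - 1))) +
        (1 - u) * gaussAvg v h (a + c * (-1 - (2 * u - 1))) - gaussAvg (s + v) h a| ≤
      A / 2 * |c ^ 2 * (1 - (2 * u - 1) ^ 2) - s| + B * (8 * |c| ^ 3 + gaussianThird * √s ^ 3) := by
  have t1 := H.gaussAvg_taylor v a (c * (1 - (2 * u - 1)))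
  have t2 := H.gaussAvg_taylor v a (c * (-1 - (2 * u - 1)))
  have t3 := H.gaussAvg_step s v a
  have hA := H.abs_gaussAvg_le v a
  set q0 := gaussAvg v h a
  set q1 := gaussAvg v h1 a
  set q2 := gaussAvg v h2 a
  set x := gaussAvg v h (a + c * (1 - (2 * u - 1)))
  set y := gaussAvg v h (a + c * (-1 - (2 * u - 1)))
  have hc3 : ∀ m : ℝ, |m| ≤ 2 → B * |c * m| ^ 3 ≤ B * (8 * |c| ^ 3) := by
    intro m hm
    rw [abs_mul, mul_pow]
    have : |m| ^ 3 ≤ 2 ^ 3 := by gcongr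
    have h0 : 0 ≤ |c| ^ 3 := by positivity
    have : |c| ^ 3 * |m| ^ 3 ≤ 8 * |c| ^ 3 := by nlinarith
    gcongr
  have t1' := t1.trans (hc3 _ (by rw [abs_le]; constructor <;> linarith))
  have t2' := t2.trans (hc3 _ (by rw [abs_le]; constructor <;> linarith))
  have hA2 : |q2 * (c ^ 2 * (1 - (2 * u - 1) ^ 2) - s)| ≤
      A * |c ^ 2 * (1 - (2 * u - 1) ^ 2) - s| := by
    rw [abs_mul]; gcongr
  rw [show u * x + (1 - u) * y - gaussAvg (s + v) h a =
    u * (x - q0 - q1 * (c * (1 - (2 * u - 1))) - q2 * (c * (1 - (2 * u - 1))) ^ 2 / 2) +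
    (1 - u) * (y - q0 - q1 * (c * (-1 - (2 * u - 1))) - q2 * (c * (-1 - (2 * u - 1))) ^ 2 / 2) -
    (gaussAvg (s + v) h a - q0 - q2 * s / 2) +
    q2 * (c ^ 2 * (1 - (2 * u - 1) ^ 2) - s) / 2 by ring]
  have hu1' : 0 ≤ 1 - u := by linarith
  have m1 := mul_le_mul_of_nonneg_left t1' hu0
  have m2 := mul_le_mul_of_nonneg_left t2' hu1'
  rw [← abs_of_nonneg hu0, ← abs_mul, abs_of_nonneg hu0] at m1
  rw [← abs_of_nonneg hu1', ← abs_mul, abs_of_nonneg hu1'] at m2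
  rw [abs_le] at *
  constructor <;> linarith

end

section

/-- Conditional expectation of `Φ` after `L` steps of a `±1` process started from the history `h`
at time `j`; a history is recorded as the set of times of its `+1` steps, and `u i h` is the
conditional probability that step `i` is `+1`. -/
def pathAvg (u : ℕ → Finset ℕ → ℝ) : ℕ → ℕ → (Finset ℕ → ℝ) → Finset ℕ → ℝ
  | 0, _, Φ, h => Φ h
  | L + 1, j, Φ, h => u j h * pathAvg u L (j + 1) Φ (insert j h) +
      (1 - u j h) * pathAvg u L (j + 1) Φ (h.erase j)

/-- Agreement of two histories before time `j`. -/
def AgreeBelow (j : ℕ) (g h : Finset ℕ) : Prop := ∀ m < j, m ∈ g ↔ m ∈ h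

/-- The step at time `i`. -/
def stepSign (i : ℕ) (g : Finset ℕ) : ℝ := if i ∈ g then 1 else -1

/-- Transition probabilities of a `±1` process depending only on the past. -/
structure IsTransition (u : ℕ → Finset ℕ → ℝ) : Prop where
  nonneg : ∀ i h, 0 ≤ u i h
  le_one : ∀ i h, u i h ≤ 1
  adapted : ∀ i g h, AgreeBelow i g h → u i g = u i h

lemma AgreeBelow.mono {i j : ℕ} {g h : Finset ℕ} (H : AgreeBelow j g h) (hij : i ≤ j) :
    AgreeBelow i g h := fun m hm => H m (hm.trans_le hij)

lemma AgreeBelow.of_insert {j : ℕ} {g h : Finset ℕ} (H : AgreeBelow (j + 1) g (insert j h)) :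
    AgreeBelow j g h ∧ j ∈ g := by
  refine ⟨fun m hm => ?_, ?_⟩
  · rw [H m (by omega), Finset.mem_insert]; simp [hm.ne]
  · rw [H j (by omega)]; simp

lemma AgreeBelow.of_erase {j : ℕ} {g h : Finset ℕ} (H : AgreeBelow (j + 1) g (h.erase j)) :
    AgreeBelow j g h ∧ j ∉ g := by
  refine ⟨fun m hm => ?_, ?_⟩
  · rw [H m (by omega), Finset.mem_erase]; simp [hm.ne]
  · rw [H j (by omega)]; simp

variable {u : ℕ → Finset ℕ → ℝ}

lemma pathAvg_mono (hu : IsTransition u) (L j : ℕ) (h : Finset ℕ) {Φ Ψ : Finset ℕ → ℝ}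
    (H : ∀ g, AgreeBelow j g h → (∀ m, j + L ≤ m → (m ∈ g ↔ m ∈ h)) → Φ g ≤ Ψ g) :
    pathAvg u L j Φ h ≤ pathAvg u L j Ψ h := by
  induction L generalizing j h with
  | zero => exact H h (fun _ _ => Iff.rfl) (fun _ _ => Iff.rfl)
  | succ L ih =>
    have h1 := ih (j + 1) (insert j h) fun g hg hg' => H g hg.of_insert.1 fun m hm => by
      rw [hg' m (by omega), Finset.mem_insert]; simp [show m ≠ j by omega]
    have h2 := ih (j + 1) (h.erase j) fun g hg hg' => H g hg.of_erase.1 fun m hm => by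
      rw [hg' m (by omega), Finset.mem_erase]; simp [show m ≠ j by omega]
    have := hu.nonneg j h
    have := hu.le_one j h
    simp only [pathAvg]
    gcongr

lemma pathAvg_congr (hu : IsTransition u) (L j : ℕ) (h : Finset ℕ) {Φ Ψ : Finset ℕ → ℝ}
    (H : ∀ g, AgreeBelow j g h → (∀ m, j + L ≤ m → (m ∈ g ↔ m ∈ h)) → Φ g = Ψ g) :
    pathAvg u L j Φ h = pathAvg u L j Ψ h :=
  le_antisymm (pathAvg_mono hu L j h fun g a b => (H g a b).le)
    (pathAvg_mono hu L j h fun g a b => (H g a b).ge)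

lemma pathAvg_add (L j : ℕ) (h : Finset ℕ) (Φ Ψ : Finset ℕ → ℝ) :
    pathAvg u L j (fun g => Φ g + Ψ g) h = pathAvg u L j Φ h + pathAvg u L j Ψ h := by
  induction L generalizing j h with
  | zero => rfl
  | succ L ih => simp only [pathAvg, ih]; ring

lemma pathAvg_const_mul (L j : ℕ) (h : Finset ℕ) (a : ℝ) (Φ : Finset ℕ → ℝ) :
    pathAvg u L j (fun g => a * Φ g) h = a * pathAvg u L j Φ h := by
  induction L generalizing j h with
  | zero => rfl
  | succ L ih => simp only [pathAvg, ih]; ring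

lemma pathAvg_const (L j : ℕ) (h : Finset ℕ) (a : ℝ) : pathAvg u L j (fun _ => a) h = a := by
  induction L generalizing j h with
  | zero => rfl
  | succ L ih => simp only [pathAvg, ih]; ring

lemma pathAvg_sum {ι : Type*} (s : Finset ι) (L j : ℕ) (h : Finset ℕ) (Φ : ι → Finset ℕ → ℝ) :
    pathAvg u L j (fun g => ∑ i ∈ s, Φ i g) h = ∑ i ∈ s, pathAvg u L j (Φ i) h := by
  classical
  induction s using Finset.induction_on with
  | empty => simp [pathAvg_const]
  | insert a s ha ih => simp only [Finset.sum_insert ha, pathAvg_add, ih]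

lemma pathAvg_comp (L L' j : ℕ) (h : Finset ℕ) (Φ : Finset ℕ → ℝ) :
    pathAvg u (L + L') j Φ h = pathAvg u L j (pathAvg u L' (j + L) Φ) h := by
  induction L generalizing j h with
  | zero => simp [pathAvg]
  | succ L ih =>
    rw [show L + 1 + L' = (L + L') + 1 by ring]
    simp only [pathAvg, ih, show j + 1 + L = j + (L + 1) by ring]

/-- The centered step at time `i`. -/
def centeredStep (u : ℕ → Finset ℕ → ℝ) (i : ℕ) (g : Finset ℕ) : ℝ :=
  stepSign i g - (2 * u i g - 1)

/-- The martingale transform `∑ c i * ξ i` over a block of times. -/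
def blockSum (u : ℕ → Finset ℕ → ℝ) (c : ℕ → ℝ) (j L : ℕ) (g : Finset ℕ) : ℝ :=
  ∑ i ∈ Finset.Ico j (j + L), c i * centeredStep u i g

lemma blockSum_succ (c : ℕ → ℝ) (j L : ℕ) (g : Finset ℕ) : blockSum u c j (L + 1) g =
    c j * centeredStep u j g + blockSum u c (j + 1) L g := by
  unfold blockSum
  rw [Finset.sum_eq_sum_Ico_succ_bot (by omega), show j + (L + 1) = j + 1 + L by ring]

lemma centeredStep_of_insert (hu : IsTransition u) {j : ℕ} {g h : Finset ℕ}
    (H : AgreeBelow (j + 1) g (insert j h)) : centeredStep u j g = 1 - (2 * u j h - 1) := by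
  rw [centeredStep, stepSign, if_pos H.of_insert.2, hu.adapted j g h H.of_insert.1]

lemma centeredStep_of_erase (hu : IsTransition u) {j : ℕ} {g h : Finset ℕ}
    (H : AgreeBelow (j + 1) g (h.erase j)) : centeredStep u j g = -1 - (2 * u j h - 1) := by
  rw [centeredStep, stepSign, if_neg H.of_erase.2, hu.adapted j g h H.of_erase.1]

/-- Peeling off the first step of a function of the block sum. -/
lemma pathAvg_blockSum_succ (hu : IsTransition u) (c : ℕ → ℝ) (L j : ℕ) (h : Finset ℕ)
    (φ : ℝ → ℝ) (a : ℝ) : pathAvg u (L + 1) j (fun g => φ (a + blockSum u c j (L + 1) g)) h =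
      u j h * pathAvg u L (j + 1) (fun g => φ (a + c j * (1 - (2 * u j h - 1)) +
        blockSum u c (j + 1) L g)) (insert j h) +
      (1 - u j h) * pathAvg u L (j + 1) (fun g => φ (a + c j * (-1 - (2 * u j h - 1)) +
        blockSum u c (j + 1) L g)) (h.erase j) := by
  simp only [pathAvg]
  congr 2
  · exact pathAvg_congr hu _ _ _ fun g hg _ => by
      rw [blockSum_succ, centeredStep_of_insert hu hg, add_assoc]
  · exact pathAvg_congr hu _ _ _ fun g hg _ => by
      rw [blockSum_succ, centeredStep_of_erase hu hg, add_assoc]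

/-- The error of replacing step `i` by a Gaussian increment of variance `s i`. -/
def lindebergError (u : ℕ → Finset ℕ → ℝ) (c : ℕ → ℝ) (s : ℕ → NNReal) (A B : ℝ) (i : ℕ)
    (g : Finset ℕ) : ℝ :=
  A / 2 * |c i ^ 2 * (1 - (2 * u i g - 1) ^ 2) - s i| +
    B * (8 * |c i| ^ 3 + gaussianThird * √(s i) ^ 3)

theorem TaylorBound.lindeberg {φ φ1 φ2 : ℝ → ℝ} {A B K : ℝ} (H : TaylorBound φ φ1 φ2 A B K)
    (hB : 0 ≤ B) (hu : IsTransition u) (c : ℕ → ℝ) (s : ℕ → NNReal) (L j : ℕ) (h : Finset ℕ)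
    (a : ℝ) :
    |pathAvg u L j (fun g => φ (a + blockSum u c j L g)) h -
        gaussAvg (∑ i ∈ Finset.Ico j (j + L), s i) φ a| ≤
      pathAvg u L j (fun g => ∑ i ∈ Finset.Ico j (j + L), lindebergError u c s A B i g) h := by
  induction L generalizing j h a with
  | zero => simp [pathAvg, blockSum, gaussAvg_zero]
  | succ L ih =>
    have i1 := ih (j + 1) (insert j h) (a + c j * (1 - (2 * u j h - 1)))
    have i2 := ih (j + 1) (h.erase j) (a + c j * (-1 - (2 * u j h - 1)))
    have hu0 := hu.nonneg j h
    have hu1 : 0 ≤ 1 - u j h := sub_nonneg.2 (hu.le_one j h)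
    have st := H.lindeberg_step hB (s j) (∑ i ∈ Finset.Ico (j + 1) (j + 1 + L), s i) a (c j)
      (u j h) hu0 (hu.le_one j h)
    rw [pathAvg_blockSum_succ hu, Finset.sum_eq_sum_Ico_succ_bot (by omega),
      show j + (L + 1) = j + 1 + L by ring]
    have e : pathAvg u (L + 1) j
        (fun g => ∑ i ∈ Finset.Ico j (j + 1 + L), lindebergError u c s A B i g) h =
        lindebergError u c s A B j h + (u j h * pathAvg u L (j + 1)
          (fun g => ∑ i ∈ Finset.Ico (j + 1) (j + 1 + L), lindebergError u c s A B i g) (insert j h) +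
        (1 - u j h) * pathAvg u L (j + 1)
          (fun g => ∑ i ∈ Finset.Ico (j + 1) (j + 1 + L), lindebergError u c s A B i g)
          (h.erase j)) := by
      have : pathAvg u (L + 1) j
          (fun g => ∑ i ∈ Finset.Ico j (j + 1 + L), lindebergError u c s A B i g) h =
          pathAvg u (L + 1) j (fun g => lindebergError u c s A B j h +
            ∑ i ∈ Finset.Ico (j + 1) (j + 1 + L), lindebergError u c s A B i g) h := by
        refine pathAvg_congr hu _ _ _ fun g hg _ => ?_
        rw [Finset.sum_eq_sum_Ico_succ_bot (by omega)]
        congr 1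
        rw [lindebergError, lindebergError, hu.adapted j g h hg]
      rw [this, pathAvg_add, pathAvg_const]
      rfl
    rw [e]
    have m1 := mul_le_mul_of_nonneg_left i1 hu0
    have m2 := mul_le_mul_of_nonneg_left i2 hu1
    rw [← abs_of_nonneg hu0, ← abs_mul, abs_of_nonneg hu0] at m1
    rw [← abs_of_nonneg hu1, ← abs_mul, abs_of_nonneg hu1] at m2
    change _ ≤ lindebergError u c s A B j h at st
    rw [abs_le] at *
    constructor <;> linarith

theorem lindeberg_lipschitz {φ : ℝ → ℝ} (hφ : LipschitzWith 1 φ) {δ : ℝ} (hδ : 0 < δ)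
    (hu : IsTransition u) (c : ℕ → ℝ) (s : ℕ → NNReal) (L j : ℕ) (h : Finset ℕ) :
    pathAvg u L j (fun g => φ (blockSum u c j L g)) h -
        ∫ y, φ y ∂(gaussianReal 0 (∑ i ∈ Finset.Ico j (j + L), s i)) ≤
      4 * δ + pathAvg u L j (fun g => ∑ i ∈ Finset.Ico j (j + L),
        lindebergError u c s (2 / δ) (4 / δ ^ 2) i g) h := by
  obtain ⟨f, f1, f2, K, hf, hfφ⟩ := exists_taylorBound hφ hδ
  have h1 := hf.lindeberg (by positivity) hu c s L j h 0
  set V := ∑ i ∈ Finset.Ico j (j + L), s i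
  have h2 : pathAvg u L j (fun g => φ (blockSum u c j L g)) h ≤
      pathAvg u L j (fun g => f (0 + blockSum u c j L g)) h + 2 * δ := by
    rw [← pathAvg_const (u := u) L j h (2 * δ), ← pathAvg_add]
    refine pathAvg_mono hu _ _ _ fun g _ _ => ?_
    have := (abs_le.1 (hfφ (blockSum u c j L g))).1
    rw [zero_add]
    linarith
  have h3 : gaussAvg V f 0 ≤ ∫ y, φ y ∂(gaussianReal 0 V) + 2 * δ := by
    have i1 := integrable_of_growth hf.meas hf.growth V 0
    have i2 : Integrable φ (gaussianReal 0 V) := by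
      have := integrable_of_growth hφ.continuous.measurable (K := K + 2 * δ) (fun x => by
        have := abs_sub_abs_le_abs_sub (φ x) (f x)
        rw [abs_sub_comm (φ x)] at this
        linarith [hfφ x, hf.growth x]) V 0
      simpa using this
    have : ∫ y, φ y ∂(gaussianReal 0 V) + 2 * δ = ∫ y, (φ y + 2 * δ) ∂(gaussianReal 0 V) := by
      rw [integral_add i2 (integrable_const _)]; simp
    rw [this]
    refine integral_mono i1 (i2.add (integrable_const _)) fun y => ?_
    have := (abs_le.1 (hfφ y)).2
    simp only [zero_add]
    linarith
  linarith [(abs_le.1 h1).2]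

lemma pathAvg_exp_le (hu : IsTransition u) (c : ℕ → ℝ) (L j : ℕ) (h : Finset ℕ) (a l : ℝ) :
    pathAvg u L j (fun g => Real.exp (l * (a + blockSum u c j L g))) h ≤
      Real.exp (l * a + 4 * l ^ 2 * ∑ i ∈ Finset.Ico j (j + L), c i ^ 2) := by
  induction L generalizing j h a with
  | zero => simp [pathAvg, blockSum]
  | succ L ih =>
    rw [pathAvg_blockSum_succ hu c L j h (fun x => Real.exp (l * x)) a]
    have i1 := ih (j + 1) (insert j h) (a + c j * (1 - (2 * u j h - 1)))
    have i2 := ih (j + 1) (h.erase j) (a + c j * (-1 - (2 * u j h - 1)))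
    have hu0 := hu.nonneg j h
    have hu1 : 0 ≤ 1 - u j h := sub_nonneg.2 (hu.le_one j h)
    have key : ∀ x : ℝ, Real.exp x ≤ x + Real.exp (x ^ 2) := fun x => by
      have h1 := Real.add_one_le_exp (x ^ 2)
      rcases le_total |x| 1 with hx | hx
      · have := Real.abs_exp_sub_one_sub_id_le hx
        rw [abs_le] at this
        linarith
      · rcases le_total 0 x with h0 | h0
        · rw [abs_of_nonneg h0] at hx
          have : Real.exp x ≤ Real.exp (x ^ 2) := Real.exp_le_exp.2 (by nlinarith)
          linarith
        · rw [abs_of_nonpos h0] at hx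
          have : Real.exp x ≤ 1 := Real.exp_le_one_iff.2 h0
          nlinarith
    set U := u j h
    set T := ∑ i ∈ Finset.Ico (j + 1) (j + 1 + L), c i ^ 2
    have k1 : Real.exp (l * (c j * (1 - (2 * U - 1)))) ≤
        l * (c j * (1 - (2 * U - 1))) + Real.exp (4 * l ^ 2 * c j ^ 2) :=
      (key _).trans (by
        gcongr
        have : (1 - (2 * U - 1)) ^ 2 ≤ 4 := by nlinarith
        have h0 : 0 ≤ l ^ 2 * c j ^ 2 := by positivity
        nlinarith)
    have k2 : Real.exp (l * (c j * (-1 - (2 * U - 1)))) ≤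
        l * (c j * (-1 - (2 * U - 1))) + Real.exp (4 * l ^ 2 * c j ^ 2) :=
      (key _).trans (by
        gcongr
        have : (-1 - (2 * U - 1)) ^ 2 ≤ 4 := by nlinarith
        have h0 : 0 ≤ l ^ 2 * c j ^ 2 := by positivity
        nlinarith)
    have k3 : U * Real.exp (l * (c j * (1 - (2 * U - 1)))) +
        (1 - U) * Real.exp (l * (c j * (-1 - (2 * U - 1)))) ≤ Real.exp (4 * l ^ 2 * c j ^ 2) := by
      nlinarith [mul_le_mul_of_nonneg_left k1 hu0, mul_le_mul_of_nonneg_left k2 hu1]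
    rw [Finset.sum_eq_sum_Ico_succ_bot (by omega), show j + (L + 1) = j + 1 + L by ring]
    calc _ ≤ U * Real.exp (l * (a + c j * (1 - (2 * U - 1))) + 4 * l ^ 2 * T) +
          (1 - U) * Real.exp (l * (a + c j * (-1 - (2 * U - 1))) + 4 * l ^ 2 * T) := by gcongr
      _ = Real.exp (l * a + 4 * l ^ 2 * T) * (U * Real.exp (l * (c j * (1 - (2 * U - 1)))) +
        (1 - U) * Real.exp (l * (c j * (-1 - (2 * U - 1))))) := by
          rw [mul_add (Real.exp _), mul_left_comm, mul_left_comm (Real.exp _), ← Real.exp_add,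
            ← Real.exp_add]
          ring_nf
      _ ≤ Real.exp (l * a + 4 * l ^ 2 * T) * Real.exp (4 * l ^ 2 * c j ^ 2) := by gcongr
      _ = Real.exp (l * a + 4 * l ^ 2 * (c j ^ 2 + T)) := by
          rw [← Real.exp_add]
          congr 1
          ring

/-- Even moments of a block sum are controlled by its total variance. -/
lemma pathAvg_blockSum_pow_le (hu : IsTransition u) (c : ℕ → ℝ) (L j : ℕ) (h : Finset ℕ) (r : ℕ)
    {v : ℝ} (hv : 0 < v) (hc : ∑ i ∈ Finset.Ico j (j + L), c i ^ 2 ≤ v) :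
    pathAvg u L j (fun g => blockSum u c j L g ^ (2 * r)) h ≤
      (2 * r).factorial * (2 * Real.exp 4) * v ^ r := by
  have h1 : ∀ g, blockSum u c j L g ^ (2 * r) ≤ ((2 * r).factorial * v ^ r) *
      (Real.exp ((√v)⁻¹ * (0 + blockSum u c j L g)) +
        Real.exp (-(√v)⁻¹ * (0 + blockSum u c j L g))) := by
    intro g
    set x := blockSum u c j L g
    have h2 := Real.pow_div_factorial_le_exp |(√v)⁻¹ * x| (abs_nonneg _) (2 * r)
    have h3 : Real.exp |(√v)⁻¹ * x| ≤ Real.exp ((√v)⁻¹ * x) + Real.exp (-(√v)⁻¹ * x) := by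
      rcases abs_cases ((√v)⁻¹ * x) with h | h <;> rw [h.1]
      · linarith [Real.exp_pos (-(√v)⁻¹ * x)]
      · rw [neg_mul]; linarith [Real.exp_pos ((√v)⁻¹ * x)]
    rw [(even_two_mul r).pow_abs, mul_pow, inv_pow, pow_mul √v, Real.sq_sqrt hv.le,
      div_le_iff₀ (by positivity), inv_mul_le_iff₀ (by positivity)] at h2
    rw [zero_add]
    refine h2.trans ?_
    rw [mul_comm (Real.exp _), ← mul_assoc, mul_comm (v ^ r)]
    gcongr
  refine (pathAvg_mono hu L j h fun g _ _ => h1 g).trans ?_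
  rw [pathAvg_const_mul, pathAvg_add]
  have e1 := pathAvg_exp_le hu c L j h 0 (√v)⁻¹
  have e2 := pathAvg_exp_le hu c L j h 0 (-(√v)⁻¹)
  have hle : Real.exp (4 * v⁻¹ * ∑ i ∈ Finset.Ico j (j + L), c i ^ 2) ≤ Real.exp 4 := by
    rw [Real.exp_le_exp, mul_assoc]
    have : v⁻¹ * ∑ i ∈ Finset.Ico j (j + L), c i ^ 2 ≤ 1 := by
      rw [inv_mul_le_iff₀ hv]; simpa using hc
    linarith
  rw [mul_zero, zero_add, inv_pow, Real.sq_sqrt hv.le] at e1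
  rw [mul_zero, zero_add, neg_sq, inv_pow, Real.sq_sqrt hv.le] at e2
  calc _ ≤ ((2 * r).factorial * v ^ r) * (Real.exp 4 + Real.exp 4) := by
        gcongr
        · exact e1.trans hle
        · exact e2.trans hle
    _ = _ := by ring

end

section

/-- The histories that agree with `h` outside the block of times `[j, j + L)`. -/
def blockHistories (j L : ℕ) (h : Finset ℕ) : Finset (Finset ℕ) :=
  (Finset.Ico j (j + L)).powerset.image fun b => (h \ Finset.Ico j (j + L)) ∪ b

lemma mem_blockHistories {j L : ℕ} {h g : Finset ℕ} : g ∈ blockHistories j L h ↔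
    AgreeBelow j g h ∧ ∀ m, j + L ≤ m → (m ∈ g ↔ m ∈ h) := by
  simp only [blockHistories, Finset.mem_image, Finset.mem_powerset]
  constructor
  · rintro ⟨b, hb, rfl⟩
    have hb' : ∀ m, m ∈ b → j ≤ m ∧ m < j + L := fun m hm => Finset.mem_Ico.1 (hb hm)
    refine ⟨fun m hm => ?_, fun m hm => ?_⟩
    · have : m ∉ b := fun hb => by have := hb' m hb; omega
      simp only [Finset.mem_union, Finset.mem_sdiff, Finset.mem_Ico, this, or_false,
        and_iff_left_iff_imp]
      intro _; omega
    · have : m ∉ b := fun hb => by have := hb' m hb; omega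
      simp only [Finset.mem_union, Finset.mem_sdiff, Finset.mem_Ico, this, or_false,
        and_iff_left_iff_imp]
      intro _; omega
  · rintro ⟨h1, h2⟩
    refine ⟨g ∩ Finset.Ico j (j + L), Finset.inter_subset_right, ?_⟩
    ext m
    simp only [Finset.mem_union, Finset.mem_sdiff, Finset.mem_Ico, Finset.mem_inter]
    by_cases hm : m < j
    · have := h1 m hm; grind
    · by_cases hm' : j + L ≤ m
      · have := h2 m hm'; grind
      · grind

variable {u : ℕ → Finset ℕ → ℝ}

lemma sum_blockHistories (hu : IsTransition u) (j L : ℕ) (h : Finset ℕ) (Φ : Finset ℕ → ℝ) :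
    ∑ e ∈ blockHistories j L h, pathAvg u L j (fun g => if g = e then 1 else 0) h * Φ e =
      pathAvg u L j Φ h := by
  have : ∀ e, pathAvg u L j (fun g => if g = e then 1 else 0) h * Φ e =
      pathAvg u L j (fun g => Φ e * if g = e then 1 else 0) h := fun e => by
    rw [pathAvg_const_mul, mul_comm]
  simp only [this]
  rw [← pathAvg_sum]
  refine pathAvg_congr hu _ _ _ fun g h1 h2 => ?_
  simp only [mul_ite, mul_one, mul_zero]
  rw [Finset.sum_ite_eq, if_pos (mem_blockHistories.2 ⟨h1, h2⟩)]

/-- A function taking finitely many values on measurable pieces integrates to a finite sum. -/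
lemma integral_comp_finite {Ω E : Type*} [MeasurableSpace Ω] [DecidableEq E] {μ : Measure Ω}
    [IsFiniteMeasure μ] {f : Ω → E} {s : Finset E} (hs : ∀ ω, f ω ∈ s)
    (hf : ∀ e ∈ s, MeasurableSet {ω | f ω = e}) (Φ : E → ℝ) :
    Integrable (fun ω => Φ (f ω)) μ ∧
      ∫ ω, Φ (f ω) ∂μ = ∑ e ∈ s, μ.real {ω | f ω = e} * Φ e := by
  have key : (fun ω => Φ (f ω)) =
      fun ω => ∑ e ∈ s, ({ω | f ω = e}.indicator (fun _ => Φ e)) ω := by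
    funext ω
    simp only [Set.indicator_apply, Set.mem_ofPred_eq]
    rw [Finset.sum_ite_eq, if_pos (hs ω)]
  have hi : ∀ e ∈ s, Integrable ({ω | f ω = e}.indicator (fun _ => Φ e)) μ := fun e he =>
    (integrable_const _).indicator (hf e he)
  rw [key]
  refine ⟨integrable_finsetSum _ hi, ?_⟩
  rw [integral_finsetSum _ hi]
  refine Finset.sum_congr rfl fun e he => ?_
  rw [integral_indicator_const _ (hf e he), smul_eq_mul]

/-- One block of the coupling: the block sum of the walk is built from a Gaussian variable. -/
lemma exists_block_step (hu : IsTransition u) (c : ℕ → ℝ) (s : ℕ → NNReal) (j L : ℕ)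
    (h : Finset ℕ) {V : NNReal} (hV : V = ∑ i ∈ Finset.Ico j (j + L), s i) (hV0 : V ≠ 0) :
    ∃ f : ℝ → Finset ℕ, (∀ y, f y ∈ blockHistories j L h) ∧
      (∀ e, MeasurableSet {y | f y = e}) ∧
      (∀ Φ : Finset ℕ → ℝ, Integrable (fun y => Φ (f y)) (gaussianReal 0 V) ∧
        ∫ y, Φ (f y) ∂(gaussianReal 0 V) = pathAvg u L j Φ h) ∧
      Integrable (fun y => |blockSum u c j L (f y) - y|) (gaussianReal 0 V) ∧
      ∀ δ > 0, ∫ y, |blockSum u c j L (f y) - y| ∂(gaussianReal 0 V) ≤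
        4 * δ + pathAvg u L j (fun g => ∑ i ∈ Finset.Ico j (j + L),
          lindebergError u c s (2 / δ) (4 / δ ^ 2) i g) h := by
  obtain ⟨f, hf, hfw, φ, hφ, hD⟩ := exists_quantile_coupling hV0 (blockHistories j L h)
    (fun e => pathAvg u L j (fun g => if g = e then 1 else 0) h) (blockSum u c j L)
    (fun e _ => by
      have := pathAvg_mono hu L j h (Φ := fun _ => 0) (Ψ := fun g => if g = e then 1 else 0)
        fun g _ _ => by split_ifs <;> norm_num
      rwa [pathAvg_const] at this)
    (by simpa [pathAvg_const] using sum_blockHistories hu j L h fun _ => 1)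
  have hfi : ∀ Φ : Finset ℕ → ℝ, Integrable (fun y => Φ (f y)) (gaussianReal 0 V) ∧
      ∫ y, Φ (f y) ∂(gaussianReal 0 V) = pathAvg u L j Φ h := fun Φ => by
    obtain ⟨h1, h2⟩ := integral_comp_finite (μ := gaussianReal 0 V) hf (fun e he => (hfw e he).1) Φ
    refine ⟨h1, h2.trans ?_⟩
    rw [← sum_blockHistories hu]
    exact Finset.sum_congr rfl fun e he => by rw [(hfw e he).2]
  have i1 := (hfi fun g => φ (blockSum u c j L g)).1
  have i2 : Integrable φ (gaussianReal 0 V) := by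
    refine Integrable.mono' (g := fun y => |φ 0| + |y| ^ 1)
      ((integrable_const _).add (integrable_abs_pow_gaussianReal V 1))
      hφ.continuous.aestronglyMeasurable (ae_of_all _ fun y => ?_)
    have := hφ.dist_le_mul y 0
    simp only [NNReal.coe_one, one_mul, Real.dist_eq, sub_zero] at this
    rw [Real.norm_eq_abs, pow_one]
    calc |φ y| = |φ 0 + (φ y - φ 0)| := by ring_nf
      _ ≤ |φ 0| + |φ y - φ 0| := abs_add_le _ _
      _ ≤ _ := by gcongr
  refine ⟨f, hf, fun e => ?_, hfi, ?_, fun δ hδ => ?_⟩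
  · by_cases he : e ∈ blockHistories j L h
    · exact (hfw e he).1
    · convert MeasurableSet.empty
      ext y
      simp only [Set.mem_ofPred_eq, Set.mem_empty_iff_false, iff_false]
      exact fun hy => he (hy ▸ hf y)
  · simp only [hD]
    exact i1.sub i2
  · simp only [hD]
    rw [integral_sub i1 i2, (hfi fun g => φ (blockSum u c j L g)).2, hV]
    exact lindeberg_lipschitz hφ hδ hu c s L j h

end

/-- Integration against an independent pair, one component of which takes finitely many values. -/
lemma integral_comp_indep_finite {Ω E : Type*} [MeasurableSpace Ω] [DecidableEq E]
    [MeasurableSpace E] [MeasurableSingletonClass E] {P : Measure Ω} [IsProbabilityMeasure P]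
    {H : Ω → E} {G : Ω → ℝ} (hH : Measurable H) (hG : Measurable G) (hind : IndepFun H G P)
    {s : Finset E} (hs : ∀ ω, H ω ∈ s) (Ξ : E → ℝ → ℝ)
    (hΞ : ∀ e ∈ s, Integrable (Ξ e) (P.map G)) :
    Integrable (fun ω => Ξ (H ω) (G ω)) P ∧
      ∫ ω, Ξ (H ω) (G ω) ∂P = ∫ ω, (∫ y, Ξ (H ω) y ∂(P.map G)) ∂P := by
  have hm : ∀ e, MeasurableSet {ω | H ω = e} := fun e => hH (measurableSet_singleton e)
  have key : (fun ω => Ξ (H ω) (G ω)) =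
      fun ω => ∑ e ∈ s, (({e} : Set E).indicator (fun _ => (1 : ℝ)) (H ω)) * Ξ e (G ω) := by
    funext ω
    simp only [Set.indicator_apply, Set.mem_singleton_iff, ite_mul, one_mul, zero_mul]
    rw [Finset.sum_ite_eq, if_pos (hs ω)]
  have hi1 : ∀ e, Measurable (({e} : Set E).indicator (fun _ => (1 : ℝ))) := fun e =>
    measurable_const.indicator (measurableSet_singleton e)
  have hi2 : ∀ e, Integrable (fun ω => ({e} : Set E).indicator (fun _ => (1 : ℝ)) (H ω)) P :=
    fun e => (integrable_const (1 : ℝ)).indicator (hm e)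
  have hi3 : ∀ e ∈ s, Integrable (fun ω => Ξ e (G ω)) P := fun e he =>
    (hΞ e he).comp_measurable hG
  have hind' : ∀ e ∈ s, IndepFun (fun ω => ({e} : Set E).indicator (fun _ => (1 : ℝ)) (H ω))
      (fun ω => Ξ e (G ω)) P := fun e he =>
    hind.comp₀ hH.aemeasurable hG.aemeasurable (hi1 e).aemeasurable (hΞ e he).aemeasurable
  have hi4 : ∀ e ∈ s, Integrable (fun ω => ({e} : Set E).indicator (fun _ => (1 : ℝ)) (H ω) *
      Ξ e (G ω)) P := fun e he => (hind' e he).integrable_mul (hi2 e) (hi3 e he)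
  rw [(integral_comp_finite hs (fun e _ => hm e) fun e => ∫ y, Ξ e y ∂(P.map G)).2, key]
  refine ⟨integrable_finsetSum _ hi4, ?_⟩
  rw [integral_finsetSum _ hi4]
  refine Finset.sum_congr rfl fun e he => ?_
  rw [(hind' e he).integral_fun_mul_eq_mul_integral (hi2 e).aestronglyMeasurable
    (hi3 e he).aestronglyMeasurable, integral_map hG.aemeasurable (hΞ e he).aestronglyMeasurable]
  congr 1
  exact (integral_indicator_const (1 : ℝ) (hm e)).trans (by simp)

/-- Histories built block by block from a driving sequence `x`. -/
def blockPath (f : ℕ → Finset ℕ → ℝ → Finset ℕ) : ℕ → (ℕ → ℝ) → Finset ℕ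
  | 0, _ => ∅
  | k + 1, x => f k (blockPath f k x) (x k)

lemma blockPath_congr (f : ℕ → Finset ℕ → ℝ → Finset ℕ) (k : ℕ) {x y : ℕ → ℝ}
    (h : ∀ i < k, x i = y i) : blockPath f k x = blockPath f k y := by
  induction k with
  | zero => rfl
  | succ k ih => rw [blockPath, blockPath, ih fun i hi => h i (by omega), h k (by omega)]

lemma measurableSet_blockPath {f : ℕ → Finset ℕ → ℝ → Finset ℕ}
    (hf : ∀ k h e, MeasurableSet {y | f k h y = e}) (k : ℕ) (e : Finset ℕ) :
    MeasurableSet {x | blockPath f k x = e} := by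
  induction k generalizing e with
  | zero => exact MeasurableSet.const (∅ = e)
  | succ k ih =>
    have : {x | blockPath f (k + 1) x = e} =
        ⋃ h, {x | blockPath f k x = h} ∩ (fun x : ℕ → ℝ => x k) ⁻¹' {y | f k h y = e} := by
      ext x
      simp [blockPath]
    rw [this]
    exact MeasurableSet.iUnion fun h => (ih h).inter (measurable_pi_apply k (hf k h e))

/-- A `±1` process whose block sums are close to given independent Gaussian variables. -/
theorem exists_block_coupling {Ω : Type*} [MeasurableSpace Ω] {P : Measure Ω}
    [IsProbabilityMeasure P] {u : ℕ → Finset ℕ → ℝ} (hu : IsTransition u) (c : ℕ → ℝ)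
    (s : ℕ → NNReal) {N : ℕ → ℕ} (hN : StrictMono N) (hN0 : N 0 = 0) {G : ℕ → Ω → ℝ}
    (hG : ∀ k, Measurable (G k)) (hind : iIndepFun G P)
    (hlaw : ∀ k, P.map (G k) = gaussianReal 0 (∑ i ∈ Finset.Ico (N k) (N (k + 1)), s i))
    (hpos : ∀ k, ∑ i ∈ Finset.Ico (N k) (N (k + 1)), s i ≠ 0) :
    ∃ H : ℕ → Ω → Finset ℕ, (∀ k e, MeasurableSet {ω | H k ω = e}) ∧
      (∀ k ω, H k ω ⊆ Finset.range (N k)) ∧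
      (∀ k ω, AgreeBelow (N k) (H (k + 1) ω) (H k ω)) ∧
      (∀ k Φ, Integrable (fun ω => Φ (H k ω)) P ∧
        ∫ ω, Φ (H k ω) ∂P = pathAvg u (N k) 0 Φ ∅) ∧
      ∀ k, Integrable (fun ω => |blockSum u c (N k) (N (k + 1) - N k) (H (k + 1) ω) - G k ω|) P ∧
        ∀ δ > 0, ∫ ω, |blockSum u c (N k) (N (k + 1) - N k) (H (k + 1) ω) - G k ω| ∂P ≤
          4 * δ + pathAvg u (N (k + 1)) 0 (fun g => ∑ i ∈ Finset.Ico (N k) (N (k + 1)),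
            lindebergError u c s (2 / δ) (4 / δ ^ 2) i g) ∅ := by
  have hle : ∀ k, N k + (N (k + 1) - N k) = N (k + 1) := fun k =>
    Nat.add_sub_cancel' (hN.monotone (Nat.le_succ k))
  have hstep := fun k h => exists_block_step hu c s (N k) (N (k + 1) - N k) h
    (V := ∑ i ∈ Finset.Ico (N k) (N (k + 1)), s i) (by rw [hle]) (hpos k)
  choose f hf1 hf2 hf3 hf4 hf5 using hstep
  set H : ℕ → Ω → Finset ℕ := fun k ω => blockPath f k fun i => G i ω with hH
  have hGm : Measurable fun ω i => G i ω := measurable_pi_iff.2 hG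
  have hHm : ∀ k e, MeasurableSet {ω | H k ω = e} := fun k e =>
    hGm (measurableSet_blockPath hf2 k e)
  have hsub : ∀ k ω, H k ω ⊆ Finset.range (N k) := by
    intro k ω
    induction k with
    | zero => exact Finset.empty_subset _
    | succ k ih =>
      intro m hm
      by_contra hc
      rw [Finset.mem_range, not_lt, ← hle k] at hc
      have h1 := ((mem_blockHistories.1 (hf1 k (H k ω) (G k ω))).2 m hc).1 hm
      have h2 := Finset.mem_range.1 (ih h1)
      omega
  let _ : MeasurableSpace (Finset ℕ) := ⊤
  have _ : MeasurableSingletonClass (Finset ℕ) := ⟨fun _ => trivial⟩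
  have hHmeas : ∀ k, Measurable (H k) := fun k => measurable_to_countable' fun e => hHm k e
  have hHG : ∀ k, IndepFun (H k) (G k) P := by
    intro k
    have h1 := hind.indepFun_finset (Finset.range k) {k}
      (by simp) hG
    let ext0 : ((i : Finset.range k) → ℝ) → ℕ → ℝ := fun z i =>
      if hi : i ∈ Finset.range k then z ⟨i, hi⟩ else 0
    have hext : Measurable ext0 := by
      refine measurable_pi_iff.2 fun i => ?_
      by_cases hi : i ∈ Finset.range k
      · simpa only [ext0, hi, dif_pos] using measurable_pi_apply (⟨i, hi⟩ : Finset.range k)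
      · simpa only [ext0, hi, dif_neg, not_false_iff] using measurable_const
    have h2 : Measurable fun z => blockPath f k (ext0 z) :=
      measurable_to_countable' fun e => hext (measurableSet_blockPath hf2 k e)
    have h3 : Measurable fun z : ((i : ({k} : Finset ℕ)) → ℝ) => z ⟨k, by simp⟩ :=
      measurable_pi_apply _
    have h4 : H k = (fun z => blockPath f k (ext0 z)) ∘ fun ω (i : Finset.range k) => G i ω := by
      funext ω
      exact blockPath_congr f k fun i hi => by simp [ext0, hi]
    rw [h4]
    exact h1.comp h2 h3
  have hmem : ∀ k ω, H k ω ∈ (Finset.range (N k)).powerset := fun k ω =>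
    Finset.mem_powerset.2 (hsub k ω)
  have hfi : ∀ k Φ, ∫ ω, Φ (H k ω) ∂P = pathAvg u (N k) 0 Φ ∅ := by
    intro k
    induction k with
    | zero => intro Φ; simp [hH, blockPath, hN0, pathAvg]
    | succ k ih =>
      intro Φ
      have := (integral_comp_indep_finite (hHmeas k) (hG k) (hHG k) (hmem k)
        (fun h y => Φ (f k h y)) (fun h _ => by rw [hlaw]; exact (hf3 k h Φ).1)).2
      change ∫ ω, Φ (f k (H k ω) (G k ω)) ∂P = _
      rw [this, ih fun h => ∫ y, Φ (f k h y) ∂(P.map (G k)), ← hle k, pathAvg_comp, hlaw, zero_add]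
      simp only [(hf3 k _ Φ).2]
  refine ⟨H, hHm, hsub, fun k ω => (mem_blockHistories.1 (hf1 k _ _)).1, fun k Φ =>
    ⟨(integral_comp_finite (hmem k) (fun e _ => hHm k e) Φ).1, hfi k Φ⟩, fun k => ?_⟩
  have := integral_comp_indep_finite (hHmeas k) (hG k) (hHG k) (hmem k)
    (fun h y => |blockSum u c (N k) (N (k + 1) - N k) (f k h y) - y|)
    (fun h _ => by rw [hlaw]; exact hf4 k h)
  refine ⟨this.1, fun δ hδ => ?_⟩
  refine this.2.trans_le ?_
  rw [hfi k fun h => ∫ y, |blockSum u c (N k) (N (k + 1) - N k) (f k h y) - y| ∂(P.map (G k)),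
    ← pathAvg_const (u := u) (N k) 0 ∅ (4 * δ)]
  conv_rhs => rw [← hle k, pathAvg_comp, zero_add]
  rw [← pathAvg_add, hlaw]
  refine pathAvg_mono hu _ _ _ fun h _ _ => ?_
  simpa only [hle, pathAvg_const] using hf5 k h δ hδ

/-- Position after `j` steps. -/
def walkSum (j : ℕ) (h : Finset ℕ) : ℝ := ∑ i ∈ Finset.range j, stepSign i h

/-- Conditional probability of a `+1` step of the elephant random walk. -/
def erwProb (p q : ℝ) (j : ℕ) (h : Finset ℕ) : ℝ :=
  if j = 0 then q else (1 + (2 * p - 1) * walkSum j h / j) / 2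

lemma stepSign_congr {i j : ℕ} {g h : Finset ℕ} (H : AgreeBelow j g h) (hi : i < j) :
    stepSign i g = stepSign i h := by
  simp only [stepSign, H i hi]

lemma walkSum_congr {j : ℕ} {g h : Finset ℕ} (H : AgreeBelow j g h) : walkSum j g = walkSum j h :=
  Finset.sum_congr rfl fun _ hi => stepSign_congr H (Finset.mem_range.1 hi)

lemma abs_stepSign (i : ℕ) (h : Finset ℕ) : |stepSign i h| = 1 := by
  unfold stepSign; split_ifs <;> simp

lemma abs_walkSum_le (j : ℕ) (h : Finset ℕ) : |walkSum j h| ≤ j := by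
  refine (Finset.abs_sum_le_sum_abs _ _).trans ?_
  simp [abs_stepSign]

lemma walkSum_succ (j : ℕ) (h : Finset ℕ) : walkSum (j + 1) h = walkSum j h + stepSign j h :=
  Finset.sum_range_succ _ _

lemma isTransition_erwProb {p q : ℝ} (hp0 : 0 ≤ p) (hp1 : p ≤ 1) (hq0 : 0 ≤ q) (hq1 : q ≤ 1) :
    IsTransition (erwProb p q) := by
  have key : ∀ (j : ℕ) (h : Finset ℕ), |(2 * p - 1) * walkSum j h / j| ≤ 1 := fun j h => by
    rw [abs_div, abs_mul, Nat.abs_cast]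
    refine div_le_one_of_le₀ ?_ (Nat.cast_nonneg _)
    calc |2 * p - 1| * |walkSum j h| ≤ 1 * j := by
          gcongr
          · exact abs_le.2 ⟨by linarith, by linarith⟩
          · exact abs_walkSum_le j h
      _ = j := one_mul _
  refine ⟨fun i h => ?_, fun i h => ?_, fun i g h H => ?_⟩
  · unfold erwProb; split_ifs
    · exact hq0
    · linarith [(abs_le.1 (key i h)).1]
  · unfold erwProb; split_ifs
    · exact hq1
    · linarith [(abs_le.1 (key i h)).2]
  · simp only [erwProb, walkSum_congr H]

section
variable {u : ℕ → Finset ℕ → ℝ}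

lemma pathAvg_last (n : ℕ) (h : Finset ℕ) (Φ : Finset ℕ → ℝ) :
    pathAvg u (n + 1) 0 Φ h =
      pathAvg u n 0 (fun g => u n g * Φ (insert n g) + (1 - u n g) * Φ (g.erase n)) h := by
  rw [pathAvg_comp, zero_add]
  rfl

lemma pathAvg_of_agreeBelow (hu : IsTransition u) {n M : ℕ} (hn : n ≤ M) (h : Finset ℕ)
    {Φ : Finset ℕ → ℝ} (hΦ : ∀ g g', AgreeBelow n g g' → Φ g = Φ g') :
    pathAvg u M 0 Φ h = pathAvg u n 0 Φ h := by
  obtain ⟨L, rfl⟩ := Nat.exists_eq_add_of_le hn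
  rw [pathAvg_comp]
  refine pathAvg_congr hu _ _ _ fun g _ _ => ?_
  rw [zero_add]
  calc pathAvg u L n Φ g = pathAvg u L n (fun _ => Φ g) g :=
        pathAvg_congr hu _ _ _ fun g' hg' _ => hΦ _ _ hg'
    _ = Φ g := pathAvg_const _ _ _ _

open Classical in
lemma pathAvg_indicator (hu : IsTransition u) (n : ℕ) (e h : Finset ℕ) :
    pathAvg u n 0 (fun g => if AgreeBelow n g e then 1 else 0) h =
      ∏ m ∈ Finset.range n, if m ∈ e then u m e else 1 - u m e := by
  induction n with
  | zero => simp [pathAvg, AgreeBelow]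
  | succ n ih =>
    have h1 : ∀ g, AgreeBelow (n + 1) (insert n g) e ↔ AgreeBelow n g e ∧ n ∈ e := fun g => by
      constructor
      · intro H
        refine ⟨fun m hm => ?_, (H n (by omega)).1 (Finset.mem_insert_self _ _)⟩
        rw [← H m (by omega)]; simp [hm.ne]
      · rintro ⟨H, hn⟩ m hm
        rcases Nat.lt_succ_iff_lt_or_eq.1 hm with hm | rfl
        · rw [← H m hm]; simp [hm.ne]
        · simp [hn]
    have h2 : ∀ g, AgreeBelow (n + 1) (g.erase n) e ↔ AgreeBelow n g e ∧ n ∉ e := fun g => by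
      constructor
      · intro H
        refine ⟨fun m hm => ?_, fun hn => by simpa using (H n (by omega)).2 hn⟩
        rw [← H m (by omega)]; simp [hm.ne]
      · rintro ⟨H, hn⟩ m hm
        rcases Nat.lt_succ_iff_lt_or_eq.1 hm with hm | rfl
        · rw [← H m hm]; simp [hm.ne]
        · simp [hn]
    rw [pathAvg_last, Finset.prod_range_succ, ← ih, mul_comm, ← pathAvg_const_mul]
    refine pathAvg_congr hu _ _ _ fun g _ _ => ?_
    simp only [h1, h2]
    by_cases hA : AgreeBelow n g e
    · by_cases hn : n ∈ e <;> simp [hA, hn, hu.adapted n g e hA]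
    · simp [hA]

end

lemma walkSum_insert (n : ℕ) (g : Finset ℕ) : walkSum (n + 1) (insert n g) = walkSum n g + 1 := by
  rw [walkSum_succ, walkSum_congr (h := g) fun m hm => by simp [hm.ne]]
  simp [stepSign]

lemma walkSum_erase (n : ℕ) (g : Finset ℕ) : walkSum (n + 1) (g.erase n) = walkSum n g - 1 := by
  rw [walkSum_succ, walkSum_congr (h := g) fun m hm => by simp [hm.ne]]
  simp [stepSign, sub_eq_add_neg]

/-- A (non-sharp) second moment bound for the elephant random walk. -/
lemma pathAvg_walkSum_sq_le {p q : ℝ} (hp0 : 0 ≤ p) (hp1 : p ≤ 3 / 4) (hq0 : 0 ≤ q) (hq1 : q ≤ 1)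
    (n : ℕ) : pathAvg (erwProb p q) n 0 (fun g => walkSum n g ^ 2) ∅ ≤ 2 * (n * √n) := by
  have hu := isTransition_erwProb hp0 (by linarith : p ≤ 1) hq0 hq1
  induction n with
  | zero => simp [pathAvg, walkSum]
  | succ n ih =>
    have hpt : ∀ g, erwProb p q n g * walkSum (n + 1) (insert n g) ^ 2 +
        (1 - erwProb p q n g) * walkSum (n + 1) (g.erase n) ^ 2 ≤
        (1 + (n : ℝ)⁻¹) * walkSum n g ^ 2 + 1 := fun g => by
      rw [walkSum_insert, walkSum_erase]
      rcases Nat.eq_zero_or_pos n with rfl | hn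
      · simp [walkSum]
      · have : 2 * erwProb p q n g - 1 = (2 * p - 1) * walkSum n g / n := by
          rw [erwProb, if_neg hn.ne']; ring
        have e : erwProb p q n g * (walkSum n g + 1) ^ 2 +
            (1 - erwProb p q n g) * (walkSum n g - 1) ^ 2 =
            walkSum n g ^ 2 + 2 * walkSum n g * (2 * erwProb p q n g - 1) + 1 := by ring
        rw [e, this]
        have hS : 0 ≤ walkSum n g ^ 2 * (n : ℝ)⁻¹ := by positivity
        have : 2 * walkSum n g * ((2 * p - 1) * walkSum n g / n) =
          (4 * p - 2) * (walkSum n g ^ 2 * (n : ℝ)⁻¹) := by rw [div_eq_mul_inv]; ring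
        rw [this]
        nlinarith
    rw [pathAvg_last]
    refine (pathAvg_mono hu _ _ _ fun g _ _ => hpt g).trans ?_
    rw [pathAvg_add, pathAvg_const_mul, pathAvg_const]
    push_cast
    have h0 : (0 : ℝ) ≤ √n := Real.sqrt_nonneg _
    have h1 : (1 : ℝ) ≤ √(n + 1 : ℝ) := Real.one_le_sqrt.2 (by simp)
    have h2 : √(n : ℝ) ≤ √(n + 1 : ℝ) := Real.sqrt_le_sqrt (by simp)
    have h3 : √(n : ℝ) ^ 2 = n := Real.sq_sqrt (by positivity)
    have h4 : √(n + 1 : ℝ) ^ 2 = n + 1 := Real.sq_sqrt (by positivity)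
    have h5 : (1 + (n : ℝ)⁻¹) * (2 * (n * √n)) ≤ 2 * (n + 1) * √n := by
      rcases Nat.eq_zero_or_pos n with rfl | hn
      · simp
      · have : (0 : ℝ) < n := by exact_mod_cast hn
        apply le_of_eq; field_simp
    have h6 : (1 + (n : ℝ)⁻¹) * pathAvg (erwProb p q) n 0 (fun g => walkSum n g ^ 2) ∅ ≤
      (1 + (n : ℝ)⁻¹) * (2 * (n * √n)) := by gcongr
    set a := √(n : ℝ)
    set b := √(n + 1 : ℝ)
    have h7 : (b - a) * (b + a) = 1 := by nlinarith
    have h8 : 1 ≤ 2 * (n + 1 : ℝ) * (b - a) := by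
      rw [← h4]
      have : 0 ≤ b - a := by linarith
      nlinarith [mul_nonneg this (by linarith : 0 ≤ b - a), mul_nonneg this h0,
        mul_nonneg (mul_nonneg this (by linarith : 0 ≤ b)) (by linarith : 0 ≤ b - 1)]
    linarith

/-- The elephant random walk decomposes into a martingale transform and a small drift. -/
lemma walkSum_decomposition (p q : ℝ) (n : ℕ) (hn : 1 ≤ n) (h : Finset ℕ) :
    (n : ℝ) ^ (-(2 * p - 1)) * walkSum n h = (2 * q - 1) +
      blockSum (erwProb p q) (fun i => ((i : ℝ) + 1) ^ (-(2 * p - 1))) 0 n h +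
      ∑ j ∈ Finset.Ico 1 n, ((1 + (2 * p - 1) / j) * ((j : ℝ) + 1) ^ (-(2 * p - 1)) -
        (j : ℝ) ^ (-(2 * p - 1))) * walkSum j h := by
  induction n, hn using Nat.le_induction with
  | base => simp [walkSum, blockSum, centeredStep, erwProb]
  | succ n hn ih =>
    rw [Finset.sum_Ico_succ_top hn]
    have hb : blockSum (erwProb p q) (fun i => ((i : ℝ) + 1) ^ (-(2 * p - 1))) 0 (n + 1) h =
        blockSum (erwProb p q) (fun i => ((i : ℝ) + 1) ^ (-(2 * p - 1))) 0 n h +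
        ((n : ℝ) + 1) ^ (-(2 * p - 1)) * (stepSign n h - (2 * p - 1) * walkSum n h / n) := by
      simp only [blockSum, zero_add]
      rw [Finset.sum_Ico_succ_top (Nat.zero_le n)]
      congr 2
      rw [centeredStep, erwProb, if_neg (by omega)]
      ring
    rw [hb, walkSum_succ]
    push_cast
    linear_combination ih

/-- The steps read off from a consistent family of histories form an elephant random walk. -/
lemma isERW_of_histories {Ω : Type*} [MeasurableSpace Ω] {P : Measure Ω} [IsProbabilityMeasure P]
    {p q : ℝ} (hp0 : 0 ≤ p) (hp1 : p ≤ 1) (hq0 : 0 ≤ q) (hq1 : q ≤ 1)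
    {H : ℕ → Ω → Finset ℕ} (hHm : ∀ n e, MeasurableSet {ω | H n ω = e})
    (hcons : ∀ n m, n ≤ m → ∀ ω, AgreeBelow n (H m ω) (H n ω))
    (hlaw : ∀ n Φ, (∀ g g', AgreeBelow n g g' → Φ g = Φ g') →
      ∫ ω, Φ (H n ω) ∂P = pathAvg (erwProb p q) n 0 Φ ∅) :
    IsERW P p q fun i ω => if i ∈ H (i + 1) ω then 1 else -1 := by
  classical
  have hu := isTransition_erwProb hp0 hp1 hq0 hq1
  have hmeas : ∀ n (A : Set (Finset ℕ)), MeasurableSet {ω | H n ω ∈ A} := fun n A => by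
    have : {ω | H n ω ∈ A} = ⋃ e ∈ A, {ω | H n ω = e} := by ext ω; simp
    rw [this]
    exact MeasurableSet.biUnion (Set.to_countable _) fun e _ => hHm n e
  refine ⟨fun n => ?_, fun n ω => ?_, fun n ε hε => ?_⟩
  · exact Measurable.ite (hmeas (n + 1) {e | n ∈ e}) measurable_const measurable_const
  · dsimp only; split_ifs <;> simp
  · set e : Finset ℕ := (Finset.range (n + 1)).filter fun i => ε i = 1 with he
    have hmem : ∀ i ≤ n, (i ∈ e ↔ ε i = 1) := fun i hi => by
      simp only [he, Finset.mem_filter, Finset.mem_range]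
      exact and_iff_right (by omega)
    have hset : {ω | ∀ i ≤ n, (if i ∈ H (i + 1) ω then (1 : ℤ) else -1) = ε i} =
        {ω | H (n + 1) ω ∈ {g | AgreeBelow (n + 1) g e}} := by
      ext ω
      simp only [Set.mem_ofPred_eq]
      have hi : ∀ i ≤ n, (((if i ∈ H (i + 1) ω then (1 : ℤ) else -1) = ε i) ↔
          (i ∈ H (n + 1) ω ↔ i ∈ e)) := fun i hi => by
        rw [hmem i hi, hcons (i + 1) (n + 1) (by omega) ω i (by omega)]
        rcases hε i with h1 | h1 <;> by_cases h2 : i ∈ H (i + 1) ω <;> simp [h1, h2]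
      constructor
      · intro h i hi'
        exact (hi i (by omega)).1 (h i (by omega))
      · intro h i hi'
        exact (hi i hi').2 (h i (by omega))
    rw [hset]
    change P.real _ = _
    rw [← integral_indicator_one (hmeas _ _)]
    have : ({ω | H (n + 1) ω ∈ {g | AgreeBelow (n + 1) g e}}.indicator 1 : Ω → ℝ) =
        fun ω => (fun g => if AgreeBelow (n + 1) g e then (1 : ℝ) else 0) (H (n + 1) ω) := by
      funext ω
      simp [Set.indicator_apply]
    rw [this, hlaw, pathAvg_indicator hu, Finset.prod_range_succ', mul_comm]
    · congr 1
      · simp only [hmem 0 (by omega), erwProb, if_true]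
      · refine Finset.prod_congr rfl fun m hm => ?_
        rw [Finset.mem_range] at hm
        have hs : walkSum (m + 1) e = ∑ i ∈ Finset.range (m + 1), (ε i : ℝ) := by
          refine Finset.sum_congr rfl fun i hi => ?_
          rw [Finset.mem_range] at hi
          simp only [stepSign, hmem i (by omega)]
          rcases hε i with h1 | h1 <;> simp [h1]
        have hm0 : ((m : ℝ) + 1) ≠ 0 := by positivity
        simp only [hmem (m + 1) (by omega)]
        have hE : erwProb p q (m + 1) e =
            (1 + (2 * p - 1) * (∑ i ∈ Finset.range (m + 1), (ε i : ℝ)) / ((m : ℝ) + 1)) / 2 := by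
          rw [erwProb, if_neg (by omega), hs]
          push_cast
          rfl
        rw [hE]
        rcases hε (m + 1) with h1 | h1
        · have : ∀ i, p * (if ε i = ε (m + 1) then (1 : ℝ) else 0) +
              (1 - p) * (if ε i = -ε (m + 1) then 1 else 0) =
              (2 * p - 1) / 2 * ε i + 1 / 2 := fun i => by
            rcases hε i with h2 | h2 <;> simp [h1, h2] <;> ring
          simp only [this, Finset.sum_add_distrib, ← Finset.mul_sum]
          simp [h1]
          field_simp
          ring
        · have : ∀ i, p * (if ε i = ε (m + 1) then (1 : ℝ) else 0) +
              (1 - p) * (if ε i = -ε (m + 1) then 1 else 0) =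
              -((2 * p - 1) / 2) * ε i + 1 / 2 := fun i => by
            rcases hε i with h2 | h2 <;> simp [h1, h2] <;> ring
          simp only [this, Finset.sum_add_distrib, ← Finset.mul_sum]
          simp [h1]
          field_simp
          ring
    · intro g g' hg
      have : AgreeBelow (n + 1) g e ↔ AgreeBelow (n + 1) g' e :=
        forall₂_congr fun m hm => by rw [hg m hm]
      simp only [this]

/-- Starting time of block `k`. -/
def blockTime (k : ℕ) : ℕ := (k + 1) ^ 10 - 1

lemma blockTime_add_one (k : ℕ) : blockTime k + 1 = (k + 1) ^ 10 :=
  Nat.sub_add_cancel (Nat.one_le_pow _ _ (Nat.succ_pos k))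

lemma blockTime_zero : blockTime 0 = 0 := by simp [blockTime]

lemma strictMono_blockTime : StrictMono blockTime := fun a b hab => by
  have h1 := blockTime_add_one a
  have h2 := blockTime_add_one b
  have h3 : (a + 1) ^ 10 < (b + 1) ^ 10 := Nat.pow_lt_pow_left (by omega) (by norm_num)
  omega

lemma le_of_blockTime_le {k i : ℕ} (h : blockTime k ≤ i) : ((k : ℝ) + 1) ^ 10 ≤ (i : ℝ) + 1 := by
  have h1 := blockTime_add_one k
  have h2 : (k + 1) ^ 10 ≤ i + 1 := by omega
  exact_mod_cast h2

lemma le_of_le_blockTime_succ {k i : ℕ} (h : i < blockTime (k + 1)) :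
    (i : ℝ) + 1 ≤ 1024 * ((k : ℝ) + 1) ^ 10 := by
  have h1 := blockTime_add_one (k + 1)
  have h2 : i + 1 ≤ (2 * (k + 1)) ^ 10 := by
    have : (k + 1 + 1) ^ 10 ≤ (2 * (k + 1)) ^ 10 := Nat.pow_le_pow_left (by omega) _
    omega
  have h3 : (i : ℝ) + 1 ≤ (2 * ((k : ℝ) + 1)) ^ 10 := by exact_mod_cast h2
  rw [mul_pow] at h3
  norm_num at h3
  exact h3

lemma blockTime_card (k : ℕ) :
    ((blockTime (k + 1) - blockTime k : ℕ) : ℝ) ≤ 1023 * ((k : ℝ) + 1) ^ 9 := by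
  have h1 := blockTime_add_one (k + 1)
  have h2 := blockTime_add_one k
  have h3 : (k + 1 + 1) ^ 10 ≤ (k + 1) ^ 10 + 1023 * (k + 1) ^ 9 := by
    have hp : ∀ j ≤ 9, (k + 1) ^ j ≤ (k + 1) ^ 9 := fun j hj => Nat.pow_le_pow_right (by omega) hj
    generalize k + 1 = m at hp
    have := hp 0 (by norm_num); have := hp 1 (by norm_num); have := hp 2 (by norm_num)
    have := hp 3 (by norm_num); have := hp 4 (by norm_num); have := hp 5 (by norm_num)
    have := hp 6 (by norm_num); have := hp 7 (by norm_num); have := hp 8 (by norm_num)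
    calc (m + 1) ^ 10 = m ^ 10 + 10 * m ^ 9 + 45 * m ^ 8 + 120 * m ^ 7 + 210 * m ^ 6 +
        252 * m ^ 5 + 210 * m ^ 4 + 120 * m ^ 3 + 45 * m ^ 2 + 10 * m ^ 1 + m ^ 0 := by ring
      _ ≤ _ := by omega
  have h4 : blockTime (k + 1) - blockTime k ≤ 1023 * (k + 1) ^ 9 := by omega
  exact_mod_cast h4

/-- The normalization turning the elephant random walk into a martingale, up to lower order. -/
def erwWeight (p : ℝ) (i : ℕ) : ℝ := ((i : ℝ) + 1) ^ (-(2 * p - 1))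

/-- The size of `erwWeight` throughout block `k`. -/
def blockWeight (p : ℝ) (k : ℕ) : ℝ := (((k : ℝ) + 1) ^ 10) ^ (-(2 * p - 1))

lemma erwWeight_pos (p : ℝ) (i : ℕ) : 0 < erwWeight p i := Real.rpow_pos_of_pos (by positivity) _

lemma blockWeight_pos (p : ℝ) (k : ℕ) : 0 < blockWeight p k :=
  Real.rpow_pos_of_pos (by positivity) _

lemma rpow_le_mul_rpow {x y b K : ℝ} (hy : 0 < y) (hyx : y ≤ x) (hxy : x ≤ K * y) (hb : |b| ≤ 1) :
    x ^ b ≤ K * y ^ b := by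
  have hK : 1 ≤ K := by
    by_contra h
    nlinarith
  rcases le_total 0 b with h0 | h0
  · calc x ^ b ≤ (K * y) ^ b := Real.rpow_le_rpow (hy.le.trans hyx) hxy h0
      _ = K ^ b * y ^ b := Real.mul_rpow (by linarith) hy.le
      _ ≤ K ^ (1 : ℝ) * y ^ b := by
        gcongr
        exact (le_abs_self b).trans hb
      _ = K * y ^ b := by rw [Real.rpow_one]
  · calc x ^ b ≤ y ^ b := Real.rpow_le_rpow_of_nonpos hy hyx h0
      _ ≤ K * y ^ b := le_mul_of_one_le_left (Real.rpow_nonneg hy.le _) hK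

lemma erwWeight_le {p : ℝ} (hp0 : 0 ≤ p) (hp1 : p ≤ 1) {k i : ℕ} (h1 : blockTime k ≤ i)
    (h2 : i < blockTime (k + 1)) : erwWeight p i ≤ 1024 * blockWeight p k :=
  rpow_le_mul_rpow (by positivity) (le_of_blockTime_le h1) (le_of_le_blockTime_succ h2)
    (abs_le.2 ⟨by linarith, by linarith⟩)

/-- The squared conditional drift of the elephant random walk is small on average. -/
lemma pathAvg_drift_sq_le {p q : ℝ} (hp0 : 0 ≤ p) (hp1 : p ≤ 3 / 4) (hq0 : 0 ≤ q) (hq1 : q ≤ 1)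
    {i n : ℕ} (hi : i ≤ n) :
    pathAvg (erwProb p q) n 0 (fun g => (2 * erwProb p q i g - 1) ^ 2) ∅ ≤ 4 / √((i : ℝ) + 1) := by
  have hu := isTransition_erwProb hp0 (by linarith : p ≤ 1) hq0 hq1
  rw [pathAvg_of_agreeBelow hu hi ∅ fun g g' hg => by rw [hu.adapted i g g' hg]]
  rcases Nat.eq_zero_or_pos i with rfl | hi0
  · simp only [pathAvg, erwProb]
    norm_num
    nlinarith
  · have hi' : (0 : ℝ) < i := by exact_mod_cast hi0
    have hi1 : (1 : ℝ) ≤ i := by exact_mod_cast hi0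
    calc _ ≤ pathAvg (erwProb p q) i 0 (fun g => ((i : ℝ) ^ 2)⁻¹ * walkSum i g ^ 2) ∅ := by
          refine pathAvg_mono hu _ _ _ fun g _ _ => ?_
          have : 2 * erwProb p q i g - 1 = (2 * p - 1) * walkSum i g / i := by
            rw [erwProb, if_neg hi0.ne']; ring
          rw [this, div_pow, mul_pow, div_eq_inv_mul]
          gcongr
          have : (2 * p - 1) ^ 2 ≤ 1 := by nlinarith
          exact mul_le_of_le_one_left (sq_nonneg _) this
      _ ≤ ((i : ℝ) ^ 2)⁻¹ * (2 * (i * √i)) := by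
          rw [pathAvg_const_mul]
          gcongr
          exact pathAvg_walkSum_sq_le hp0 hp1 hq0 hq1 i
      _ = 2 / √i := by
          have : √(i : ℝ) ≠ 0 := (Real.sqrt_pos.2 hi').ne'
          have h2 : √(i : ℝ) * √i = i := Real.mul_self_sqrt hi'.le
          field_simp
          nlinarith
      _ ≤ 4 / √((i : ℝ) + 1) := by
          have h1 : √((i : ℝ) + 1) ≤ 2 * √i := by
            rw [Real.sqrt_le_iff]
            refine ⟨by positivity, ?_⟩
            rw [mul_pow, Real.sq_sqrt hi'.le]
            linarith
          have : 0 < √(i : ℝ) := Real.sqrt_pos.2 hi'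
          rw [div_le_div_iff₀ this (by positivity)]
          linarith

/-- Arithmetic of the coupling error of a single step. -/
lemma block_error_le {m ρ c R C K T δ : ℝ} (hm1 : 1 ≤ m) (hρ : 0 < ρ) (hc0 : 0 ≤ c)
    (hc : c ≤ 1024 * ρ) (hC : 0 ≤ C) (hK : 0 ≤ K) (hT : 0 ≤ T) (hR : R ≤ 4 / m ^ 5)
    (hδ : δ = m ^ 3 * ρ) :
    1 / δ * c ^ 2 * R + (1 / δ * (C * c ^ 2 / m ^ 5) + 4 / δ ^ 2 * (8 * c ^ 3 + T * (K * c) ^ 3)) ≤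
      ρ * (1024 ^ 2 * (4 + C) + 4 * (8 + T * K ^ 3) * 1024 ^ 3) / m ^ 6 := by
  have hm0 : 0 < m := by linarith
  have hδ0 : 0 < δ := by rw [hδ]; positivity
  calc _ ≤ 1 / δ * c ^ 2 * (4 / m ^ 5) +
        (1 / δ * (C * c ^ 2 / m ^ 5) + 4 / δ ^ 2 * (8 * c ^ 3 + T * (K * c) ^ 3)) := by
        gcongr
    _ ≤ 1 / δ * (1024 * ρ) ^ 2 * (4 / m ^ 5) + (1 / δ * (C * (1024 * ρ) ^ 2 / m ^ 5) +
        4 / δ ^ 2 * (8 * (1024 * ρ) ^ 3 + T * (K * (1024 * ρ)) ^ 3)) := by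
        gcongr
    _ = ρ * (1024 ^ 2 * (4 + C)) / m ^ 8 + ρ * (4 * (8 + T * K ^ 3) * 1024 ^ 3) / m ^ 6 := by
        rw [hδ]
        field_simp
        ring
    _ ≤ ρ * (1024 ^ 2 * (4 + C)) / m ^ 6 + ρ * (4 * (8 + T * K ^ 3) * 1024 ^ 3) / m ^ 6 := by
        gcongr
        norm_num
    _ = _ := by ring

/-- Expected coupling error of a block. -/
lemma exists_pathAvg_lindebergError_le {p q C : ℝ} (hp0 : 0 ≤ p) (hp1 : p ≤ 3 / 4) (hq0 : 0 ≤ q)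
    (hq1 : q ≤ 1) {s : ℕ → NNReal} (hC : 0 ≤ C)
    (hs : ∀ i, |(s i : ℝ) - erwWeight p i ^ 2| ≤ C * erwWeight p i ^ 2 / (i + 1)) :
    ∃ A, ∀ k : ℕ, ∀ δ, δ = ((k : ℝ) + 1) ^ 3 * blockWeight p k →
      4 * δ + pathAvg (erwProb p q) (blockTime (k + 1)) 0
        (fun g => ∑ i ∈ Finset.Ico (blockTime k) (blockTime (k + 1)),
          lindebergError (erwProb p q) (erwWeight p) s (2 / δ) (4 / δ ^ 2) i g) ∅ ≤
        A * (((k : ℝ) + 1) ^ 3 * blockWeight p k) := by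
  have hu := isTransition_erwProb hp0 (by linarith : p ≤ 1) hq0 hq1
  set K := √(1 + C) with hK
  have hK0 : 0 ≤ K := Real.sqrt_nonneg _
  have hg0 := gaussianThird_nonneg
  refine ⟨4 + 1023 * (1024 ^ 2 * (4 + C) + 4 * (8 + gaussianThird * K ^ 3) * 1024 ^ 3),
    fun k δ hδ => ?_⟩
  set m : ℝ := (k : ℝ) + 1 with hm
  have hm1 : 1 ≤ m := by simp [hm]
  have hm0 : 0 < m := by linarith
  set ρ := blockWeight p k
  have hρ : 0 < ρ := blockWeight_pos p k
  have hδ0 : 0 < δ := by rw [hδ]; positivity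
  set E := ρ * (1024 ^ 2 * (4 + C) + 4 * (8 + gaussianThird * K ^ 3) * 1024 ^ 3) / m ^ 6 with hE
  have hE0 : 0 ≤ E := by positivity
  have key : ∀ i ∈ Finset.Ico (blockTime k) (blockTime (k + 1)),
      pathAvg (erwProb p q) (blockTime (k + 1)) 0
        (fun g => lindebergError (erwProb p q) (erwWeight p) s (2 / δ) (4 / δ ^ 2) i g) ∅ ≤ E := by
    intro i hi
    obtain ⟨hi1, hi2⟩ := Finset.mem_Ico.1 hi
    have hc0 := erwWeight_pos p i
    have hc := erwWeight_le hp0 (by linarith) hi1 hi2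
    set c := erwWeight p i
    have hx := le_of_blockTime_le hi1
    rw [← hm] at hx
    have hx5 : m ^ 5 ≤ √((i : ℝ) + 1) := by
      apply Real.le_sqrt_of_sq_le
      rw [← pow_mul]
      exact hx
    have hx5' : m ^ 5 ≤ (i : ℝ) + 1 := (pow_le_pow_right₀ hm1 (by norm_num)).trans hx
    have hs1 : |(s i : ℝ) - c ^ 2| ≤ C * c ^ 2 / m ^ 5 := (hs i).trans (by gcongr)
    have hs2 : √(s i : ℝ) ≤ K * c := by
      rw [Real.sqrt_le_iff]
      refine ⟨by positivity, ?_⟩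
      rw [mul_pow, hK, Real.sq_sqrt (by positivity)]
      have h1 := (abs_le.1 (hs i)).2
      have h2 : C * c ^ 2 / ((i : ℝ) + 1) ≤ C * c ^ 2 :=
        div_le_self (by positivity) (by simp)
      linarith
    have hpt : ∀ g, lindebergError (erwProb p q) (erwWeight p) s (2 / δ) (4 / δ ^ 2) i g ≤
        (1 / δ * c ^ 2) * (2 * erwProb p q i g - 1) ^ 2 + (1 / δ * (C * c ^ 2 / m ^ 5) +
          4 / δ ^ 2 * (8 * c ^ 3 + gaussianThird * (K * c) ^ 3)) := fun g => by
      unfold lindebergError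
      have h1 : |c ^ 2 * (1 - (2 * erwProb p q i g - 1) ^ 2) - s i| ≤
          c ^ 2 * (2 * erwProb p q i g - 1) ^ 2 + C * c ^ 2 / m ^ 5 := by
        have h0 : 0 ≤ c ^ 2 * (2 * erwProb p q i g - 1) ^ 2 := by positivity
        have := abs_le.1 hs1
        rw [abs_le]
        constructor <;> linarith
      have h2 : |c| = c := abs_of_pos hc0
      calc 2 / δ / 2 * |c ^ 2 * (1 - (2 * erwProb p q i g - 1) ^ 2) - s i| +
          4 / δ ^ 2 * (8 * |c| ^ 3 + gaussianThird * √(s i : ℝ) ^ 3)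
          ≤ 2 / δ / 2 * (c ^ 2 * (2 * erwProb p q i g - 1) ^ 2 + C * c ^ 2 / m ^ 5) +
          4 / δ ^ 2 * (8 * c ^ 3 + gaussianThird * (K * c) ^ 3) := by
            rw [h2]; gcongr
        _ = _ := by ring
    refine (pathAvg_mono hu _ _ _ fun g _ _ => hpt g).trans ?_
    rw [pathAvg_add, pathAvg_const_mul, pathAvg_const]
    have hd := pathAvg_drift_sq_le hp0 hp1 hq0 hq1 hi2.le
    have hd' : 4 / √((i : ℝ) + 1) ≤ 4 / m ^ 5 := by gcongr
    exact block_error_le hm1 hρ hc0.le hc hC hK0 hg0 (hd.trans hd') hδ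
  rw [pathAvg_sum]
  have h1 := Finset.sum_le_card_nsmul _ _ _ key
  rw [Nat.card_Ico, nsmul_eq_mul] at h1
  have h2 := mul_le_mul_of_nonneg_right (blockTime_card k) hE0
  rw [← hm] at h2
  calc _ ≤ 4 * δ + 1023 * m ^ 9 * E := by linarith
    _ = _ := by rw [hδ, hE]; field_simp

/-- Variance of the Gaussian increment attached to step `i`. -/
def incrVar (κ : ℝ) (τ : ℕ → ℝ) (i : ℕ) : NNReal := Real.toNNReal (κ ^ 2 * (τ (i + 1) - τ i))

lemma coe_incrVar {κ : ℝ} {τ : ℕ → ℝ} (hτ : Monotone τ) (i : ℕ) :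
    (incrVar κ τ i : ℝ) = κ ^ 2 * (τ (i + 1) - τ i) :=
  Real.coe_toNNReal _ (mul_nonneg (sq_nonneg _) (sub_nonneg.2 (hτ (Nat.le_succ i))))

lemma sum_incrVar {κ : ℝ} {τ : ℕ → ℝ} (hτ : Monotone τ) {a b : ℕ} (hab : a ≤ b) :
    ∑ i ∈ Finset.Ico a b, incrVar κ τ i = Real.toNNReal (κ ^ 2 * (τ b - τ a)) := by
  apply NNReal.eq
  rw [Real.coe_toNNReal _ (mul_nonneg (sq_nonneg _) (sub_nonneg.2 (hτ hab)))]
  push_cast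
  simp only [coe_incrVar hτ]
  induction b, hab using Nat.le_induction with
  | base => simp
  | succ n hn ih => rw [Finset.sum_Ico_succ_top hn, ih]; ring

/-- An elephant random walk built on the Brownian motion, with all the block estimates. -/
theorem exists_erw_histories {p q : ℝ} (hp0 : 0 ≤ p) (hp1 : p ≤ 1) (hq0 : 0 ≤ q) (hq1 : q ≤ 1)
    {κ : ℝ} {τ : ℕ → ℝ} (hτ : Monotone τ) (hτ0 : 0 ≤ τ 0)
    (hpos : ∀ i, 1 ≤ i → 0 < κ ^ 2 * (τ (i + 1) - τ i)) :
    ∃ H : ℕ → (ℕ × ℕ → ℝ) → Finset ℕ,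
      IsERW gaussianNoise p q (fun i ω => if i ∈ H (i + 1) ω then 1 else -1) ∧
      (∀ j k, j ≤ k → ∀ ω, AgreeBelow (blockTime j) (H k ω) (H j ω)) ∧
      (∀ k Φ, Integrable (fun ω => Φ (H k ω)) gaussianNoise ∧
        ∫ ω, Φ (H k ω) ∂gaussianNoise = pathAvg (erwProb p q) (blockTime k) 0 Φ ∅) ∧
      ∀ k, Integrable (fun ω => |blockSum (erwProb p q) (erwWeight p) (blockTime k)
            (blockTime (k + 1) - blockTime k) (H (k + 1) ω) -
            κ * (brownian (τ (blockTime (k + 1))) ω - brownian (τ (blockTime k)) ω)|)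
          gaussianNoise ∧
        ∀ δ > 0, ∫ ω, |blockSum (erwProb p q) (erwWeight p) (blockTime k)
            (blockTime (k + 1) - blockTime k) (H (k + 1) ω) -
            κ * (brownian (τ (blockTime (k + 1))) ω - brownian (τ (blockTime k)) ω)|
              ∂gaussianNoise ≤
          4 * δ + pathAvg (erwProb p q) (blockTime (k + 1)) 0
            (fun g => ∑ i ∈ Finset.Ico (blockTime k) (blockTime (k + 1)),
              lindebergError (erwProb p q) (erwWeight p) (incrVar κ τ) (2 / δ) (4 / δ ^ 2) i g)
            ∅ := by
  have hu := isTransition_erwProb hp0 hp1 hq0 hq1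
  have hN := strictMono_blockTime
  have ht0 : ∀ n, 0 ≤ τ n := fun n => hτ0.trans (hτ (Nat.zero_le n))
  have hle : ∀ k, blockTime k ≤ blockTime (k + 1) := fun k => hN.monotone (Nat.le_succ k)
  obtain ⟨H, hHm, -, hagree, hlaw, hgap⟩ := exists_block_coupling (P := gaussianNoise) hu
    (erwWeight p) (incrVar κ τ) hN blockTime_zero
    (G := fun k ω => κ * (brownian (τ (blockTime (k + 1))) ω - brownian (τ (blockTime k)) ω))
    (fun k => ((measurable_brownian _).sub (measurable_brownian _)).const_mul κ)
    ((iIndepFun_brownian_sub (fun k => τ (blockTime k)) (hτ.comp hN.monotone)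
      fun k => ht0 _).comp (fun _ x => κ * x) fun _ => measurable_const_mul κ)
    (fun k => by rw [sum_incrVar hτ (hle k), map_brownian_sub (ht0 _) (hτ (hle k))])
    (fun k => by
      obtain ⟨i, hi, hi1⟩ : ∃ i ∈ Finset.Ico (blockTime k) (blockTime (k + 1)), 1 ≤ i := by
        refine ⟨blockTime (k + 1) - 1, Finset.mem_Ico.2 ?_, ?_⟩
        · have := hN (Nat.lt_succ_self k)
          simp only [Nat.succ_eq_add_one] at this
          omega
        · have h1 := blockTime_add_one (k + 1)
          have h2 : 2 ^ 10 ≤ (k + 1 + 1) ^ 10 := Nat.pow_le_pow_left (by omega) _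
          omega
      refine (lt_of_lt_of_le ?_ (Finset.single_le_sum (fun _ _ => zero_le) hi)).ne'
      exact Real.toNNReal_pos.2 (hpos i hi1))
  have hcons : ∀ j k, j ≤ k → ∀ ω, AgreeBelow (blockTime j) (H k ω) (H j ω) := by
    intro j k hjk ω
    induction k, hjk using Nat.le_induction with
    | base => exact fun _ _ => Iff.rfl
    | succ k hk ih =>
      exact fun m hm => ((hagree k ω).mono (hN.monotone hk) m hm).trans (ih m hm)
  refine ⟨H, isERW_of_histories hp0 hp1 hq0 hq1 hHm (fun n m hnm ω =>
    (hcons n m hnm ω).mono hN.le_apply) (fun n Φ hΦ => ?_), hcons, hlaw, hgap⟩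
  rw [(hlaw n Φ).2, pathAvg_of_agreeBelow hu hN.le_apply ∅ hΦ]

/-- The order of magnitude of the normalized walk throughout block `k`, up to constants. -/
def blockScale (p : ℝ) (k : ℕ) : ℝ := ((k : ℝ) + 1) ^ 5 * blockWeight p k

lemma blockScale_pos (p : ℝ) (k : ℕ) : 0 < blockScale p k :=
  mul_pos (by positivity) (blockWeight_pos p k)

lemma blockScale_eq (p : ℝ) (k : ℕ) :
    blockScale p k = (((k : ℝ) + 1) ^ 10) ^ (1 / 2 - (2 * p - 1)) := by
  have h : (0 : ℝ) < ((k : ℝ) + 1) ^ 10 := by positivity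
  rw [blockScale, blockWeight, sub_eq_add_neg (1 / 2 : ℝ), Real.rpow_add h, ← Real.sqrt_eq_rpow,
    show ((k : ℝ) + 1) ^ 10 = (((k : ℝ) + 1) ^ 5) ^ 2 by ring, Real.sqrt_sq (by positivity)]

lemma blockScale_le {p : ℝ} (hp : p ≤ 3 / 4) {k n : ℕ} (h : blockTime k ≤ n) :
    blockScale p k ≤ ((n : ℝ) + 1) ^ (1 / 2 - (2 * p - 1)) := by
  rw [blockScale_eq]
  exact Real.rpow_le_rpow (by positivity) (le_of_blockTime_le h) (by linarith)

lemma monotone_blockScale {p : ℝ} (hp : p ≤ 3 / 4) : Monotone (blockScale p) := fun a b hab => by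
  rw [blockScale_eq, blockScale_eq]
  have : (a : ℝ) ≤ b := by exact_mod_cast hab
  exact Real.rpow_le_rpow (by positivity) (by gcongr) (by linarith)

lemma summable_one_div_succ_sq (A : ℝ) : Summable fun k : ℕ => A / ((k : ℝ) + 1) ^ 2 := by
  have h := (summable_nat_add_iff 1).2 (Real.summable_one_div_nat_pow.2 (by norm_num : 1 < 2))
  simpa [div_eq_mul_inv] using h.mul_left A

/-- Almost sure control of within-block fluctuations from their high moments. -/
lemma ae_block_bound {Ω : Type*} [MeasurableSpace Ω] {P : Measure Ω} (p : ℝ)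
    {Y : ℕ → ℕ → Ω → ℝ} {A : ℝ} (hA : 0 ≤ A)
    (hfi : ∀ k n, blockTime k ≤ n → n < blockTime (k + 1) →
      Integrable (fun ω => Y k n ω ^ 22) P ∧
        ∫ ω, Y k n ω ^ 22 ∂P ≤ A * (((k : ℝ) + 1) ^ 9 * blockWeight p k ^ 2) ^ 11) :
    ∀ᵐ ω ∂P, ∃ K, ∀ k n, blockTime k ≤ n → n < blockTime (k + 1) →
      |Y k n ω| ≤ K * blockScale p k := by
  have hf : ∀ k, Integrable (fun ω => ∑ n ∈ Finset.Ico (blockTime k) (blockTime (k + 1)),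
      (blockScale p k ^ 22)⁻¹ * Y k n ω ^ 22) P := fun k =>
    integrable_finsetSum _ fun n hn =>
      (hfi k n (Finset.mem_Ico.1 hn).1 (Finset.mem_Ico.1 hn).2).1.const_mul _
  have hnn : ∀ k n ω, 0 ≤ (blockScale p k ^ 22)⁻¹ * Y k n ω ^ 22 := fun k n ω =>
    mul_nonneg (inv_nonneg.2 (pow_nonneg (blockScale_pos p k).le _))
      (Even.pow_nonneg (by decide) _)
  have hle : ∀ k, ∫ ω, ∑ n ∈ Finset.Ico (blockTime k) (blockTime (k + 1)),
      (blockScale p k ^ 22)⁻¹ * Y k n ω ^ 22 ∂P ≤ 1023 * A / ((k : ℝ) + 1) ^ 2 := fun k => by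
    have hb : ∀ n ∈ Finset.Ico (blockTime k) (blockTime (k + 1)),
        ∫ ω, (blockScale p k ^ 22)⁻¹ * Y k n ω ^ 22 ∂P ≤ A / ((k : ℝ) + 1) ^ 11 := fun n hn => by
      rw [integral_const_mul]
      have h1 := (hfi k n (Finset.mem_Ico.1 hn).1 (Finset.mem_Ico.1 hn).2).2
      have h2 := blockWeight_pos p k
      have h3 := blockScale_pos p k
      calc _ ≤ (blockScale p k ^ 22)⁻¹ *
            (A * (((k : ℝ) + 1) ^ 9 * blockWeight p k ^ 2) ^ 11) := by gcongr
        _ = _ := by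
          unfold blockScale
          field_simp
    rw [integral_finsetSum _ fun n hn =>
      (hfi k n (Finset.mem_Ico.1 hn).1 (Finset.mem_Ico.1 hn).2).1.const_mul _]
    have h1 := Finset.sum_le_card_nsmul _ _ _ hb
    rw [Nat.card_Ico, nsmul_eq_mul] at h1
    calc _ ≤ _ := h1
      _ ≤ 1023 * ((k : ℝ) + 1) ^ 9 * (A / ((k : ℝ) + 1) ^ 11) := by
        gcongr
        exact blockTime_card k
      _ = _ := by field_simp
  have hs := ae_summable_of_summable_integral (P := P) _
    (fun k ω => Finset.sum_nonneg fun n _ => hnn k n ω) hf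
    ((summable_one_div_succ_sq (1023 * A)).of_nonneg_of_le
      (fun k => integral_nonneg fun ω => Finset.sum_nonneg fun n _ => hnn k n ω) hle)
  filter_upwards [hs] with ω hω
  set T := ∑' k, ∑ n ∈ Finset.Ico (blockTime k) (blockTime (k + 1)),
      (blockScale p k ^ 22)⁻¹ * Y k n ω ^ 22
  have hT0 : 0 ≤ T := tsum_nonneg fun k => Finset.sum_nonneg fun n _ => hnn k n ω
  refine ⟨1 + T, fun k n h1 h2 => ?_⟩
  have h3 := blockScale_pos p k
  have h4 : (blockScale p k ^ 22)⁻¹ * Y k n ω ^ 22 ≤ T :=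
    (Finset.single_le_sum (f := fun n => (blockScale p k ^ 22)⁻¹ * Y k n ω ^ 22)
      (fun n _ => hnn k n ω) (Finset.mem_Ico.2 ⟨h1, h2⟩)).trans
      (hω.le_tsum k fun j _ => Finset.sum_nonneg fun n _ => hnn j n ω)
  have h5 : (|Y k n ω| / blockScale p k) ^ 22 ≤ T := by
    rw [div_pow, Even.pow_abs (by decide), div_eq_inv_mul]
    exact h4
  rw [← div_le_iff₀ h3]
  set z := |Y k n ω| / blockScale p k
  by_cases hz : z ≤ 1
  · linarith
  · have := le_self_pow₀ (not_le.1 hz).le (n := 22) (by norm_num)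
    linarith

lemma integral_pow_gaussian_law {Ω : Type*} [MeasurableSpace Ω] {P : Measure Ω} {Y : Ω → ℝ}
    (hY : Measurable Y) {v : NNReal} (h : P.map Y = gaussianReal 0 v) :
    Integrable (fun ω => Y ω ^ 22) P ∧
      ∫ ω, Y ω ^ 22 ∂P = (v : ℝ) ^ 11 * ∫ y, |y| ^ 22 ∂(gaussianReal 0 1) := by
  have e : (fun ω => Y ω ^ 22) = fun ω => |Y ω| ^ 22 :=
    funext fun ω => (Even.pow_abs (by decide) (Y ω)).symm
  have hi := integrable_abs_pow_gaussianReal v 22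
  have hm : AEStronglyMeasurable (fun y : ℝ => |y| ^ 22) (P.map Y) := by
    rw [h]; exact hi.aestronglyMeasurable
  rw [e]
  refine ⟨?_, ?_⟩
  · rw [← h] at hi
    exact hi.comp_measurable hY
  · rw [← integral_map (f := fun y : ℝ => |y| ^ 22) hY.aemeasurable hm, h,
      integral_abs_pow_gaussianReal,
      show √(v : ℝ) ^ 22 = (√(v : ℝ) ^ 2) ^ 11 by rw [← pow_mul], Real.sq_sqrt v.coe_nonneg]

lemma abs_one_add_rpow_sub_le {a x : ℝ} (ha : |a| ≤ 1) (hx : 0 ≤ x) :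
    |(1 + x) ^ a - 1 - a * x| ≤ x ^ 2 := by
  have hx1 : 0 < 1 + x := by linarith
  obtain ⟨ha1, ha2⟩ := abs_le.1 ha
  rcases le_total 0 a with h0 | h0
  · have h1 : (1 + x) ^ a ≤ 1 + a * x :=
      rpow_one_add_le_one_add_mul_self (by linarith) h0 ha2
    have h2 : (1 + x) ^ (1 - a) ≤ 1 + (1 - a) * x :=
      rpow_one_add_le_one_add_mul_self (by linarith) (by linarith) (by linarith)
    have h3 : (1 + x) ^ a * (1 + x) ^ (1 - a) = 1 + x := by
      rw [← Real.rpow_add hx1]; simp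
    have h4 : 0 ≤ (1 + x) ^ a := Real.rpow_nonneg hx1.le _
    have h6 : 0 < 1 + (1 - a) * x := by nlinarith
    have h5 : 1 + x ≤ (1 + x) ^ a * (1 + (1 - a) * x) := by
      calc 1 + x = (1 + x) ^ a * (1 + x) ^ (1 - a) := h3.symm
        _ ≤ _ := by gcongr
    have h7 : 1 + a * x - x ^ 2 ≤ (1 + x) ^ a := by
      refine le_of_mul_le_mul_right (le_trans ?_ h5) h6
      have : 0 ≤ (1 - a) * x ^ 3 := mul_nonneg (by linarith) (by positivity)
      have : 0 ≤ (1 - a * (1 - a)) * x ^ 2 := mul_nonneg (by nlinarith) (by positivity)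
      nlinarith
    rw [abs_le]
    constructor <;> linarith [sq_nonneg x]
  · have h1 : (1 + x) ^ (a + 1) ≤ 1 + (a + 1) * x :=
      rpow_one_add_le_one_add_mul_self (by linarith) (by linarith) (by linarith)
    rw [Real.rpow_add hx1, Real.rpow_one] at h1
    have h2 : (1 + x) ^ (-a) ≤ 1 + (-a) * x :=
      rpow_one_add_le_one_add_mul_self (by linarith) (by linarith) (by linarith)
    have h3 : (1 + x) ^ a * (1 + x) ^ (-a) = 1 := by
      rw [← Real.rpow_add hx1]; simp
    have h4 : 0 ≤ (1 + x) ^ a := Real.rpow_nonneg hx1.le _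
    have h5 : 1 ≤ (1 + x) ^ a * (1 + (-a) * x) := by
      calc 1 = (1 + x) ^ a * (1 + x) ^ (-a) := h3.symm
        _ ≤ _ := by gcongr
    have h6 : 0 < 1 + (-a) * x := by nlinarith
    have h7 : 1 + a * x ≤ (1 + x) ^ a := by
      refine le_of_mul_le_mul_right (le_trans ?_ h5) h6
      nlinarith [sq_nonneg (a * x)]
    have h8 : (1 + x) ^ a ≤ 1 + a * x + x ^ 2 := by
      refine le_of_mul_le_mul_right (h1.trans ?_) hx1
      have : 0 ≤ (1 + a) * x ^ 2 := mul_nonneg (by linarith) (by positivity)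
      have : 0 ≤ x ^ 3 := by positivity
      nlinarith
    rw [abs_le]
    constructor <;> linarith [sq_nonneg x]

lemma exists_one_add_rpow_bound_succ {a : ℝ}
    (h : ∃ C, 0 ≤ C ∧ ∀ x : ℝ, 0 ≤ x → x ≤ 1 → |(1 + x) ^ a - 1 - a * x| ≤ C * x ^ 2) :
    ∃ C, 0 ≤ C ∧ ∀ x : ℝ, 0 ≤ x → x ≤ 1 → |(1 + x) ^ (a + 1) - 1 - (a + 1) * x| ≤ C * x ^ 2 := by
  obtain ⟨C, hC, hx⟩ := h
  refine ⟨2 * C + |a|, by positivity, fun x h0 h1 => ?_⟩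
  have e : (1 + x) ^ (a + 1) - 1 - (a + 1) * x =
      (1 + x) * ((1 + x) ^ a - 1 - a * x) + a * x ^ 2 := by
    rw [Real.rpow_add (by linarith), Real.rpow_one]; ring
  rw [e]
  calc _ ≤ |(1 + x) * ((1 + x) ^ a - 1 - a * x)| + |a * x ^ 2| := abs_add_le _ _
    _ = (1 + x) * |(1 + x) ^ a - 1 - a * x| + |a| * x ^ 2 := by
      rw [abs_mul, abs_mul, abs_of_nonneg (by linarith : 0 ≤ 1 + x), abs_of_nonneg (sq_nonneg x)]
    _ ≤ 2 * (C * x ^ 2) + |a| * x ^ 2 := by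
      gcongr
      · linarith
      · exact hx x h0 h1
    _ = _ := by ring

lemma exists_one_add_rpow_bound {a : ℝ} (h1 : -1 ≤ a) (h3 : a ≤ 3) :
    ∃ C, 0 ≤ C ∧ ∀ x : ℝ, 0 ≤ x → x ≤ 1 → |(1 + x) ^ a - 1 - a * x| ≤ C * x ^ 2 := by
  have base : ∀ b : ℝ, |b| ≤ 1 →
      ∃ C, 0 ≤ C ∧ ∀ x : ℝ, 0 ≤ x → x ≤ 1 → |(1 + x) ^ b - 1 - b * x| ≤ C * x ^ 2 := fun b hb =>
    ⟨1, zero_le_one, fun x h0 _ => by rw [one_mul]; exact abs_one_add_rpow_sub_le hb h0⟩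
  rcases le_total a 1 with h | h
  · exact base a (abs_le.2 ⟨h1, h⟩)
  · have := exists_one_add_rpow_bound_succ
      (exists_one_add_rpow_bound_succ (base (a - 2) (abs_le.2 ⟨by linarith, by linarith⟩)))
    rwa [show a - 2 + 1 + 1 = a by ring] at this

lemma rpow_le_mul_rpow' {x y b K : ℝ} (hy : 0 < y) (hyx : y ≤ x) (hxy : x ≤ K * y)
    (hb : |b| ≤ 1) : y ^ b ≤ K * x ^ b := by
  have hx : 0 < x := hy.trans_le hyx
  have h := rpow_le_mul_rpow hy hyx hxy (b := -b) (by rwa [abs_neg])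
  rw [Real.rpow_neg hx.le, Real.rpow_neg hy.le, ← div_eq_mul_inv,
    inv_le_comm₀ (Real.rpow_pos_of_pos hx _)
      (div_pos (by nlinarith) (Real.rpow_pos_of_pos hy _)), inv_div,
    div_le_iff₀ (by nlinarith)] at h
  linarith

/-- The drift coefficients of the normalized walk. -/
lemma abs_drift_le {a : ℝ} (ha : |a| ≤ 1) {j : ℕ} (hj : 1 ≤ j) :
    |(1 + a / j) * ((j : ℝ) + 1) ^ (-a) - (j : ℝ) ^ (-a)| ≤ 2 * (j : ℝ) ^ (-a) / j ^ 2 := by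
  have hj0 : (0 : ℝ) < j := by exact_mod_cast hj
  have hj1 : (1 : ℝ) ≤ j := by exact_mod_cast hj
  have e1 : ((j : ℝ) + 1) = j * (1 + 1 / j) := by field_simp
  have e2 : (j : ℝ) ^ (-a) = ((j : ℝ) + 1) ^ (-a) * (1 + 1 / j) ^ a := by
    rw [e1, Real.mul_rpow hj0.le (by positivity), mul_assoc, ← Real.rpow_add (by positivity)]
    simp
  have h1 := abs_one_add_rpow_sub_le ha (x := 1 / j) (by positivity)
  have h2 : ((j : ℝ) + 1) ^ (-a) ≤ 2 * (j : ℝ) ^ (-a) :=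
    rpow_le_mul_rpow hj0 (by linarith) (by linarith) (by rwa [abs_neg])
  have h3 : 0 ≤ ((j : ℝ) + 1) ^ (-a) := by positivity
  calc _ = |-(((j : ℝ) + 1) ^ (-a) * ((1 + 1 / (j : ℝ)) ^ a - 1 - a * (1 / j)))| := by
        congr 1
        rw [e2]; ring
    _ = ((j : ℝ) + 1) ^ (-a) * |(1 + 1 / (j : ℝ)) ^ a - 1 - a * (1 / j)| := by
        rw [abs_neg, abs_mul, abs_of_nonneg h3]
    _ ≤ 2 * (j : ℝ) ^ (-a) * (1 / j) ^ 2 := by gcongr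
    _ = _ := by rw [one_div, inv_pow]; rfl

/-- The accumulated drift of the normalized walk is of lower order. -/
lemma exists_drift_sum_le {p : ℝ} (hp0 : 0 ≤ p) (hp1 : p ≤ 3 / 4) : ∃ K, 0 ≤ K ∧ ∀ (n : ℕ)
    (h : Finset ℕ), |∑ j ∈ Finset.Ico 1 n, ((1 + (2 * p - 1) / j) *
      ((j : ℝ) + 1) ^ (-(2 * p - 1)) - (j : ℝ) ^ (-(2 * p - 1))) * walkSum j h| ≤
        K * (n : ℝ) ^ (1 / 2 - (2 * p - 1)) := by
  have hs : Summable fun j : ℕ => 2 * (1 / (j : ℝ) ^ (3 / 2 : ℝ)) :=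
    (Real.summable_one_div_nat_rpow.2 (by norm_num)).mul_left 2
  have hnn : ∀ j : ℕ, 0 ≤ 2 * (1 / (j : ℝ) ^ (3 / 2 : ℝ)) := fun j => by positivity
  refine ⟨∑' j : ℕ, 2 * (1 / (j : ℝ) ^ (3 / 2 : ℝ)), tsum_nonneg hnn, fun n h => ?_⟩
  refine (Finset.abs_sum_le_sum_abs _ _).trans ?_
  calc _ ≤ ∑ j ∈ Finset.Ico 1 n, 2 * (1 / (j : ℝ) ^ (3 / 2 : ℝ)) *
        (n : ℝ) ^ (1 / 2 - (2 * p - 1)) := by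
        refine Finset.sum_le_sum fun j hj => ?_
        obtain ⟨hj1, hjn⟩ := Finset.mem_Ico.1 hj
        have hj0 : (0 : ℝ) < j := by exact_mod_cast hj1
        have hle : (j : ℝ) ≤ n := by exact_mod_cast hjn.le
        have hd := abs_drift_le (a := 2 * p - 1) (abs_le.2 ⟨by linarith, by linarith⟩) hj1
        rw [abs_mul]
        calc _ ≤ 2 * (j : ℝ) ^ (-(2 * p - 1)) / j ^ 2 * j := by
              gcongr
              exact abs_walkSum_le j h
          _ = 2 * (1 / (j : ℝ) ^ (3 / 2 : ℝ)) * (j : ℝ) ^ (1 / 2 - (2 * p - 1)) := by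
              rw [one_div, ← Real.rpow_neg hj0.le, mul_assoc, ← Real.rpow_add hj0,
                show -(3 / 2) + (1 / 2 - (2 * p - 1)) = -(2 * p - 1) + (-1 : ℝ) by ring,
                Real.rpow_add hj0, Real.rpow_neg_one]
              field_simp
          _ ≤ _ := by
              gcongr
              linarith
    _ = (∑ j ∈ Finset.Ico 1 n, 2 * (1 / (j : ℝ) ^ (3 / 2 : ℝ))) *
        (n : ℝ) ^ (1 / 2 - (2 * p - 1)) := by rw [Finset.sum_mul]
    _ ≤ _ := by
        gcongr
        exact hs.sum_le_tsum _ fun j _ => hnn j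

/-- Increments of the clock `n ↦ n ^ (3 - 4 * p)`. -/
lemma exists_rpow_clock_bound {p : ℝ} (hp0 : 0 < p) (hp1 : p < 3 / 4) : ∃ C, 0 ≤ C ∧ ∀ i : ℕ,
    |(1 / √(3 - 4 * p)) ^ 2 * (((i + 1 : ℕ) : ℝ) ^ (3 - 4 * p) - (i : ℝ) ^ (3 - 4 * p)) -
      erwWeight p i ^ 2| ≤ C * erwWeight p i ^ 2 / (i + 1) := by
  set γ := 3 - 4 * p with hγ
  have hγ0 : 0 < γ := by linarith
  have hsq : (1 / √γ) ^ 2 = γ⁻¹ := by rw [div_pow, one_pow, Real.sq_sqrt hγ0.le, one_div]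
  obtain ⟨C1, hC1, h1⟩ := exists_one_add_rpow_bound (a := γ) (by linarith) (by linarith)
  obtain ⟨C2, hC2, h2⟩ := exists_one_add_rpow_bound (a := γ - 1) (by linarith) (by linarith)
  set D := γ⁻¹ * C1 + |γ - 1| + C2 with hD
  have hD0 : 0 ≤ D := by positivity
  refine ⟨|γ⁻¹ - 1| + 8 * D, by positivity, fun i => ?_⟩
  rw [hsq]
  have hE := erwWeight_pos p i
  rcases Nat.eq_zero_or_pos i with rfl | hi
  · have : erwWeight p 0 = 1 := by simp [erwWeight]
    rw [this]
    simp [Real.zero_rpow hγ0.ne']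
    positivity
  · have hi0 : (0 : ℝ) < i := by exact_mod_cast hi
    have hi1 : (1 : ℝ) ≤ i := by exact_mod_cast hi
    set x : ℝ := 1 / i with hx
    have hx0 : 0 ≤ x := by positivity
    have hx1 : x ≤ 1 := by rw [hx, div_le_one hi0]; exact hi1
    have e0 : ((i : ℝ) + 1) = i * (1 + x) := by rw [hx]; field_simp
    set y := (i : ℝ) ^ (γ - 1) with hy
    have hy0 : 0 < y := Real.rpow_pos_of_pos hi0 _
    have e1 : (i : ℝ) ^ γ = y * i := by
      rw [hy, ← Real.rpow_add_one hi0.ne', sub_add_cancel]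
    have e2 : ((i + 1 : ℕ) : ℝ) ^ γ = y * i * (1 + x) ^ γ := by
      push_cast
      rw [e0, Real.mul_rpow hi0.le (by linarith), e1]
    have e3 : erwWeight p i ^ 2 = y * (1 + x) ^ (γ - 1) := by
      rw [erwWeight, ← Real.rpow_natCast, ← Real.rpow_mul (by positivity), e0,
        Real.mul_rpow hi0.le (by linarith)]
      have : -(2 * p - 1) * ((2 : ℕ) : ℝ) = γ - 1 := by push_cast; rw [hγ]; ring
      rw [this]
    have hix : (i : ℝ) * x = 1 := by rw [hx]; field_simp
    have key : |γ⁻¹ * (((i + 1 : ℕ) : ℝ) ^ γ - (i : ℝ) ^ γ) - erwWeight p i ^ 2| ≤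
        y * x * D := by
      rw [e1, e2, e3]
      have e4 : γ⁻¹ * (y * i * (1 + x) ^ γ - y * i) - y * (1 + x) ^ (γ - 1) =
          y * (i * γ⁻¹ * ((1 + x) ^ γ - 1 - γ * x) -
            (((1 + x) ^ (γ - 1) - 1 - (γ - 1) * x) + (γ - 1) * x)) := by
        have : γ⁻¹ * γ = 1 := inv_mul_cancel₀ hγ0.ne'
        linear_combination y * (i * x) * this + y * hix
      rw [e4, abs_mul, abs_of_pos hy0, mul_assoc y x D]
      refine mul_le_mul_of_nonneg_left ?_ hy0.le
      have t1 : |i * γ⁻¹ * ((1 + x) ^ γ - 1 - γ * x)| ≤ γ⁻¹ * C1 * x := by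
        rw [abs_mul, abs_of_nonneg (by positivity)]
        calc _ ≤ i * γ⁻¹ * (C1 * x ^ 2) := by
              gcongr
              exact h1 x hx0 hx1
          _ = γ⁻¹ * C1 * x := by linear_combination γ⁻¹ * C1 * x * hix
      have t2 : |(1 + x) ^ (γ - 1) - 1 - (γ - 1) * x| ≤ C2 * x :=
        (h2 x hx0 hx1).trans (by gcongr; nlinarith)
      have t3 : |(γ - 1) * x| ≤ |γ - 1| * x := by rw [abs_mul, abs_of_nonneg hx0]
      calc _ ≤ |i * γ⁻¹ * ((1 + x) ^ γ - 1 - γ * x)| +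
            |((1 + x) ^ (γ - 1) - 1 - (γ - 1) * x) + (γ - 1) * x| := abs_sub _ _
        _ ≤ γ⁻¹ * C1 * x + (C2 * x + |γ - 1| * x) :=
            add_le_add t1 ((abs_add_le _ _).trans (add_le_add t2 t3))
        _ = x * D := by rw [hD]; ring
    refine key.trans ?_
    have t4 : (i : ℝ) ^ (-(2 * p - 1)) ≤ 2 * erwWeight p i :=
      rpow_le_mul_rpow' hi0 (by linarith) (by linarith) (abs_le.2 ⟨by linarith, by linarith⟩)
    have t5 : y ≤ 4 * erwWeight p i ^ 2 := by
      have : y = ((i : ℝ) ^ (-(2 * p - 1))) ^ 2 := by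
        rw [← Real.rpow_natCast, ← Real.rpow_mul hi0.le, hy, hγ]
        congr 1
        push_cast; ring
      rw [this]
      calc _ ≤ (2 * erwWeight p i) ^ 2 := by gcongr
        _ = _ := by ring
    have t6 : x ≤ 2 / ((i : ℝ) + 1) := by
      rw [hx, div_le_div_iff₀ hi0 (by positivity)]; linarith
    calc y * x * D ≤ (4 * erwWeight p i ^ 2) * (2 / ((i : ℝ) + 1)) * D := by gcongr
      _ = 8 * D * erwWeight p i ^ 2 / (i + 1) := by ring
      _ ≤ _ := by
        gcongr
        linarith [abs_nonneg (γ⁻¹ - 1)]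

/-- Increments of the clock `n ↦ log n`. -/
lemma log_clock_bound (i : ℕ) : |(1 : ℝ) ^ 2 * (Real.log ((i + 1 : ℕ) : ℝ) - Real.log (i : ℝ)) -
      erwWeight (3 / 4) i ^ 2| ≤ 2 * erwWeight (3 / 4) i ^ 2 / (i + 1) := by
  have e : erwWeight (3 / 4) i ^ 2 = 1 / ((i : ℝ) + 1) := by
    rw [erwWeight, ← Real.rpow_natCast, ← Real.rpow_mul (by positivity),
      show -(2 * (3 / 4 : ℝ) - 1) * ((2 : ℕ) : ℝ) = -1 by norm_num, Real.rpow_neg_one, one_div]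
  rw [e]
  rcases Nat.eq_zero_or_pos i with rfl | hi
  · simp
  · have hi0 : (0 : ℝ) < i := by exact_mod_cast hi
    have hi1 : (1 : ℝ) ≤ i := by exact_mod_cast hi
    push_cast
    rw [one_pow, one_mul, ← Real.log_div (by positivity) hi0.ne']
    have h1 := Real.log_le_sub_one_of_pos (show 0 < ((i : ℝ) + 1) / i by positivity)
    have h2 := Real.one_sub_inv_le_log_of_pos (show 0 < ((i : ℝ) + 1) / i by positivity)
    have h3 : ((i : ℝ) + 1) / i - 1 = 1 / i := by field_simp; ring
    have h4 : 1 - (((i : ℝ) + 1) / i)⁻¹ = 1 / ((i : ℝ) + 1) := by field_simp; ring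
    have h5 : 1 / (i : ℝ) - 1 / ((i : ℝ) + 1) ≤ 2 * (1 / ((i : ℝ) + 1)) / ((i : ℝ) + 1) := by
      rw [div_sub_div _ _ hi0.ne' (by positivity), mul_one_div, div_div, div_le_div_iff₀
        (by positivity) (by positivity)]
      nlinarith
    rw [abs_le]
    constructor
    · have : 0 ≤ 2 * (1 / ((i : ℝ) + 1)) / ((i : ℝ) + 1) := by positivity
      linarith
    · linarith

attribute [irreducible] blockTime

lemma centeredStep_congr {u : ℕ → Finset ℕ → ℝ} (hu : IsTransition u) {i M : ℕ} {g h : Finset ℕ}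
    (H : AgreeBelow M g h) (hi : i < M) : centeredStep u i g = centeredStep u i h := by
  rw [centeredStep, centeredStep, stepSign_congr H hi, hu.adapted i g h (H.mono hi.le)]

lemma blockSum_congr {u : ℕ → Finset ℕ → ℝ} (hu : IsTransition u) (c : ℕ → ℝ) {j L M : ℕ}
    {g h : Finset ℕ} (H : AgreeBelow M g h) (hM : j + L ≤ M) :
    blockSum u c j L g = blockSum u c j L h :=
  Finset.sum_congr rfl fun i hi => by
    rw [centeredStep_congr hu H ((Finset.mem_Ico.1 hi).2.trans_le hM)]

lemma sum_erwWeight_sq_le {p : ℝ} (hp0 : 0 ≤ p) (hp1 : p ≤ 1) {k n : ℕ}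
    (h : n ≤ blockTime (k + 1)) :
    ∑ i ∈ Finset.Ico (blockTime k) n, erwWeight p i ^ 2 ≤
      1023 * 1024 ^ 2 * (((k : ℝ) + 1) ^ 9 * blockWeight p k ^ 2) := by
  have hb := blockWeight_pos p k
  calc _ ≤ ∑ i ∈ Finset.Ico (blockTime k) (blockTime (k + 1)), erwWeight p i ^ 2 :=
        Finset.sum_le_sum_of_subset_of_nonneg (Finset.Ico_subset_Ico_right h)
          fun _ _ _ => sq_nonneg _
    _ ≤ ∑ i ∈ Finset.Ico (blockTime k) (blockTime (k + 1)), (1024 * blockWeight p k) ^ 2 :=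
        Finset.sum_le_sum fun i hi => pow_le_pow_left₀ (erwWeight_pos p i).le
          (erwWeight_le hp0 hp1 (Finset.mem_Ico.1 hi).1 (Finset.mem_Ico.1 hi).2) 2
    _ = ((blockTime (k + 1) - blockTime k : ℕ) : ℝ) * (1024 * blockWeight p k) ^ 2 := by
        rw [Finset.sum_const, Nat.card_Ico, nsmul_eq_mul]
    _ ≤ 1023 * ((k : ℝ) + 1) ^ 9 * (1024 * blockWeight p k) ^ 2 := by
        gcongr
        exact blockTime_card k
    _ = _ := by ring

lemma pathAvg_partial_block_le {p q : ℝ} (hp0 : 0 ≤ p) (hp1 : p ≤ 1) (hq0 : 0 ≤ q) (hq1 : q ≤ 1)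
    {k n : ℕ} (h1 : blockTime k ≤ n) (h2 : n ≤ blockTime (k + 1)) :
    pathAvg (erwProb p q) (blockTime (k + 1)) 0
        (fun g => blockSum (erwProb p q) (erwWeight p) (blockTime k) (n - blockTime k) g ^ 22) ∅ ≤
      ((22).factorial * (2 * Real.exp 4) * (1023 * 1024 ^ 2) ^ 11) *
        (((k : ℝ) + 1) ^ 9 * blockWeight p k ^ 2) ^ 11 := by
  have hu := isTransition_erwProb hp0 hp1 hq0 hq1
  have hb := blockWeight_pos p k
  have hn : blockTime k + (n - blockTime k) = n := by omega
  rw [pathAvg_of_agreeBelow hu h2 ∅ fun g g' hg => by rw [blockSum_congr hu _ hg hn.le]]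
  have e : n = blockTime k + (n - blockTime k) := hn.symm
  conv_lhs => rw [e]
  rw [pathAvg_comp]
  refine (pathAvg_mono hu _ _ _ fun g _ _ => ?_).trans (pathAvg_const (u := erwProb p q) _ _ _ _).le
  rw [zero_add, mul_assoc _ (_ ^ 11), ← mul_pow]
  have := pathAvg_blockSum_pow_le hu (erwWeight p) (n - blockTime k) (blockTime k) g 11
    (v := 1023 * 1024 ^ 2 * (((k : ℝ) + 1) ^ 9 * blockWeight p k ^ 2)) (by positivity)
    (by rw [hn]; exact sum_erwWeight_sq_le hp0 hp1 h2)
  simpa using this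

lemma clock_increment_le {p κ C : ℝ} (hp0 : 0 ≤ p) (hp1 : p ≤ 1) (hC : 0 ≤ C) {τ : ℕ → ℝ}
    (hs : ∀ i : ℕ, |κ ^ 2 * (τ (i + 1) - τ i) - erwWeight p i ^ 2| ≤
      C * erwWeight p i ^ 2 / (i + 1)) {k n : ℕ} (h1 : blockTime k ≤ n)
    (h2 : n ≤ blockTime (k + 1)) :
    κ ^ 2 * (τ n - τ (blockTime k)) ≤
      (1 + C) * (1023 * 1024 ^ 2) * (((k : ℝ) + 1) ^ 9 * blockWeight p k ^ 2) := by
  have e : κ ^ 2 * (τ n - τ (blockTime k)) =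
      ∑ i ∈ Finset.Ico (blockTime k) n, κ ^ 2 * (τ (i + 1) - τ i) := by
    rw [← Finset.mul_sum, Finset.sum_Ico_sub _ h1]
  rw [e, mul_assoc (1 + C)]
  refine le_trans ?_ (mul_le_mul_of_nonneg_left (sum_erwWeight_sq_le hp0 hp1 h2)
    (by linarith : 0 ≤ 1 + C))
  rw [Finset.mul_sum]
  refine Finset.sum_le_sum fun i _ => ?_
  have t1 := (abs_le.1 (hs i)).2
  have t2 : C * erwWeight p i ^ 2 / (i + 1) ≤ C * erwWeight p i ^ 2 :=
    div_le_self (by positivity) (by linarith [(Nat.cast_nonneg i : (0 : ℝ) ≤ i)])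
  linarith

lemma ae_brownian_block_bound {p κ C : ℝ} (hp0 : 0 ≤ p) (hp1 : p ≤ 1) (hC : 0 ≤ C) {τ : ℕ → ℝ}
    (hτ : Monotone τ) (hτ0 : 0 ≤ τ 0)
    (hs : ∀ i : ℕ, |κ ^ 2 * (τ (i + 1) - τ i) - erwWeight p i ^ 2| ≤
      C * erwWeight p i ^ 2 / (i + 1)) :
    ∀ᵐ ω ∂gaussianNoise, ∃ K, ∀ k n, blockTime k ≤ n → n < blockTime (k + 1) →
      |κ * (brownian (τ n) ω - brownian (τ (blockTime k)) ω)| ≤ K * blockScale p k := by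
  have ht0 : ∀ n, 0 ≤ τ n := fun n => hτ0.trans (hτ (Nat.zero_le n))
  have hm : 0 ≤ ∫ y, |y| ^ 22 ∂(gaussianReal 0 1) := integral_nonneg fun y => by positivity
  obtain ⟨V, hV0, hV⟩ : ∃ V : ℝ, 0 ≤ V ∧ ∀ k n, blockTime k ≤ n → n < blockTime (k + 1) →
      κ ^ 2 * (τ n - τ (blockTime k)) ≤ V * (((k : ℝ) + 1) ^ 9 * blockWeight p k ^ 2) :=
    ⟨_, by positivity, fun k n h1 h2 => clock_increment_le hp0 hp1 hC hs h1 h2.le⟩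
  refine ae_block_bound p (A := V ^ 11 *
    ∫ y, |y| ^ 22 ∂(gaussianReal 0 1)) (mul_nonneg (pow_nonneg hV0 _) hm)
    fun k n h1 h2 => ?_
  have hY : Measurable fun ω => κ * (brownian (τ n) ω - brownian (τ (blockTime k)) ω) :=
    ((measurable_brownian (τ n)).sub (measurable_brownian (τ (blockTime k)))).const_mul κ
  obtain ⟨i1, i2⟩ := integral_pow_gaussian_law hY
    (map_brownian_sub (ht0 (blockTime k)) (hτ h1) κ)
  refine ⟨i1, i2.le.trans ?_⟩
  have hv : 0 ≤ κ ^ 2 * (τ n - τ (blockTime k)) :=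
    mul_nonneg (sq_nonneg _) (sub_nonneg.2 (hτ h1))
  rw [Real.coe_toNNReal _ hv, mul_right_comm, ← mul_pow]
  exact mul_le_mul_of_nonneg_right (pow_le_pow_left₀ hv (hV k n h1 h2) 11) hm

lemma blockSum_eq_sum_blocks {u : ℕ → Finset ℕ → ℝ} (c : ℕ → ℝ) (k n : ℕ) (h : blockTime k ≤ n)
    (g : Finset ℕ) : blockSum u c 0 n g =
      ∑ l ∈ Finset.range k, blockSum u c (blockTime l) (blockTime (l + 1) - blockTime l) g +
        blockSum u c (blockTime k) (n - blockTime k) g := by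
  have hN := strictMono_blockTime
  have e : ∀ j m, j ≤ m → blockSum u c j (m - j) g =
      ∑ i ∈ Finset.Ico j m, c i * centeredStep u i g := fun j m hjm => by
    rw [blockSum, Nat.add_sub_cancel' hjm]
  have e0 : blockSum u c 0 n g = ∑ i ∈ Finset.Ico 0 n, c i * centeredStep u i g := by
    rw [blockSum, zero_add]
  rw [e0, e _ _ h, ← Finset.sum_Ico_consecutive _ (Nat.zero_le _) h]
  congr 1
  induction k with
  | zero => simp [blockTime_zero]
  | succ k ih =>
    have hk := hN.monotone (Nat.le_succ k)
    rw [Finset.sum_range_succ, ← ih (hk.trans h), e _ _ hk,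
      Finset.sum_Ico_consecutive _ (Nat.zero_le _) hk]

lemma exists_blockTime_le (n : ℕ) : ∃ k, blockTime k ≤ n ∧ n < blockTime (k + 1) := by
  have hN := strictMono_blockTime
  have hex : ∃ k, n < blockTime (k + 1) := ⟨n, (Nat.lt_succ_self n).trans_le (hN.le_apply)⟩
  refine ⟨Nat.find hex, ?_, Nat.find_spec hex⟩
  rcases Nat.eq_zero_or_pos (Nat.find hex) with h | h
  · rw [h, blockTime_zero]; exact Nat.zero_le n
  · have := Nat.find_min hex (Nat.sub_lt h one_pos)
    rwa [Nat.sub_add_cancel (n := Nat.find hex) (m := 1) h, not_lt] at this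

/-- Strong approximation of the elephant random walk by a time-changed Brownian motion. -/
theorem exists_erw_brownian_bound {p q κ C : ℝ} (hp0 : 0 ≤ p) (hp1 : p ≤ 3 / 4) (hq0 : 0 ≤ q)
    (hq1 : q ≤ 1) (hC : 0 ≤ C) {τ : ℕ → ℝ} (hτ : Monotone τ) (hτ0 : 0 ≤ τ 0)
    (hpos : ∀ i, 1 ≤ i → 0 < κ ^ 2 * (τ (i + 1) - τ i))
    (hs : ∀ i : ℕ, |κ ^ 2 * (τ (i + 1) - τ i) - erwWeight p i ^ 2| ≤
      C * erwWeight p i ^ 2 / (i + 1)) :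
    ∃ X : ℕ → (ℕ × ℕ → ℝ) → ℤ, IsERW gaussianNoise p q X ∧ ∀ᵐ ω ∂gaussianNoise, ∃ K, ∀ n : ℕ,
      1 ≤ n → |((∑ i ∈ Finset.range n, X i ω : ℤ) : ℝ) -
        (n : ℝ) ^ (2 * p - 1) * (κ * brownian (τ n) ω)| ≤ K * √n := by
  have hp1' : p ≤ 1 := by linarith
  have hu := isTransition_erwProb hp0 hp1' hq0 hq1
  have hN := strictMono_blockTime
  have ht0 : ∀ n, 0 ≤ τ n := fun n => hτ0.trans (hτ (Nat.zero_le n))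
  obtain ⟨H, hERW, hagree, hlaw, hgap⟩ := exists_erw_histories hp0 hp1' hq0 hq1 hτ hτ0 hpos
  refine ⟨_, hERW, ?_⟩
  obtain ⟨A, hA⟩ := exists_pathAvg_lindebergError_le (s := incrVar κ τ) hp0 hp1 hq0 hq1 hC
    fun i => by rw [coe_incrVar hτ]; exact hs i
  obtain ⟨Kd, hKd0, hKd⟩ := exists_drift_sum_le hp0 hp1
  set D : ℕ → (ℕ × ℕ → ℝ) → ℝ := fun k ω => blockSum (erwProb p q) (erwWeight p) (blockTime k)
    (blockTime (k + 1) - blockTime k) (H (k + 1) ω) -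
      κ * (brownian (τ (blockTime (k + 1))) ω - brownian (τ (blockTime k)) ω) with hD
  have hA' : ∀ k, ∫ ω, |D k ω| ∂gaussianNoise ≤ A * (((k : ℝ) + 1) ^ 3 * blockWeight p k) :=
    fun k => ((hgap k).2 _ (mul_pos (by positivity) (blockWeight_pos p k))).trans (hA k _ rfl)
  have hgapae : ∀ᵐ ω ∂gaussianNoise, Summable fun k => |D k ω| / blockScale p k := by
    refine ae_summable_of_summable_integral _
      (fun k ω => div_nonneg (abs_nonneg _) (blockScale_pos p k).le)
      (fun k => (hgap k).1.div_const _) ?_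
    refine Summable.of_nonneg_of_le
      (fun k => integral_nonneg fun ω => div_nonneg (abs_nonneg _) (blockScale_pos p k).le)
      (fun k => ?_) (summable_one_div_succ_sq A)
    have hb := blockWeight_pos p k
    rw [integral_div]
    refine (div_le_div_of_nonneg_right (hA' k) (blockScale_pos p k).le).trans (le_of_eq ?_)
    rw [blockScale]
    field_simp
  have hwalk : ∀ᵐ ω ∂gaussianNoise, ∃ K, ∀ k n, blockTime k ≤ n → n < blockTime (k + 1) →
      |blockSum (erwProb p q) (erwWeight p) (blockTime k) (n - blockTime k) (H (k + 1) ω)| ≤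
        K * blockScale p k :=
    ae_block_bound p (A := (22).factorial * (2 * Real.exp 4) * (1023 * 1024 ^ 2) ^ 11)
      (by positivity) fun k n h1 h2 => by
        obtain ⟨i1, i2⟩ := hlaw (k + 1) fun g => blockSum (erwProb p q) (erwWeight p)
          (blockTime k) (n - blockTime k) g ^ 22
        exact ⟨i1, i2.le.trans (pathAvg_partial_block_le hp0 hp1' hq0 hq1 h1 h2.le)⟩
  have hbrown := ae_brownian_block_bound hp0 hp1' hC hτ hτ0 hs
  filter_upwards [hgapae, hwalk, hbrown] with ω hsum ⟨Kw, hKw⟩ ⟨Kb, hKb⟩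
  set T := ∑' k, |D k ω| / blockScale p k with hT
  have hT0 : 0 ≤ T := tsum_nonneg fun k => div_nonneg (abs_nonneg _) (blockScale_pos p k).le
  have hgapsum : ∀ k, |∑ l ∈ Finset.range k, D l ω| ≤ T * blockScale p k := fun k => by
    calc |∑ l ∈ Finset.range k, D l ω| ≤ ∑ l ∈ Finset.range k, |D l ω| :=
          Finset.abs_sum_le_sum_abs _ _
      _ ≤ ∑ l ∈ Finset.range k, |D l ω| / blockScale p l * blockScale p k := by
          refine Finset.sum_le_sum fun l hl => ?_
          rw [div_mul_eq_mul_div, le_div_iff₀ (blockScale_pos p l)]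
          exact mul_le_mul_of_nonneg_left
            (monotone_blockScale hp1 (Finset.mem_range.1 hl).le) (abs_nonneg _)
      _ ≤ _ := by
          rw [← Finset.sum_mul]
          exact mul_le_mul_of_nonneg_right (hsum.sum_le_tsum _ fun k _ =>
            div_nonneg (abs_nonneg _) (blockScale_pos p k).le) (blockScale_pos p k).le
  set W := |2 * q - 1| + |κ * brownian (τ 0) ω| with hW
  have hW0 : 0 ≤ W := by positivity
  refine ⟨W + 4 * (T + |Kw| + |Kb|) + Kd, fun n hn => ?_⟩
  have hn0 : (1 : ℝ) ≤ n := by exact_mod_cast hn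
  have hnpos : (0 : ℝ) < n := by linarith
  obtain ⟨k, h1, h2⟩ := exists_blockTime_le n
  have hkn : k ≤ n := (hN.le_apply).trans h1
  set g := H (k + 1) ω with hg
  have hX : ((∑ i ∈ Finset.range n, (if i ∈ H (i + 1) ω then 1 else -1) : ℤ) : ℝ) =
      walkSum n g := by
    rw [walkSum]
    push_cast
    refine Finset.sum_congr rfl fun i hi => ?_
    have hin := Finset.mem_range.1 hi
    have h3 : i < blockTime (i + 1) := (Nat.lt_succ_self i).trans_le hN.le_apply
    have h4 : i < blockTime (k + 1) := hin.trans h2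
    have : i ∈ H (i + 1) ω ↔ i ∈ g := by
      rcases le_total i k with h | h
      · exact (hagree (i + 1) (k + 1) (by omega) ω i h3).symm
      · exact hagree (k + 1) (i + 1) (by omega) ω i h4
    simp only [stepSign, this]
  have hblocks : blockSum (erwProb p q) (erwWeight p) 0 n g - κ * brownian (τ n) ω =
      ∑ l ∈ Finset.range k, D l ω +
        blockSum (erwProb p q) (erwWeight p) (blockTime k) (n - blockTime k) g -
        κ * (brownian (τ n) ω - brownian (τ (blockTime k)) ω) - κ * brownian (τ 0) ω := by
    have e1 : ∑ l ∈ Finset.range k, D l ω = ∑ l ∈ Finset.range k,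
        blockSum (erwProb p q) (erwWeight p) (blockTime l) (blockTime (l + 1) - blockTime l) g -
          κ * (brownian (τ (blockTime k)) ω - brownian (τ (blockTime 0)) ω) := by
      rw [← Finset.sum_range_sub (fun l => brownian (τ (blockTime l)) ω), Finset.mul_sum,
        ← Finset.sum_sub_distrib]
      refine Finset.sum_congr rfl fun l hl => ?_
      have hlk := Finset.mem_range.1 hl
      rw [hD]
      simp only
      rw [blockSum_congr hu _ (hagree (l + 1) (k + 1) (by omega) ω)
        (Nat.add_sub_cancel' (hN.monotone (Nat.le_succ l))).le]
    rw [blockSum_eq_sum_blocks _ k n h1, e1, blockTime_zero]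
    ring
  have hscale : blockScale p k ≤ 4 * (n : ℝ) ^ (1 / 2 - (2 * p - 1)) := by
    refine (blockScale_le hp1 h1).trans ?_
    calc ((n : ℝ) + 1) ^ (1 / 2 - (2 * p - 1)) ≤ (2 * (n : ℝ)) ^ (1 / 2 - (2 * p - 1)) :=
          Real.rpow_le_rpow (by positivity) (by linarith) (by linarith)
      _ = 2 ^ (1 / 2 - (2 * p - 1)) * (n : ℝ) ^ (1 / 2 - (2 * p - 1)) :=
          Real.mul_rpow (by norm_num) hnpos.le
      _ ≤ 2 ^ (2 : ℝ) * (n : ℝ) ^ (1 / 2 - (2 * p - 1)) := by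
          gcongr
          · norm_num
          · linarith
      _ = _ := by norm_num
  have hone : (1 : ℝ) ≤ (n : ℝ) ^ (1 / 2 - (2 * p - 1)) := Real.one_le_rpow hn0 (by linarith)
  set R := (n : ℝ) ^ (1 / 2 - (2 * p - 1)) with hR
  have hbound : |(n : ℝ) ^ (-(2 * p - 1)) * walkSum n g - κ * brownian (τ n) ω| ≤
      (W + 4 * (T + |Kw| + |Kb|) + Kd) * R := by
    have hdec := walkSum_decomposition p q n hn g
    have hdrift := hKd n g
    set E := ∑ j ∈ Finset.Ico 1 n, ((1 + (2 * p - 1) / j) *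
      ((j : ℝ) + 1) ^ (-(2 * p - 1)) - (j : ℝ) ^ (-(2 * p - 1))) * walkSum j g with hE
    have e : (n : ℝ) ^ (-(2 * p - 1)) * walkSum n g - κ * brownian (τ n) ω =
        (2 * q - 1) + (∑ l ∈ Finset.range k, D l ω +
        blockSum (erwProb p q) (erwWeight p) (blockTime k) (n - blockTime k) g -
        κ * (brownian (τ n) ω - brownian (τ (blockTime k)) ω) - κ * brownian (τ 0) ω) + E := by
      rw [hdec, ← hblocks]
      change _ + blockSum (erwProb p q) (erwWeight p) 0 n g + _ - _ = _
      ring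
    have s0 := blockScale_pos p k
    have b1 : |∑ l ∈ Finset.range k, D l ω| ≤ T * (4 * R) :=
      (hgapsum k).trans (mul_le_mul_of_nonneg_left hscale hT0)
    have b2 : |blockSum (erwProb p q) (erwWeight p) (blockTime k) (n - blockTime k) g| ≤
        |Kw| * (4 * R) := (hKw k n h1 h2).trans
      (mul_le_mul (le_abs_self _) hscale s0.le (abs_nonneg _))
    have b3 : |κ * (brownian (τ n) ω - brownian (τ (blockTime k)) ω)| ≤ |Kb| * (4 * R) :=
      (hKb k n h1 h2).trans (mul_le_mul (le_abs_self _) hscale s0.le (abs_nonneg _))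
    have b4 : W ≤ W * R := le_mul_of_one_le_right hW0 hone
    rw [e]
    rw [hW] at b4 ⊢
    refine abs_le.2 ⟨?_, ?_⟩ <;>
      linarith [abs_le.1 b1, abs_le.1 b2, abs_le.1 b3, abs_le.1 hdrift, le_abs_self (2 * q - 1),
        neg_abs_le (2 * q - 1), le_abs_self (κ * brownian (τ 0) ω),
        neg_abs_le (κ * brownian (τ 0) ω)]
  have hpow : 0 < (n : ℝ) ^ (2 * p - 1) := Real.rpow_pos_of_pos hnpos _
  have e5 : ((∑ i ∈ Finset.range n, (if i ∈ H (i + 1) ω then 1 else -1) : ℤ) : ℝ) -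
      (n : ℝ) ^ (2 * p - 1) * (κ * brownian (τ n) ω) = (n : ℝ) ^ (2 * p - 1) *
        ((n : ℝ) ^ (-(2 * p - 1)) * walkSum n g - κ * brownian (τ n) ω) := by
    rw [hX, mul_sub, ← mul_assoc _ _ (walkSum n g), ← Real.rpow_add hnpos, add_neg_cancel,
      Real.rpow_zero, one_mul]
  have e6 : (n : ℝ) ^ (2 * p - 1) * R = √n := by
    rw [hR, ← Real.rpow_add hnpos, Real.sqrt_eq_rpow]
    congr 1
    ring
  rw [e5, abs_mul, abs_of_pos hpow]
  calc _ ≤ (n : ℝ) ^ (2 * p - 1) * ((W + 4 * (T + |Kw| + |Kb|) + Kd) * R) :=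
        mul_le_mul_of_nonneg_left hbound hpow.le
    _ = _ := by rw [← e6]; ring

lemma isLittleO_sqrt_mul_of_abs_le {f g : ℕ → ℝ} {K : ℝ} (hf : ∀ n : ℕ, 1 ≤ n → |f n| ≤ K * √n)
    (hg : Tendsto g atTop atTop) : f =o[atTop] fun n : ℕ => √(n * g n) := by
  have h1 : f =O[atTop] fun n : ℕ => √(n : ℝ) * 1 := IsBigO.of_bound K <| by
    filter_upwards [eventually_ge_atTop 1] with n hn
    simpa [abs_of_nonneg (Real.sqrt_nonneg _)] using hf n hn
  have h2 : (fun _ : ℕ => (1 : ℝ)) =o[atTop] fun n => √(g n) :=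
    (isLittleO_const_left.2 <| Or.inr <| tendsto_norm_atTop_atTop.comp
      (Real.tendsto_sqrt_atTop.comp hg))
  have h3 := (isBigO_refl (fun n : ℕ => √(n : ℝ)) atTop).mul_isLittleO h2
  refine (h1.trans_isLittleO h3).congr_right fun n => ?_
  rw [Real.sqrt_mul (Nat.cast_nonneg n)]

/-- Lemma 1 (Coletti–Gava–Schütz): there is a probability space carrying an ERW with
parameters `p, q` together with a standard Brownian motion such that
(a) if `0 < p < 3/4` then a.s. `S_n - (n^{2p-1}/√(3-4p)) B(n^{3-4p}) = o(√(n log log n))`;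
(b) if `p = 3/4` then a.s. `S_n - √n B(log n) = o(√(n log n log log log n))`. -/
theorem erw_brownian_coupling (p q : ℝ) (hp0 : 0 < p) (hp1 : p < 1)
    (hq0 : 0 ≤ q) (hq1 : q ≤ 1) :
    ∃ (Ω : Type) (_ : MeasurableSpace Ω) (P : Measure Ω)
      (X : ℕ → Ω → ℤ) (B : ℝ → Ω → ℝ),
      IsProbabilityMeasure P ∧ IsERW P p q X ∧ IsStandardBM P B ∧
      (p < 3 / 4 →
        ∀ᵐ ω ∂P,
          (fun n : ℕ =>
              ((∑ i ∈ Finset.range n, X i ω : ℤ) : ℝ)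
                - (n : ℝ) ^ (2 * p - 1) / Real.sqrt (3 - 4 * p)
                    * B ((n : ℝ) ^ (3 - 4 * p)) ω)
            =o[atTop] fun n : ℕ => Real.sqrt (n * Real.log (Real.log n))) ∧
      (p = 3 / 4 →
        ∀ᵐ ω ∂P,
          (fun n : ℕ =>
              ((∑ i ∈ Finset.range n, X i ω : ℤ) : ℝ)
                - Real.sqrt n * B (Real.log n) ω)
            =o[atTop] fun n : ℕ =>
              Real.sqrt (n * Real.log n * Real.log (Real.log (Real.log n)))) := by
  have hlog : Tendsto (fun n : ℕ => Real.log n) atTop atTop :=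
    Real.tendsto_log_atTop.comp tendsto_natCast_atTop_atTop
  rcases lt_trichotomy p (3 / 4) with h | h | h
  · have hγ : 0 < 3 - 4 * p := by linarith
    obtain ⟨C, hC, hs⟩ := exists_rpow_clock_bound hp0 h
    have hmono : StrictMono fun n : ℕ => (n : ℝ) ^ (3 - 4 * p) := fun a b hab =>
      Real.rpow_lt_rpow (Nat.cast_nonneg a) (Nat.cast_lt.2 hab) hγ
    obtain ⟨X, hX, hb⟩ := exists_erw_brownian_bound (q := q) (κ := 1 / √(3 - 4 * p)) hp0.le h.le
      hq0 hq1 hC hmono.monotone (by positivity)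
      (fun i _ => mul_pos (by positivity) (sub_pos.2 (hmono (Nat.lt_succ_self i)))) hs
    refine ⟨_, _, gaussianNoise, X, brownian, inferInstance, hX, isStandardBM_brownian,
      fun _ => ?_, fun h' => absurd h' h.ne⟩
    filter_upwards [hb] with ω ⟨K, hK⟩
    refine isLittleO_sqrt_mul_of_abs_le (K := K) (fun n hn => ?_)
      (Real.tendsto_log_atTop.comp hlog)
    convert hK n hn using 3
    ring
  · have hmono : Monotone fun n : ℕ => Real.log n := fun a b hab => by
      rcases Nat.eq_zero_or_pos a with rfl | ha
      · simpa using Real.log_natCast_nonneg b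
      · exact Real.log_le_log (Nat.cast_pos.2 ha) (Nat.cast_le.2 hab)
    obtain ⟨X, hX, hb⟩ := exists_erw_brownian_bound (p := p) (q := q) (κ := 1) (C := 2) hp0.le
      h.le hq0 hq1 (by norm_num) hmono (by simp)
      (fun i hi => mul_pos (by positivity) (sub_pos.2
        (Real.log_lt_log (Nat.cast_pos.2 hi) (Nat.cast_lt.2 (Nat.lt_succ_self i)))))
      (fun i => h ▸ log_clock_bound i)
    refine ⟨_, _, gaussianNoise, X, brownian, inferInstance, hX, isStandardBM_brownian,
      fun h' => absurd h h'.ne, fun _ => ?_⟩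
    filter_upwards [hb] with ω ⟨K, hK⟩
    have key := isLittleO_sqrt_mul_of_abs_le (K := K) (f := fun n : ℕ =>
      ((∑ i ∈ Finset.range n, X i ω : ℤ) : ℝ) - Real.sqrt n * brownian (Real.log n) ω)
      (fun n hn => ?_)
      (hlog.atTop_mul_atTop₀ (Real.tendsto_log_atTop.comp (Real.tendsto_log_atTop.comp hlog)))
    · simpa only [mul_assoc, Function.comp_def] using key
    · convert hK n hn using 3
      rw [one_mul, Real.sqrt_eq_rpow, h]
      norm_num
  · obtain ⟨H, hX, -⟩ := exists_erw_histories (q := q) (κ := 1) (τ := fun n : ℕ => (n : ℝ)) hp0.le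
      hp1.le hq0 hq1 Nat.mono_cast (by simp) (fun i _ => by simp)
    exact ⟨_, _, gaussianNoise, _, brownian, inferInstance, hX, isStandardBM_brownian,
      fun h' => absurd h h'.not_gt, fun h' => absurd h' h.ne'⟩
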